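/- Let (ψ_0, ψ) and (φ_0, φ) be two pairs of functions in 𝒮(ℝⁿ), each pair satisfying the Tauberian conditions (for constants ε_ψ > 0 and ε_φ > 0 respectively), and suppose ψ satisfies the moment condition of order M_ψ ≥ −1. Let 0 < p_i < ∞ (i = 1,…,n), 0 < q ≤ ∞, and let s ∈ ℝ with s < (M_ψ+1)·a_0. Then there exists a constant c > 0 such that for every f ∈ 𝒮′(ℝⁿ): ‖(2^{sj} ψ_j*f)_{j≥0} | L_{p̄}(ℓ_q)‖ ≤ c·‖(2^{sj} φ_j*f)_{j≥0} | L_{p̄}(ℓ_q)‖. In particular, if in addition φ satisfies the moment condition of order M_φ with s < (M_φ+1)·a_0, then the two quasi-norms ‖(2^{sj} ψ_j*f)_j | L_{p̄}(ℓ_q)‖ and ‖(2^{sj} φ_j*f)_j | L_{p̄}(ℓ_q)‖ are equivalent on 𝒮′(ℝⁿ); one is finite if and only if the other is. -/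

import Mathlib

open MeasureTheory Complex
open scoped ENNReal NNReal BigOperators

noncomputable section

/-- Points of `ℝⁿ`, written `x = (x 0, …, x (n-1))`. -/
abbrev RV (n : ℕ) := Fin n → ℝ

/-- Tempered distributions `𝒮′(ℝⁿ)`. -/
abbrev TD (n : ℕ) := SchwartzMap (RV n) ℂ →L[ℂ] ℂ

/-- The Fourier transform `𝓕g(ξ) = ∫ e^{-i x·ξ} g(x) dx`. -/
def FT (n : ℕ) (g : RV n → ℂ) (ξ : RV n) : ℂ :=
  ∫ x : RV n, Complex.exp (-Complex.I * ((∑ i, x i * ξ i : ℝ) : ℂ)) * g x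

/-- The partial derivative `∂_i`. -/
def pderiv1 (n : ℕ) (i : Fin n) (g : RV n → ℂ) : RV n → ℂ :=
  fun x => fderiv ℝ g x (Pi.single i 1)

def pderivIter (n : ℕ) (i : Fin n) : ℕ → (RV n → ℂ) → RV n → ℂ
  | 0, g => g
  | k + 1, g => pderiv1 n i (pderivIter n i k g)

/-- `D^α = (-i ∂_1)^{α_1} ⋯ (-i ∂_n)^{α_n}`. -/
def Dop (n : ℕ) (α : Fin n → ℕ) (g : RV n → ℂ) : RV n → ℂ :=
  fun x => (-Complex.I) ^ (∑ i, α i) *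
    ((List.finRange n).foldr (fun i h => pderivIter n i (α i) h) g) x

/-- `anorm` is the anisotropic distance function `|·|_a` :
`anorm 0 = 0`, and for `x ≠ 0`, `anorm x` is the (unique) `t > 0` with
`x 1 ^ 2 / t ^ (2 a 1) + … + x n ^ 2 / t ^ (2 a n) = 1`. -/
def IsAnorm (n : ℕ) (a : Fin n → ℝ) (anorm : RV n → ℝ) : Prop :=
  anorm 0 = 0 ∧
    ∀ x : RV n, x ≠ 0 → 0 < anorm x ∧ ∑ i, (x i : ℝ) ^ 2 / (anorm x) ^ (2 * a i) = 1

/-- Moment condition of order `M` : `D^α (𝓕ψ)(0) = 0` for all `|α| ≤ M` (void for `M = -1`). -/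
def MomentCond (n : ℕ) (M : ℤ) (ψ : RV n → ℂ) : Prop :=
  ∀ α : Fin n → ℕ, (∑ i, (α i : ℤ)) ≤ M → Dop n α (FT n ψ) 0 = 0

/-- Tauberian conditions for `ε > 0` for the pair `(ψ0, ψ)`. -/
def Tauber (n : ℕ) (anorm : RV n → ℝ) (ψ0 ψ : RV n → ℂ) (ε : ℝ) : Prop :=
  (∀ ξ, anorm ξ < 2 * ε → 0 < ‖FT n ψ0 ξ‖) ∧
    (∀ ξ, ε / 2 < anorm ξ → anorm ξ < 2 * ε → 0 < ‖FT n ψ ξ‖)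

/-- The family `φ_j`, `φ_0` at `j = 0` and `φ_j(x) = 2^{j|a|} φ(2^{ja}x)` for `j ≥ 1`. -/
def fam (n : ℕ) (a : Fin n → ℝ) (φ0 φ : RV n → ℂ) : ℕ → RV n → ℂ
  | 0 => φ0
  | j + 1 => fun x =>
      (((2 : ℝ) ^ (((j : ℝ) + 1) * ∑ i, a i) : ℝ) : ℂ) *
        φ (fun i => (2 : ℝ) ^ (((j : ℝ) + 1) * a i) * x i)

/-- Peetre–Fefferman–Stein maximal function attached to the function `F` (intended: `F = ψ_j * f`). -/
def pfs (n : ℕ) (a r : Fin n → ℝ) (F : RV n → ℂ) (j : ℕ) (x : RV n) : ℝ≥0∞ :=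
  ⨆ y : RV n,
    ENNReal.ofReal (‖F y‖ / ∏ l, (1 + (2 : ℝ) ^ ((j : ℝ) * a l) * |x l - y l|) ^ (r l))

/-- Iterated-integral construction of the mixed Lebesgue norm : integrate out the
coordinates one at a time, first `x 0`, last `x (n-1)`. -/
def mixAux (n : ℕ) (p : Fin n → ℝ≥0∞) : ℕ → ((RV n) → ℝ≥0∞) → (RV n) → ℝ≥0∞
  | 0, F => F
  | l + 1, F => fun x =>
      if h : l < n then
        (if p ⟨l, h⟩ = ∞ then
          essSup (fun t : ℝ => mixAux n p l F (Function.update x ⟨l, h⟩ t)) volume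
        else
          (∫⁻ t : ℝ, (mixAux n p l F (Function.update x ⟨l, h⟩ t)) ^ (p ⟨l, h⟩).toReal) ^
            (1 / (p ⟨l, h⟩).toReal))
      else mixAux n p l F x

/-- The mixed Lebesgue quasi-norm `‖F | L_{p̄}‖` of an extended-nonnegative-valued `F`. -/
def mixedNorm (n : ℕ) (p : Fin n → ℝ≥0∞) (F : RV n → ℝ≥0∞) : ℝ≥0∞ :=
  mixAux n p n F fun _ => 0

/-- `‖(u_k) | L_{p̄}(ℓ_q)‖`. -/
def seqNorm (n : ℕ) (p : Fin n → ℝ≥0∞) (q : ℝ≥0∞) (u : ℕ → RV n → ℝ≥0∞) : ℝ≥0∞ :=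
  mixedNorm n p fun x =>
    if q = ∞ then ⨆ k, u k x else (∑' k, u k x ^ q.toReal) ^ (1 / q.toReal)

/-- Convolution of (Schwartz) functions. -/
def conv2 (n : ℕ) (f g : RV n → ℂ) (x : RV n) : ℂ := ∫ y : RV n, f y * g (x - y)

/-- Schwartz seminorm `p_{α,β}(φ) = sup_x |x^α D^β φ(x)|`, valued in `[0,∞]`. -/
def pSemiE (n : ℕ) (α β : Fin n → ℕ) (g : RV n → ℂ) : ℝ≥0∞ :=
  ⨆ x : RV n, (‖((∏ i, x i ^ α i : ℝ) : ℂ) * Dop n β g x‖₊ : ℝ≥0∞)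

/-- Schwartz seminorm `q_{N,γ}(φ) = ∫ (1+|x|²)^{N/2} |D^γ φ(x)| dx`, valued in `[0,∞]`. -/
def qSemiE (n : ℕ) (N : ℝ) (γ : Fin n → ℕ) (g : RV n → ℂ) : ℝ≥0∞ :=
  ∫⁻ x : RV n, ENNReal.ofReal ((1 + ∑ i, (x i) ^ 2) ^ (N / 2)) * (‖Dop n γ g x‖₊ : ℝ≥0∞)

/-- Iterated Laplacian `Δ^N`. -/
def lapIter (n : ℕ) : ℕ → (RV n → ℂ) → RV n → ℂ
  | 0, g => g
  | N + 1, g => fun x => ∑ i, pderiv1 n i (pderiv1 n i (lapIter n N g)) x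

/-- The box `B_{R,j} = {ξ : |ξ_k| ≤ R 2^{j a_k}}`. -/
def specBox (n : ℕ) (a : Fin n → ℝ) (R : ℝ) (j : ℕ) : Set (RV n) :=
  {ξ | ∀ k, |ξ k| ≤ R * (2 : ℝ) ^ ((j : ℝ) * a k)}

/-- The spectral condition `supp 𝓕u ⊆ B_{R,j}` for a temperate-growth function `u`. -/
def SpecCond (n : ℕ) (a : Fin n → ℝ) (R : ℝ) (j : ℕ) (u : RV n → ℂ) : Prop :=
  ∀ φ : SchwartzMap (RV n) ℂ,
    tsupport (⇑φ) ∩ specBox n a R j = ∅ → (∫ x : RV n, u x * FT n (⇑φ) x) = 0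

/-- The maximal function `u^*` of Section 3. -/
def ustar (n : ℕ) (a r : Fin n → ℝ) (R : ℝ) (j : ℕ) (u : RV n → ℂ) (x : RV n) : ℝ≥0∞ :=
  ⨆ y : RV n,
    ENNReal.ofReal (‖u y‖ / ∏ l, (1 + R * (2 : ℝ) ^ ((j : ℝ) * a l) * |x l - y l|) ^ (r l))

set_option linter.all false
set_option linter.deprecated false


lemma absorb {X Γ K : ℝ≥0∞} {θ : ℝ} (h0 : 0 < θ) (h1 : θ < 1) (hX : X ≠ ∞)
    (h : X ≤ K * Γ ^ θ * X ^ (1 - θ)) : X ≤ K ^ (1 / θ) * Γ := by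
  by_cases hX0 : X = 0
  · simp [hX0]
  have h2 : X ^ θ ≤ K * Γ ^ θ := by
    have : X ^ θ * X ^ (1 - θ) ≤ K * Γ ^ θ * X ^ (1 - θ) := by
      rw [← ENNReal.rpow_add _ _ hX0 hX]; simpa using h
    exact (ENNReal.mul_le_mul_iff_left (by simp [hX0, hX]) (by simp [hX0, hX])).1 this
  calc X = (X ^ θ) ^ (1 / θ) := by rw [← ENNReal.rpow_mul]; simp [h0.ne']
    _ ≤ (K * Γ ^ θ) ^ (1 / θ) := by gcongr
    _ = _ := by
      rw [ENNReal.mul_rpow_of_nonneg _ _ (by positivity), ← ENNReal.rpow_mul]; simp [h0.ne']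

lemma layer {α : Type*} [MeasurableSpace α] (μ : Measure α) {F : α → ℝ≥0∞} (hF : Measurable F)
    {L p : ℝ} (hp : 0 < p) (hL : 0 < L) :
    ∫⁻ x, (min (F x) (ENNReal.ofReal L)) ^ p ∂μ =
      ENNReal.ofReal p * ∫⁻ t in Set.Ioo 0 L, μ {x | ENNReal.ofReal t < F x} *
        ENNReal.ofReal (t ^ (p - 1)) := by
  set f : α → ℝ := fun x => (min (F x) (ENNReal.ofReal L)).toReal
  have hfin : ∀ x, min (F x) (ENNReal.ofReal L) ≠ ∞ := fun x =>
    (lt_of_le_of_lt (min_le_right _ _) ENNReal.ofReal_lt_top).ne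
  have h1 : ∀ x, (min (F x) (ENNReal.ofReal L)) ^ p = ENNReal.ofReal (f x ^ p) := by
    intro x
    rw [← ENNReal.ofReal_rpow_of_nonneg ENNReal.toReal_nonneg hp.le, ENNReal.ofReal_toReal (hfin x)]
  simp_rw [h1]
  rw [lintegral_rpow_eq_lintegral_meas_lt_mul μ (f := f) (Filter.Eventually.of_forall fun x => ENNReal.toReal_nonneg)
    (by fun_prop) hp]
  congr 1
  rw [← Set.Ioi_inter_Iio, Set.inter_comm, ← Measure.restrict_restrict measurableSet_Iio,
    ← lintegral_indicator measurableSet_Iio]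
  refine setLIntegral_congr_fun measurableSet_Ioi fun t ht => ?_
  have h0 : (0:ℝ) ≤ t := (Set.mem_Ioi.1 ht).le
  by_cases htL : t < L
  · simp only [Set.indicator, Set.mem_Iio, htL, if_true]
    congr 3 with x
    rw [← ENNReal.ofReal_lt_iff_lt_toReal h0 (hfin x)]
    simp [ENNReal.ofReal_lt_ofReal_iff hL, htL]
  · simp only [Set.indicator, Set.mem_Iio, htL, if_false]
    have : {a | t < f a} = ∅ := by
      ext x
      simp only [Set.mem_ofPred_eq, Set.mem_empty_iff_false, iff_false, not_lt]
      refine le_trans (ENNReal.toReal_mono ENNReal.ofReal_ne_top (min_le_right _ _)) ?_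
      rw [ENNReal.toReal_ofReal hL.le]; linarith
    simp [this]

lemma LC {p0 p A : ℝ} (hp0 : 0 < p0) (hp : p0 < p) (hA : 1 ≤ A) (C : ℝ≥0∞) (hC : C ≠ ∞) :
    ∃ K : ℝ≥0∞, K ≠ ∞ ∧ ∀ {α : Type} [MeasurableSpace α] (μ : Measure α) [IsFiniteMeasure μ]
      {F G : α → ℝ≥0∞}, Measurable F → Measurable G →
      (∀ t : ℝ, 0 < t → ENNReal.ofReal t ^ p0 * μ {x | ENNReal.ofReal (A * t) < F x} ≤
        C * ∫⁻ x in {x | ENNReal.ofReal t < F x}, G x ∂μ) →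
      ∫⁻ x, F x ^ p ∂μ ≤ K * ∫⁻ x, G x ^ (p / p0) ∂μ := by
  have hpp : 0 < p := hp0.trans hp
  have hA0 : 0 < A := by linarith
  have hd : 0 < p - p0 := by linarith
  set K0 : ℝ≥0∞ := ENNReal.ofReal p * ENNReal.ofReal (A ^ p) * C * (ENNReal.ofReal (p - p0))⁻¹ with hK0
  have hK0t : K0 ≠ ∞ := by
    rw [hK0]
    refine ENNReal.mul_ne_top (ENNReal.mul_ne_top (ENNReal.mul_ne_top (by simp) (by simp)) hC) ?_
    simp [hp]
  refine ⟨K0 ^ (1 / (p0 / p)), ENNReal.rpow_ne_top_of_nonneg (by positivity) hK0t, ?_⟩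
  clear_value K0
  intro α _ μ _ F G hF hG hyp
  have key : ∀ L : ℝ, 0 < L → ∫⁻ x, (min (F x) (ENNReal.ofReal (A * L))) ^ p ∂μ ≤
      K0 ^ (1 / (p0 / p)) * ∫⁻ x, G x ^ (p / p0) ∂μ := by
    intro L hL
    refine absorb (θ := p0 / p) (by positivity) ((div_lt_one hpp).2 hp) ?_ ?_
    · refine ne_of_lt (lt_of_le_of_lt (lintegral_mono fun x => ENNReal.rpow_le_rpow (min_le_right _ _) hpp.le) ?_)
      simp only [lintegral_const]
      exact ENNReal.mul_lt_top (by simp [ENNReal.rpow_lt_top_of_nonneg hpp.le]) (measure_lt_top _ _)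
    have e1 : ∫⁻ x, (min (F x) (ENNReal.ofReal (A * L))) ^ p ∂μ ≤
        K0 * ∫⁻ x, G x * (min (F x) (ENNReal.ofReal L)) ^ (p - p0) ∂μ := by
      have hs : ∀ x, min (F x) (ENNReal.ofReal (A * L)) =
          ENNReal.ofReal A * min (F x / ENNReal.ofReal A) (ENNReal.ofReal L) := by
        intro x
        have : ENNReal.ofReal A * (F x / ENNReal.ofReal A) = F x :=
          ENNReal.mul_div_cancel (by simp [hA0]) (by simp)
        rw [(mul_right_mono (a := ENNReal.ofReal A)).map_min, this, ENNReal.ofReal_mul hA0.le]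
      simp_rw [hs, ENNReal.mul_rpow_of_nonneg _ _ hpp.le]
      rw [lintegral_const_mul _ (by fun_prop), layer μ (by fun_prop) hpp hL]
      have hw : ∫⁻ x, G x * (min (F x) (ENNReal.ofReal L)) ^ (p - p0) ∂μ =
          ∫⁻ x, (min (F x) (ENNReal.ofReal L)) ^ (p - p0) ∂(μ.withDensity G) := by
        rw [lintegral_withDensity_eq_lintegral_mul _ hG (by fun_prop)]; rfl
      rw [hw, layer _ hF hd hL, ENNReal.ofReal_rpow_of_nonneg hA0.le hpp.le, hK0]
      have : ∀ X : ℝ≥0∞, ENNReal.ofReal p * ENNReal.ofReal (A ^ p) * C * (ENNReal.ofReal (p - p0))⁻¹ *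
          (ENNReal.ofReal (p - p0) * X) = ENNReal.ofReal (A ^ p) * (ENNReal.ofReal p * (C * X)) := by
        intro X
        rw [mul_assoc _ _ (_ * X), ← mul_assoc _ _ X,
          ENNReal.inv_mul_cancel (by simp [hp]) (by simp)]; ring
      rw [this]
      gcongr
      rw [← lintegral_const_mul' _ _ hC]
      refine setLIntegral_mono' measurableSet_Ioo fun t ht => ?_
      rw [withDensity_apply _ (measurableSet_lt measurable_const hF)]
      have ht0 : 0 < t := ht.1
      have e : t ^ (p - 1) = t ^ p0 * t ^ (p - p0 - 1) := by
        rw [← Real.rpow_add ht0]; ring_nf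
      rw [e, ENNReal.ofReal_mul (by positivity), ← mul_assoc, ← mul_assoc]
      refine mul_le_mul_left ?_ _
      refine le_trans (le_of_eq ?_) (hyp t ht0)
      rw [ENNReal.ofReal_rpow_of_pos ht0, mul_comm]
      congr 3 with x
      rw [ENNReal.lt_div_iff_mul_lt (by simp [hA0]) (by simp), ← ENNReal.ofReal_mul ht0.le, mul_comm t]
    refine e1.trans ?_
    rw [mul_assoc]
    refine mul_le_mul_right ?_ _
    have hconj : (p / p0).HolderConjugate (p / (p - p0)) := by
      rw [Real.holderConjugate_iff]
      refine ⟨(one_lt_div hp0).2 hp, ?_⟩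
      field_simp; ring
    refine (ENNReal.lintegral_mul_le_Lp_mul_Lq μ hconj hG.aemeasurable
      (g := fun x => (min (F x) (ENNReal.ofReal L)) ^ (p - p0)) (by fun_prop)).trans ?_
    have h3 : (1 : ℝ) / (p / p0) = p0 / p := by simp
    have h4 : (1 : ℝ) / (p / (p - p0)) = 1 - p0 / p := by field_simp
    rw [h3, h4]
    have h5 : p0 / p < 1 := (div_lt_one hpp).2 hp
    refine mul_le_mul_right (ENNReal.rpow_le_rpow (lintegral_mono fun x => ?_) (by linarith)) _
    rw [← ENNReal.rpow_mul, mul_div_cancel₀ _ hd.ne']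
    gcongr
    nlinarith
  have hlim : ∫⁻ x, F x ^ p ∂μ = ⨆ m : ℕ, ∫⁻ x, (min (F x) (ENNReal.ofReal (A * (m + 1)))) ^ p ∂μ := by
    rw [← lintegral_iSup]
    · congr with x
      have : F x = ⨆ m : ℕ, min (F x) (ENNReal.ofReal (A * (m + 1))) := by
        rw [← inf_iSup_eq]
        have : ⨆ m : ℕ, ENNReal.ofReal (A * (m + 1)) = ∞ := by
          rw [eq_top_iff, ← ENNReal.iSup_natCast]
          refine iSup_mono fun m => ?_
          rw [← ENNReal.ofReal_natCast]
          gcongr; nlinarith [Nat.cast_nonneg (α := ℝ) m]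
        rw [this]; simp
      conv_lhs => rw [this]
      exact (ENNReal.orderIsoRpow p hpp).map_iSup _
    · intro m; fun_prop
    · intro m k hmk x
      simp only
      gcongr
  rw [hlim]
  exact iSup_le fun m => key _ (by positivity)


structure Grid where
  c : ℕ → ℝ → ℤ
  meas : ∀ j, Measurable (c j)
  nest : ∀ j s t, c (j + 1) s = c (j + 1) t → c j s = c j t
  fin : ∀ j k, volume (c j ⁻¹' {k}) ≠ ∞
  pos : ∀ j k, volume (c j ⁻¹' {k}) ≠ 0

namespace Grid
variable (G : Grid)

lemma nest_le {i j : ℕ} (h : i ≤ j) {s t : ℝ} (e : G.c j s = G.c j t) : G.c i s = G.c i t := by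
  induction h with
  | refl => exact e
  | step _ ih => exact ih (G.nest _ _ _ e)

def avg (j : ℕ) (g : ℝ → ℝ≥0∞) (t : ℝ) : ℝ≥0∞ :=
  (volume (G.c j ⁻¹' {G.c j t}))⁻¹ * ∫⁻ s in G.c j ⁻¹' {G.c j t}, g s

def Mx (J : ℕ) (g : ℝ → ℝ≥0∞) (t : ℝ) : ℝ≥0∞ := ⨆ i ∈ Set.Iio J, G.avg i g t

lemma cellm (j : ℕ) (k : ℤ) : MeasurableSet (G.c j ⁻¹' {k}) := G.meas j (measurableSet_singleton k)

lemma avg_meas {Y : Type} [MeasurableSpace Y] (j : ℕ) {v : ℝ → Y → ℝ≥0∞}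
    (hv : Measurable (Function.uncurry v)) :
    Measurable fun z : ℝ × Y => G.avg j (fun s => v s z.2) z.1 := by
  have h : Measurable fun z : ℤ × Y =>
      (volume (G.c j ⁻¹' {z.1}))⁻¹ * ∫⁻ s in G.c j ⁻¹' {z.1}, v s z.2 := by
    refine measurable_from_prod_countable_right fun k => ?_
    have h1 : Measurable fun y : Y => ∫⁻ s in G.c j ⁻¹' {k}, v s y :=
      Measurable.lintegral_prod_right' (f := fun z : Y × ℝ => v z.2 z.1) (hv.comp measurable_swap)
    have h3 := h1.const_mul (volume (G.c j ⁻¹' {k}))⁻¹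
    simpa only using h3
  have h2 : Measurable fun z : ℝ × Y => (G.c j z.1, z.2) :=
    ((G.meas j).comp measurable_fst).prodMk measurable_snd
  have h3 := h.comp h2
  simpa only [avg, Function.comp_def] using h3

lemma Mx_meas {Y : Type} [MeasurableSpace Y] (J : ℕ) {v : ℝ → Y → ℝ≥0∞}
    (hv : Measurable (Function.uncurry v)) :
    Measurable fun z : ℝ × Y => G.Mx J (fun s => v s z.2) z.1 :=
  Measurable.biSup _ (Set.to_countable _) fun i _ => G.avg_meas i hv

lemma Mx_meas1 (J : ℕ) {f : ℝ → ℝ≥0∞} (hf : Measurable f) : Measurable (G.Mx J f) := by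
  have h1 := G.Mx_meas (Y := Unit) (v := fun s _ => f s) J (hf.comp measurable_fst)
  have h2 : Measurable fun t : ℝ => (t, ()) := by fun_prop
  have h3 := h1.comp h2
  simpa only [Function.comp_def] using h3

lemma avg_meas1 (J : ℕ) {f : ℝ → ℝ≥0∞} (hf : Measurable f) : Measurable (G.avg J f) := by
  have h1 := G.avg_meas (Y := Unit) (v := fun s _ => f s) J (hf.comp measurable_fst)
  have h2 : Measurable fun t : ℝ => (t, ()) := by fun_prop
  have h3 := h1.comp h2
  simpa only [Function.comp_def] using h3

lemma Mx_succ (J : ℕ) (f : ℝ → ℝ≥0∞) (t : ℝ) : G.Mx (J + 1) f t = max (G.Mx J f t) (G.avg J f t) := by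
  unfold Mx
  rw [← Nat.succ_eq_add_one, show Set.Iio (Nat.succ J) = insert J (Set.Iio J) by ext; simp,
    iSup_insert, sup_comm]

lemma Mx_zero (f : ℝ → ℝ≥0∞) (t : ℝ) : G.Mx 0 f t = 0 := by simp [Mx]

lemma Mx_mono {J J' : ℕ} (h : J ≤ J') (f : ℝ → ℝ≥0∞) (t : ℝ) : G.Mx J f t ≤ G.Mx J' f t :=
  biSup_mono fun i hi => lt_of_lt_of_le hi h

lemma avg_congr {j : ℕ} (f : ℝ → ℝ≥0∞) {s t : ℝ} (h : G.c j s = G.c j t) : G.avg j f s = G.avg j f t := by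
  simp [avg, h]

lemma Mx_congr {j : ℕ} (f : ℝ → ℝ≥0∞) {s t : ℝ} (h : G.c j s = G.c j t) :
    G.Mx (j + 1) f s = G.Mx (j + 1) f t :=
  iSup_congr fun i => iSup_congr fun hi => G.avg_congr f (G.nest_le (Nat.lt_succ_iff.1 hi) h)

def Sat (j : ℕ) (S : Set ℝ) : Prop := ∀ s t, G.c j s = G.c j t → s ∈ S → t ∈ S

lemma avg_sat {j i : ℕ} (hij : j ≤ i) {S : Set ℝ} (hS : G.Sat j S) (f : ℝ → ℝ≥0∞) {t : ℝ} (ht : t ∈ S) :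
    G.avg i f t = G.avg i (S.indicator f) t := by
  unfold avg
  congr 1
  refine setLIntegral_congr_fun (G.cellm _ _) fun s hs => ?_
  have : s ∈ S := hS t s (G.nest_le hij (Eq.symm hs)) ht
  simp [this]

lemma Mx_split {j : ℕ} {S : Set ℝ} (hS : G.Sat j S) (J : ℕ) (f : ℝ → ℝ≥0∞) {t : ℝ} (ht : t ∈ S) :
    G.Mx J f t ≤ max (G.Mx j f t) (G.Mx J (S.indicator f) t) := by
  refine iSup₂_le fun i hi => ?_
  by_cases h : i < j
  · exact le_max_of_le_left (le_iSup₂_of_le i h le_rfl)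
  · rw [G.avg_sat (not_lt.1 h) hS f ht]
    exact le_max_of_le_right (le_iSup₂_of_le (f := fun i _ => G.avg i (S.indicator f) t) i hi le_rfl)

lemma lintegral_cells (j : ℕ) (S : Set ℝ) (hS : MeasurableSet S) (f : ℝ → ℝ≥0∞) :
    ∫⁻ t in S, f t = ∑' k : ℤ, ∫⁻ t in S ∩ G.c j ⁻¹' {k}, f t := by
  rw [← lintegral_iUnion]
  · congr 2; ext t; simp
  · exact fun k => hS.inter (G.cellm j k)
  · intro k l hkl
    refine Set.disjoint_left.2 fun t h1 h2 => hkl ?_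
    have e1 : G.c j t = k := h1.2
    have e2 : G.c j t = l := h2.2
    omega

lemma avg_int {j : ℕ} {S : Set ℝ} (hS : G.Sat j S) (hSm : MeasurableSet S) (f : ℝ → ℝ≥0∞) :
    ∫⁻ t in S, G.avg j f t = ∫⁻ t in S, f t := by
  rw [G.lintegral_cells j S hSm, G.lintegral_cells j S hSm]
  congr with k
  by_cases h : ∃ t ∈ S, G.c j t = k
  · obtain ⟨t0, h0, h1⟩ := h
    have : S ∩ G.c j ⁻¹' {k} = G.c j ⁻¹' {k} :=
      Set.inter_eq_right.2 fun s hs => hS t0 s (h1.trans (Eq.symm hs)) h0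
    rw [this, setLIntegral_congr_fun (g := fun _ => (volume (G.c j ⁻¹' {k}))⁻¹ * ∫⁻ s in G.c j ⁻¹' {k}, f s)
      (G.cellm j k) (fun t ht => by
        have : G.c j t = k := ht
        simp [avg, this])]
    rw [lintegral_const, Measure.restrict_apply MeasurableSet.univ, Set.univ_inter, mul_right_comm,
      ENNReal.inv_mul_cancel (G.pos j k) (G.fin j k), one_mul]
  · have : S ∩ G.c j ⁻¹' {k} = ∅ := by
      ext s; simp only [Set.mem_inter_iff, Set.mem_preimage, Set.mem_singleton_iff, Set.mem_empty_iff_false, iff_false]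
      exact fun hs => h ⟨s, hs.1, hs.2⟩
    simp [this]

end Grid

lemma stopLC {p0 p A : ℝ} (hp0 : 0 < p0) (hp : p0 < p) (hA : 1 ≤ A) (C : ℝ≥0∞) (hC : C ≠ ∞) :
    ∃ K : ℝ≥0∞, K ≠ ∞ ∧ ∀ (G : Grid) (J : ℕ) (F : ℕ → ℝ → ℝ≥0∞) (H : ℝ → ℝ≥0∞),
      (∀ j, Measurable (F j)) → Measurable H → (∀ t, F 0 t = 0) → (∀ t, Monotone fun j => F j t) →
      (∀ j s t, G.c j s = G.c j t → F (j + 1) s = F (j + 1) t) →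
      (∀ (l : ℝ) (j : ℕ) (S : Set ℝ), 0 < l → j < J → MeasurableSet S → G.Sat j S →
        (∀ t ∈ S, F j t ≤ ENNReal.ofReal l ∧ ENNReal.ofReal l < F (j + 1) t) →
        ENNReal.ofReal l ^ p0 * volume ({t | ENNReal.ofReal (A * l) < F J t} ∩ S) ≤ C * ∫⁻ t in S, H t) →
      ∫⁻ t, F J t ^ p ≤ K * ∫⁻ t, H t ^ (p / p0) := by
  obtain ⟨K, hK, hLC⟩ := LC hp0 hp hA C hC
  refine ⟨K, hK, fun G J F H hF hH h0 hm hc hyp => ?_⟩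
  rw [← setLIntegral_univ, ← setLIntegral_univ (f := fun t => H t ^ (p / p0)),
    G.lintegral_cells 0 _ MeasurableSet.univ, G.lintegral_cells 0 _ MeasurableSet.univ, ← ENNReal.tsum_mul_left]
  refine ENNReal.tsum_le_tsum fun k => ?_
  rw [Set.univ_inter]
  set T := G.c 0 ⁻¹' {k}
  have hT : MeasurableSet T := G.cellm 0 k
  haveI : IsFiniteMeasure (volume.restrict T) := ⟨by
    rw [Measure.restrict_apply MeasurableSet.univ, Set.univ_inter]; exact (G.fin 0 k).lt_top⟩
  refine hLC (volume.restrict T) (hF J) hH fun l hl => ?_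
  set S : ℕ → Set ℝ := fun j => {t | F j t ≤ ENNReal.ofReal l ∧ ENNReal.ofReal l < F (j + 1) t}
  have hSm : ∀ j, MeasurableSet (S j) := fun j =>
    (measurableSet_le (hF j) measurable_const).inter (measurableSet_lt measurable_const (hF _))
  have hd : Pairwise (Function.onFun Disjoint S) := by
    refine (pairwise_disjoint_on S).2 fun i j hij => Set.disjoint_left.2 fun t h1 h2 => ?_
    exact absurd (h1.2.trans_le (hm t hij)) (not_lt.2 h2.1)
  have hsub : {t | ENNReal.ofReal (A * l) < F J t} ⊆ ⋃ j ∈ Finset.range J, S j := by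
    intro t ht
    have ht : ENNReal.ofReal l < F J t := lt_of_le_of_lt (ENNReal.ofReal_le_ofReal (by nlinarith)) ht
    have hex : ∃ j, ENNReal.ofReal l < F j t := ⟨J, ht⟩
    classical
    have hf := Nat.find_spec hex
    obtain ⟨j, hj⟩ : ∃ j, Nat.find hex = j + 1 := by
      refine Nat.exists_eq_succ_of_ne_zero fun h => ?_
      rw [h, h0] at hf; exact absurd hf (by simp)
    have hJ : Nat.find hex ≤ J := Nat.find_min' hex ht
    simp only [Set.mem_iUnion, Finset.mem_range]
    refine ⟨j, by omega, not_lt.1 (Nat.find_min hex (m := j) (by omega)), hj ▸ hf⟩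
  calc _ ≤ ENNReal.ofReal l ^ p0 * ∑ j ∈ Finset.range J,
        volume.restrict T ({t | ENNReal.ofReal (A * l) < F J t} ∩ S j) := by
        refine mul_le_mul_right ?_ _
        refine (measure_mono (t := ⋃ j ∈ Finset.range J, ({t | ENNReal.ofReal (A * l) < F J t} ∩ S j)) ?_).trans
          (measure_biUnion_finset_le _ _)
        rw [← Set.inter_iUnion₂]
        exact fun t ht => ⟨ht, hsub ht⟩
    _ ≤ ∑ j ∈ Finset.range J, C * ∫⁻ t in S j ∩ T, H t := by
        rw [Finset.mul_sum]
        refine Finset.sum_le_sum fun j hj => ?_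
        rw [Measure.restrict_apply ((measurableSet_lt measurable_const (hF J)).inter (hSm j)), Set.inter_assoc]
        refine hyp l j (S j ∩ T) hl (Finset.mem_range.1 hj) ((hSm j).inter hT) ?_ fun t ht => ht.1
        intro s t hst hs
        refine ⟨⟨?_, ?_⟩, ?_⟩
        · rcases j with _ | j
          · simp [h0]
          · rw [← hc j s t (G.nest_le (Nat.le_succ j) hst)]; exact hs.1.1
        · rw [← hc j s t hst]; exact hs.1.2
        · have : G.c 0 s = k := hs.2
          show G.c 0 t = k
          rw [← this]; exact (G.nest_le (Nat.zero_le j) hst).symm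
    _ = C * ∫⁻ t in ⋃ j ∈ Finset.range J, S j ∩ T, H t := by
        rw [lintegral_biUnion_finset, Finset.mul_sum]
        · intro i _ j _ hij
          exact (hd hij).mono Set.inter_subset_left Set.inter_subset_left
        · exact fun j _ => (hSm j).inter hT
    _ ≤ _ := by
        rw [Measure.restrict_restrict (measurableSet_lt measurable_const (hF J))]
        refine mul_le_mul_right (lintegral_mono_set ?_) _
        refine Set.iUnion₂_subset fun j hj t ht => ⟨ht.1.2.trans_le (hm t (Finset.mem_range.1 hj)), ht.2⟩

lemma doob {p : ℝ} (hp : 1 < p) : ∃ K : ℝ≥0∞, K ≠ ∞ ∧ ∀ (G : Grid) (J : ℕ) (f : ℝ → ℝ≥0∞), Measurable f →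
    ∫⁻ t, G.Mx J f t ^ p ≤ K * ∫⁻ t, f t ^ p := by
  obtain ⟨K, hK, h⟩ := stopLC one_pos hp le_rfl 1 (by simp)
  refine ⟨K, hK, fun G J f hf => ?_⟩
  have := h G J (fun j => G.Mx j f) f (fun j => G.Mx_meas1 j hf) hf (G.Mx_zero f)
    (fun t i j hij => G.Mx_mono hij f t) (fun j s t hst => G.Mx_congr f hst) ?_
  · simpa using this
  intro l j S hl hj hSm hS hlt
  rw [ENNReal.rpow_one, one_mul, one_mul, ← G.avg_int hS hSm]
  calc _ ≤ ENNReal.ofReal l * volume S := mul_le_mul_right (measure_mono Set.inter_subset_right) _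
    _ = ∫⁻ t in S, ENNReal.ofReal l := by simp
    _ ≤ ∫⁻ t in S, G.avg j f t := setLIntegral_mono' hSm fun t ht => by
      have h1 := hlt t ht
      rw [G.Mx_succ] at h1
      rcases lt_max_iff.1 h1.2 with h2 | h2
      · exact absurd h2 (not_lt.2 h1.1)
      · exact h2.le

structure LatN {Y : Type} [MeasurableSpace Y] (N : (Y → ℝ≥0∞) → ℝ≥0∞) (A : ℝ) : Prop where
  hA : 1 ≤ A
  mono : ∀ {w w' : Y → ℝ≥0∞}, (∀ y, w y ≤ w' y) → N w ≤ N w'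
  zero : N (fun _ => 0) = 0
  sup : ∀ {w w' : Y → ℝ≥0∞}, Measurable w → Measurable w' →
    N (fun y => max (w y) (w' y)) ≤ ENNReal.ofReal A * max (N w) (N w')
  meas : ∀ {v : ℝ → Y → ℝ≥0∞}, Measurable (Function.uncurry v) → Measurable fun t => N (v t)

lemma upcore {p0 p A : ℝ} (hp0 : 0 < p0) (hp : p0 < p) (hA : 1 ≤ A) (C : ℝ≥0∞) (hC : C ≠ ∞) :
    ∃ K : ℝ≥0∞, K ≠ ∞ ∧ ∀ {Y : Type} [MeasurableSpace Y] (N : (Y → ℝ≥0∞) → ℝ≥0∞), LatN N A →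
      (∀ (G : Grid) (J : ℕ) (v : ℝ → Y → ℝ≥0∞), Measurable (Function.uncurry v) →
        ∫⁻ t, N (fun y => G.Mx J (fun s => v s y) t) ^ p0 ≤ C * ∫⁻ t, N (v t) ^ p0) →
      ∀ (G : Grid) (J : ℕ) (v : ℝ → Y → ℝ≥0∞), Measurable (Function.uncurry v) →
        ∫⁻ t, N (fun y => G.Mx J (fun s => v s y) t) ^ p ≤ K * ∫⁻ t, N (v t) ^ p := by
  obtain ⟨K, hK, h⟩ := stopLC hp0 hp hA C hC
  refine ⟨K, hK, fun {Y} _ N hN hb G J v hv => ?_⟩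
  have hmx : ∀ (j : ℕ) {v : ℝ → Y → ℝ≥0∞}, Measurable (Function.uncurry v) →
      Measurable (Function.uncurry fun t y => G.Mx j (fun s => v s y) t) := fun j v hv => G.Mx_meas j hv
  have := h G J (fun j t => N (fun y => G.Mx j (fun s => v s y) t)) (fun t => N (v t) ^ p0)
    (fun j => hN.meas (hmx j hv)) ((hN.meas hv).pow_const _)
    (fun t => by simp [Grid.Mx_zero, hN.zero])
    (fun t i j hij => hN.mono fun y => G.Mx_mono hij _ t)
    (fun j s t hst => by simp_rw [G.Mx_congr _ hst]) ?_
  · simpa [← ENNReal.rpow_mul, mul_div_cancel₀ _ hp0.ne'] using this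
  intro l j S hl hj hSm hS hlt
  have hvS : Measurable (Function.uncurry fun s y => S.indicator (fun s => v s y) s) := by
    have : (Function.uncurry fun s y => S.indicator (fun s => v s y) s) =
        (Prod.fst ⁻¹' S).indicator (Function.uncurry v) := by
      ext ⟨s, y⟩; by_cases h : s ∈ S <;> simp [Set.indicator, h]
    rw [this]
    exact hv.indicator (measurable_fst hSm)
  have hpt : ∀ t, N (fun y => S.indicator (fun s => v s y) t) ^ p0 = S.indicator (fun t => N (v t) ^ p0) t := by
    intro t
    by_cases h : t ∈ S
    · simp [h]
    · simp [h, hN.zero, hp0]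
  have h1 := hb G J _ hvS
  simp_rw [hpt] at h1
  rw [lintegral_indicator hSm] at h1
  refine le_trans ?_ h1
  refine le_trans ?_ (mul_meas_ge_le_lintegral₀ ((hN.meas (hmx J hvS)).pow_const _).aemeasurable (ENNReal.ofReal l ^ p0))
  refine mul_le_mul_right (measure_mono fun t ht => ?_) _
  refine ENNReal.rpow_le_rpow ?_ hp0.le
  have e1 : ENNReal.ofReal (A * l) < ENNReal.ofReal A *
      max (N fun y => G.Mx j (fun s => v s y) t) (N fun y => G.Mx J (S.indicator fun s => v s y) t) := by
    refine lt_of_lt_of_le ht.1 ?_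
    refine le_trans (hN.mono fun y => G.Mx_split hS J (fun s => v s y) ht.2) ?_
    have hm1 := (hmx j hv).of_uncurry_left (x := t)
    have hm2 := (hmx J hvS).of_uncurry_left (x := t)
    exact hN.sup hm1 hm2
  have hA0 : 0 < A := by linarith
  rw [ENNReal.ofReal_mul hA0.le] at e1
  have e2 := (ENNReal.mul_lt_mul_iff_right (by simp [hA0]) (by simp)).1 e1
  rcases lt_max_iff.1 e2 with h2 | h2
  · exact absurd h2 (not_lt.2 (hlt t ht.2).1)
  · exact h2.le


structure GoodN {X Y : Type} [MeasurableSpace X] [MeasurableSpace Y]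
    (N : X → (Y → ℝ≥0∞) → ℝ≥0∞) (A : ℝ) : Prop where
  hA : 1 ≤ A
  mono : ∀ x {w w' : Y → ℝ≥0∞}, (∀ y, w y ≤ w' y) → N x w ≤ N x w'
  sup : ∀ x {w w' : Y → ℝ≥0∞}, Measurable w → Measurable w' →
    N x (fun y => max (w y) (w' y)) ≤ ENNReal.ofReal A * max (N x w) (N x w')
  smul : ∀ x (c : ℝ≥0∞) {w : Y → ℝ≥0∞}, c ≠ ∞ → Measurable w → N x (fun y => c * w y) = c * N x w
  meas : ∀ {v : ℝ → Y → ℝ≥0∞}, Measurable (Function.uncurry v) →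
    Measurable fun z : ℝ × X => N z.2 (v z.1)

lemma GoodN.meas1 {X Y : Type} [MeasurableSpace X] [MeasurableSpace Y]
    {N : X → (Y → ℝ≥0∞) → ℝ≥0∞} {A : ℝ} (hN : GoodN N A) (x : X) {v : ℝ → Y → ℝ≥0∞}
    (hv : Measurable (Function.uncurry v)) : Measurable fun t => N x (v t) := by
  have h := hN.meas hv
  have h2 : Measurable fun t : ℝ => (t, x) := by fun_prop
  have h3 := h.comp h2
  simpa only [Function.comp_def] using h3

def BddN {X Y : Type} [MeasurableSpace Y] (N : X → (Y → ℝ≥0∞) → ℝ≥0∞) (p r : ℝ) : Prop :=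
  ∃ C : ℝ≥0∞, C ≠ ∞ ∧ ∀ (x : X) (G : Grid) (J : ℕ) (v : ℝ → Y → ℝ≥0∞), Measurable (Function.uncurry v) →
    ∫⁻ t, N x (fun y => G.Mx J (fun s => v s y ^ r) t ^ (1 / r)) ^ p ≤ C * ∫⁻ t, N x (v t) ^ p

lemma max_rpow {a b : ℝ≥0∞} {r : ℝ} (hr : 0 ≤ r) : max a b ^ r = max (a ^ r) (b ^ r) :=
  (ENNReal.monotone_rpow_of_nonneg hr).map_max

lemma rswap (a : ℝ≥0∞) (x y : ℝ) : (a ^ x) ^ y = (a ^ y) ^ x := by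
  rw [← ENNReal.rpow_mul, mul_comm, ENNReal.rpow_mul]

lemma upN {X Y : Type} [MeasurableSpace X] [MeasurableSpace Y]
    {N : X → (Y → ℝ≥0∞) → ℝ≥0∞} {A p0 p r : ℝ} (hN : GoodN N A) (hr : 0 < r) (hp0 : 0 < p0) (hp : p0 < p)
    (h : BddN N p0 r) : BddN N p r := by
  obtain ⟨C, hC, hb⟩ := h
  obtain ⟨K, hK, h2⟩ := upcore hp0 hp hN.hA C hC
  refine ⟨K, hK, fun x G J v hv => ?_⟩
  have e : ∀ a : ℝ≥0∞, (a ^ r) ^ (1 / r) = a := fun a => by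
    rw [← ENNReal.rpow_mul]; simp [hr.ne']
  have e' : ∀ a : ℝ≥0∞, (a ^ (1 / r)) ^ r = a := fun a => by
    rw [← ENNReal.rpow_mul]; simp [hr.ne']
  have h3 := h2 (Y := Y) (fun w => N x (fun y => w y ^ (1 / r)))
    { hA := hN.hA
      mono := fun h => hN.mono x fun y => ENNReal.rpow_le_rpow (h y) (by positivity)
      zero := by
        have := hN.smul x 0 (w := fun _ => 0) (by simp) measurable_const
        simp only [zero_mul] at this
        have h0 : (0 : ℝ≥0∞) ^ (1 / r) = 0 := ENNReal.zero_rpow_of_pos (by positivity)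
        simp only [h0]; exact this
      sup := fun {w w'} hw hw' => by
        simp_rw [max_rpow (by positivity : 0 ≤ 1 / r)]
        exact hN.sup x (hw.pow_const _) (hw'.pow_const _)
      meas := fun {v} hv => hN.meas1 x (v := fun t y => v t y ^ (1 / r)) (hv.pow_const _) } ?_
    G J (fun t y => v t y ^ r) (hv.pow_const _)
  · simpa only [e] using h3
  · intro G J v hv
    have := hb x G J (fun t y => v t y ^ (1 / r)) (hv.pow_const _)
    simpa only [e'] using this

lemma Grid.avg_holder (G : Grid) (j : ℕ) {f g h : ℝ → ℝ≥0∞} {θ : ℝ} (h0 : 0 < θ) (h1 : θ < 1)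
    (hf : Measurable f) (hg : Measurable g) (hh : ∀ᵐ s, h s = f s ^ θ * g s ^ (1 - θ)) (t : ℝ) :
    G.avg j h t ≤ G.avg j f t ^ θ * G.avg j g t ^ (1 - θ) := by
  unfold avg
  set I := G.c j ⁻¹' {G.c j t}
  have e : ∫⁻ s in I, h s = ∫⁻ s in I, f s ^ θ * g s ^ (1 - θ) :=
    lintegral_congr_ae (ae_restrict_of_ae hh)
  rw [e, ENNReal.mul_rpow_of_nonneg _ _ h0.le, ENNReal.mul_rpow_of_nonneg _ _ (by linarith : 0 ≤ 1 - θ)]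
  have hv0 : (volume I)⁻¹ ≠ 0 := by simpa using G.fin j _
  have hvt : (volume I)⁻¹ ≠ ∞ := by simpa using G.pos j _
  have h2 : (volume I)⁻¹ ^ θ * (volume I)⁻¹ ^ (1 - θ) = (volume I)⁻¹ := by
    rw [← ENNReal.rpow_add _ _ hv0 hvt]; simp
  rw [mul_mul_mul_comm, h2]
  exact mul_le_mul_right (ENNReal.lintegral_mul_norm_pow_le hf.aemeasurable hg.aemeasurable h0.le
    (by linarith) (by ring)) _

lemma Grid.Mx_holder (G : Grid) (J : ℕ) {f g h : ℝ → ℝ≥0∞} {θ : ℝ} (h0 : 0 < θ) (h1 : θ < 1)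
    (hf : Measurable f) (hg : Measurable g) (hh : ∀ᵐ s, h s = f s ^ θ * g s ^ (1 - θ)) (t : ℝ) :
    G.Mx J h t ≤ G.Mx J f t ^ θ * G.Mx J g t ^ (1 - θ) := by
  refine iSup₂_le fun i hi => (G.avg_holder i h0 h1 hf hg hh t).trans ?_
  refine mul_le_mul' (ENNReal.rpow_le_rpow ?_ h0.le) (ENNReal.rpow_le_rpow ?_ (by linarith))
  · exact le_iSup₂_of_le (f := fun i _ => G.avg i f t) i hi le_rfl
  · exact le_iSup₂_of_le (f := fun i _ => G.avg i g t) i hi le_rfl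

lemma downN {X Y : Type} [MeasurableSpace X] [MeasurableSpace Y]
    {N : X → (Y → ℝ≥0∞) → ℝ≥0∞} {A θ p r : ℝ} (hN : GoodN N A) (hr : 0 < r) (hrp : r < p)
    (h0 : 0 < θ) (h1 : θ < 1)
    (h : BddN (fun x w => N x (fun y => w y ^ θ) ^ (1 / θ)) p r) : BddN N p r := by
  obtain ⟨C, hC, hb⟩ := h
  obtain ⟨K, hK, hd⟩ := doob (p := p / r) ((one_lt_div hr).2 hrp)
  have hp : 0 < p := hr.trans hrp
  have hθ' : 0 < 1 - θ := by linarith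
  set D : ℝ≥0∞ := K ^ (1 - θ) * C ^ θ + 1 with hD
  have hDt : D ≠ ∞ := by
    simp [hD, ENNReal.mul_eq_top, hK, hC, h0.le, h0, hθ', h1.le, h1]
  have hD1 : 1 ≤ D := by simp [hD]
  clear_value D
  refine ⟨D, hDt, fun x G J u hu => ?_⟩
  set U : ℝ → ℝ≥0∞ := fun t => N x (u t) with hU
  have hUm : Measurable U := hN.meas1 x hu
  by_cases hfin : ∫⁻ t, U t ^ p = ∞
  · rw [hfin, ENNReal.mul_top (by positivity)]; exact le_top
  have main : ∀ δ : ℝ≥0∞, δ ≠ 0 → δ ≠ ∞ →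
      ∫⁻ t, N x (fun y => G.Mx J (fun s => u s y ^ r) t ^ (1 / r)) ^ p ≤ D * ((∫⁻ t, U t ^ p) + δ) := by
    intro δ hδ hδt
    obtain ⟨g, hg0, hgm, hgi⟩ := exists_pos_lintegral_lt_of_sigmaFinite (volume : Measure ℝ) hδ
    set V : ℝ → ℝ≥0∞ := fun t => (U t ^ p + g t) ^ (1 / p) with hV
    have hVm : Measurable V := ((hUm.pow_const _).add hgm.coe_nnreal_ennreal).pow_const _
    have hVp : ∀ t, V t ^ p = U t ^ p + g t := fun t => by
      rw [hV]; simp only; rw [← ENNReal.rpow_mul]; simp [hp.ne']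
    have hVi : ∫⁻ t, V t ^ p ≤ (∫⁻ t, U t ^ p) + δ := by
      simp_rw [hVp]
      rw [lintegral_add_left (hUm.pow_const _)]
      exact add_le_add_right hgi.le _
    have hVit : ∫⁻ t, V t ^ p ≠ ∞ := ne_top_of_le_ne_top (ENNReal.add_ne_top.2 ⟨hfin, hδt⟩) hVi
    have hV0 : ∀ t, V t ≠ 0 := fun t ht => by
      have := hVp t
      rw [ht, ENNReal.zero_rpow_of_pos hp] at this
      have h3 := (add_eq_zero.1 this.symm).2
      exact (hg0 t).ne' (by exact_mod_cast h3)
    have hUV : ∀ t, U t ≤ V t := fun t => by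
      rw [← ENNReal.rpow_le_rpow_iff hp, hVp]; exact le_self_add
    have hVtop : ∀ᵐ t, V t ≠ ∞ := by
      filter_upwards [ae_lt_top (hVm.pow_const p) hVit] with t ht h
      rw [h, ENNReal.top_rpow_of_pos hp] at ht; exact lt_irrefl _ ht
    set v : ℝ → Y → ℝ≥0∞ := fun t y => u t y ^ (1 / θ) * V t ^ (-((1 - θ) / θ)) with hv
    have hvm : Measurable (Function.uncurry v) :=
      (hu.pow_const _).mul ((hVm.comp measurable_fst).pow_const _)
    have hvθ : ∀ t y, v t y ^ θ = V t ^ (-(1 - θ)) * u t y := fun t y => by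
      rw [hv]; simp only
      rw [ENNReal.mul_rpow_of_nonneg _ _ h0.le, ← ENNReal.rpow_mul, ← ENNReal.rpow_mul, mul_comm]
      congr 2
      · field_simp
      · simp [h0.ne']
    have hcV : ∀ t, V t ^ (-(1 - θ)) ≠ ∞ := fun t => by
      rw [ENNReal.rpow_neg]; simp [hV0 t, hθ', h1.le]
    have hVV : ∀ t, V t ≠ ∞ → V t ^ (-(1 - θ)) * V t ^ (1 - θ) = 1 := fun t ht => by
      rw [← ENNReal.rpow_add _ _ (hV0 t) ht]; simp
    have hut : ∀ y, ∀ᵐ s, u s y ^ r = (v s y ^ r) ^ θ * (V s ^ r) ^ (1 - θ) := fun y => by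
      filter_upwards [hVtop] with s hs
      rw [rswap (v s y), hvθ, rswap (V s), ← ENNReal.mul_rpow_of_nonneg _ _ hr.le, mul_right_comm, hVV s hs, one_mul]
    set Z : ℝ → ℝ≥0∞ := fun t => G.Mx J (fun s => V s ^ r) t ^ (1 / r) with hZ
    have hZm : Measurable Z := (G.Mx_meas1 J (hVm.pow_const r)).pow_const _
    have hZi : ∫⁻ t, Z t ^ p ≤ K * ∫⁻ t, V t ^ p := by
      have := hd G J (fun s => V s ^ r) (hVm.pow_const r)
      simp_rw [← ENNReal.rpow_mul, mul_div_cancel₀ _ hr.ne'] at this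
      simp_rw [hZ, ← ENNReal.rpow_mul, one_div_mul_eq_div]
      exact this
    have hZtop : ∀ᵐ t, Z t ≠ ∞ := by
      filter_upwards [ae_lt_top (hZm.pow_const p) (ne_top_of_le_ne_top (ENNReal.mul_ne_top hK hVit) hZi)] with t ht h
      rw [h, ENNReal.top_rpow_of_pos hp] at ht; exact lt_irrefl _ ht
    set W : ℝ → Y → ℝ≥0∞ := fun t y => G.Mx J (fun s => v s y ^ r) t ^ (1 / r) with hW
    have hWm : Measurable (Function.uncurry W) :=
      (G.Mx_meas J (v := fun s y => v s y ^ r) (hvm.pow_const r)).pow_const _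
    set R : ℝ → ℝ≥0∞ := fun t => N x (fun y => W t y ^ θ) ^ (1 / θ) with hR
    have hRm : Measurable R := (hN.meas1 x (v := fun t y => W t y ^ θ) (hWm.pow_const θ)).pow_const _
    have hRi : ∫⁻ t, R t ^ p ≤ C * ∫⁻ t, V t ^ p := by
      refine (hb x G J v hvm).trans (mul_le_mul_right (lintegral_mono fun t => ENNReal.rpow_le_rpow ?_ hp.le) _)
      simp_rw [hvθ]
      rw [hN.smul x _ (hcV t) (hu.of_uncurry_left (x := t))]
      have : V t ^ (-(1 - θ)) * N x (u t) ≤ V t ^ θ := by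
        by_cases ht : V t = ∞
        · simp [ht, h0]
        calc _ ≤ V t ^ (-(1 - θ)) * V t := mul_le_mul_right (hUV t) _
          _ = V t ^ (-(1 - θ)) * V t ^ (1 : ℝ) := by rw [ENNReal.rpow_one]
          _ = _ := by rw [← ENNReal.rpow_add _ _ (hV0 t) ht]; congr 1; ring
      refine (ENNReal.rpow_le_rpow this (by positivity)).trans_eq ?_
      rw [← ENNReal.rpow_mul]; simp [h0.ne']
    have hpt : ∀ᵐ t, N x (fun y => G.Mx J (fun s => u s y ^ r) t ^ (1 / r)) ^ p ≤
        (Z t ^ p) ^ (1 - θ) * (R t ^ p) ^ θ := by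
      filter_upwards [hZtop] with t ht
      rw [rswap (Z t), rswap (R t), ← ENNReal.mul_rpow_of_nonneg _ _ hp.le]
      refine ENNReal.rpow_le_rpow ?_ hp.le
      have hRθ : R t ^ θ = N x (fun y => W t y ^ θ) := by
        rw [hR]; simp only; rw [← ENNReal.rpow_mul]; simp [h0.ne']
      rw [hRθ, ← hN.smul x _ (by simp [ht, hθ', h1.le]) (Measurable.pow_const (hWm.of_uncurry_left (x := t)) θ)]
      refine hN.mono x fun y => ?_
      have := G.Mx_holder J h0 h1 (f := fun s => v s y ^ r) (g := fun s => V s ^ r)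
        ((hvm.of_uncurry_right (y := y)).pow_const r) (hVm.pow_const r) (hut y) t
      refine (ENNReal.rpow_le_rpow this (by positivity : 0 ≤ 1 / r)).trans_eq ?_
      rw [ENNReal.mul_rpow_of_nonneg _ _ (by positivity), rswap _ θ, rswap _ (1 - θ), mul_comm]
    calc _ ≤ ∫⁻ t, (Z t ^ p) ^ (1 - θ) * (R t ^ p) ^ θ := lintegral_mono_ae hpt
      _ ≤ (∫⁻ t, Z t ^ p) ^ (1 - θ) * (∫⁻ t, R t ^ p) ^ θ :=
        ENNReal.lintegral_mul_norm_pow_le (hZm.pow_const _).aemeasurable (hRm.pow_const _).aemeasurable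
          hθ'.le h0.le (by ring)
      _ ≤ (K * ∫⁻ t, V t ^ p) ^ (1 - θ) * (C * ∫⁻ t, V t ^ p) ^ θ := by gcongr
      _ = K ^ (1 - θ) * C ^ θ * ((∫⁻ t, V t ^ p) ^ (1 - θ) * (∫⁻ t, V t ^ p) ^ θ) := by
        rw [ENNReal.mul_rpow_of_nonneg _ _ hθ'.le, ENNReal.mul_rpow_of_nonneg _ _ h0.le]; ring
      _ = K ^ (1 - θ) * C ^ θ * ∫⁻ t, V t ^ p := by
        rw [← ENNReal.rpow_add_of_nonneg _ _ hθ'.le h0.le]; simp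
      _ ≤ _ := by
        refine mul_le_mul' ?_ hVi
        rw [hD]; exact le_self_add
  refine ENNReal.le_of_forall_pos_le_add fun ε hε _ => ?_
  have hD0 : D ≠ 0 := fun h => by simp [h] at hD1
  refine (main (ε / D) (by simp [hε.ne', hDt]) ?_).trans ?_
  · exact ENNReal.div_ne_top (by simp) hD0
  · rw [mul_add, ENNReal.mul_div_cancel hD0 hDt]

def intN {X Y : Type} (upd : X → ℝ → X) (e : ℝ) (N : X → (Y → ℝ≥0∞) → ℝ≥0∞) :
    X → (Y → ℝ≥0∞) → ℝ≥0∞ := fun x w => (∫⁻ s, N (upd x s) w ^ e) ^ (1 / e)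

lemma GoodN.meas2 {X Y : Type} [MeasurableSpace X] [MeasurableSpace Y]
    {N : X → (Y → ℝ≥0∞) → ℝ≥0∞} {A : ℝ} (hN : GoodN N A) {upd : X → ℝ → X}
    (hu : Measurable (Function.uncurry upd)) (x : X) {w : Y → ℝ≥0∞} (hw : Measurable w) :
    Measurable fun s => N (upd x s) w := by
  have h := hN.meas (v := fun _ => w) (hw.comp measurable_snd)
  have h2 : Measurable fun s : ℝ => ((0 : ℝ), upd x s) := measurable_const.prodMk (hu.of_uncurry_left)
  have h3 := h.comp h2
  simpa only [Function.comp_def] using h3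

lemma goodInt {X Y : Type} [MeasurableSpace X] [MeasurableSpace Y]
    {N : X → (Y → ℝ≥0∞) → ℝ≥0∞} {A e : ℝ} (hN : GoodN N A) {upd : X → ℝ → X}
    (hu : Measurable (Function.uncurry upd)) (he : 0 < e) : GoodN (intN upd e N) (A * 2 ^ (1 / e)) where
  hA := one_le_mul_of_one_le_of_one_le hN.hA (Real.one_le_rpow (by norm_num) (by positivity))
  mono := fun x w w' h => ENNReal.rpow_le_rpow (lintegral_mono fun s =>
    ENNReal.rpow_le_rpow (hN.mono _ h) he.le) (by positivity)
  sup := fun x {w w'} hw hw' => by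
    have hA0 : 0 ≤ A := by linarith [hN.hA]
    unfold intN
    rw [← max_rpow (by positivity), ENNReal.ofReal_mul hA0, ← ENNReal.ofReal_rpow_of_pos (by norm_num)]
    have : ENNReal.ofReal A = (ENNReal.ofReal A ^ e) ^ (1 / e) := by
      rw [← ENNReal.rpow_mul]; simp [he.ne']
    rw [this, ← ENNReal.mul_rpow_of_nonneg _ _ (by positivity), ← ENNReal.mul_rpow_of_nonneg _ _ (by positivity)]
    refine ENNReal.rpow_le_rpow ?_ (by positivity)
    have hm := (hN.meas2 hu x hw).pow_const e
    calc _ ≤ ∫⁻ s, ENNReal.ofReal A ^ e * (N (upd x s) w ^ e + N (upd x s) w' ^ e) := by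
          refine lintegral_mono fun s => ?_
          refine (ENNReal.rpow_le_rpow (hN.sup (upd x s) hw hw') he.le).trans ?_
          rw [ENNReal.mul_rpow_of_nonneg _ _ he.le, max_rpow he.le]
          exact mul_le_mul_right (max_le le_self_add le_add_self) _
      _ = ENNReal.ofReal A ^ e * ((∫⁻ s, N (upd x s) w ^ e) + ∫⁻ s, N (upd x s) w' ^ e) := by
          rw [lintegral_const_mul' _ _ (by simp [he.le]), lintegral_add_left hm]
      _ ≤ _ := by
          rw [mul_assoc]
          refine mul_le_mul_right ?_ _
          rw [show ENNReal.ofReal 2 = 2 by simp, two_mul]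
          exact add_le_add (le_max_left _ _) (le_max_right _ _)
  smul := fun x c {w} hc hw => by
    unfold intN
    simp_rw [hN.smul _ c hc hw, ENNReal.mul_rpow_of_nonneg _ _ he.le]
    rw [lintegral_const_mul' _ _ (by simp [he.le, hc]), ENNReal.mul_rpow_of_nonneg _ _ (by positivity),
      ← ENNReal.rpow_mul]
    simp [he.ne']
  meas := fun {v} hv => by
    refine Measurable.pow_const ?_ _
    have h := hN.meas hv
    have h2 : Measurable fun z : (ℝ × X) × ℝ => (z.1.1, upd z.1.2 z.2) :=
      (measurable_fst.comp measurable_fst).prodMk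
        (hu.comp ((measurable_snd.comp measurable_fst).prodMk measurable_snd))
    have h3 := h.comp h2
    exact (h3.pow_const e).lintegral_prod_right'

lemma bddInt {X Y : Type} [MeasurableSpace X] [MeasurableSpace Y]
    {N : X → (Y → ℝ≥0∞) → ℝ≥0∞} {A e r : ℝ} (hN : GoodN N A) {upd : X → ℝ → X}
    (hu : Measurable (Function.uncurry upd)) (he : 0 < e) (h : BddN N e r) : BddN (intN upd e N) e r := by
  obtain ⟨C, hC, hb⟩ := h
  refine ⟨C, hC, fun x G J v hv => ?_⟩
  have hm : ∀ {v : ℝ → Y → ℝ≥0∞}, Measurable (Function.uncurry v) →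
      Measurable fun z : ℝ × ℝ => N (upd x z.2) (v z.1) ^ e := fun {v} hv => by
    have h := hN.meas hv
    have h2 : Measurable fun z : ℝ × ℝ => (z.1, upd x z.2) :=
      measurable_fst.prodMk ((hu.of_uncurry_left (x := x)).comp measurable_snd)
    have h3 := (h.comp h2).pow_const e
    simpa only [Function.comp_def] using h3
  have hmv : Measurable (Function.uncurry fun t y => G.Mx J (fun s => v s y ^ r) t ^ (1 / r)) :=
    (G.Mx_meas J (v := fun s y => v s y ^ r) (hv.pow_const r)).pow_const _
  have e1 : ∀ a : ℝ≥0∞, (a ^ (1 / e)) ^ e = a := fun a => by rw [← ENNReal.rpow_mul]; simp [he.ne']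
  unfold intN
  simp_rw [e1]
  rw [lintegral_lintegral_swap (hm hmv).aemeasurable, lintegral_lintegral_swap (f := fun t s => N (upd x s) (v t) ^ e) (hm hv).aemeasurable,
    ← lintegral_const_mul' _ _ hC]
  exact lintegral_mono fun s => hb (upd x s) G J v hv


def ell (q : ℝ≥0∞) (u : ℕ → ℝ≥0∞) : ℝ≥0∞ :=
  if q = ∞ then ⨆ k, u k else (∑' k, u k ^ q.toReal) ^ (1 / q.toReal)

def NNm (n : ℕ) (e : Fin n → ℝ) : ℕ → (RV n → ℝ≥0∞) → RV n → ℝ≥0∞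
  | 0, F => F
  | l + 1, F => fun x => if h : l < n then
      (∫⁻ t : ℝ, (NNm n e l F (Function.update x ⟨l, h⟩ t)) ^ (e ⟨l, h⟩)) ^ (1 / e ⟨l, h⟩)
      else NNm n e l F x

def NC (n : ℕ) (e : Fin n → ℝ) (q : ℝ≥0∞) (m : ℕ) (x : RV n) (w : ℕ × RV n → ℝ≥0∞) : ℝ≥0∞ :=
  NNm n e m (fun z => ell q (fun k => w (k, z))) x

lemma NC_succ (n : ℕ) (e : Fin n → ℝ) (q : ℝ≥0∞) (m : ℕ) (h : m < n) :
    NC n e q (m + 1) = intN (fun x s => Function.update x ⟨m, h⟩ s) (e ⟨m, h⟩) (NC n e q m) := by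
  funext x w; simp [NC, intN, NNm, h]

lemma NC_succ' (n : ℕ) (e : Fin n → ℝ) (q : ℝ≥0∞) (m : ℕ) (h : ¬ m < n) :
    NC n e q (m + 1) = NC n e q m := by
  funext x w; simp [NC, NNm, h]

lemma upd_meas (n : ℕ) (i : Fin n) :
    Measurable (Function.uncurry fun (x : RV n) (s : ℝ) => Function.update x i s) := by
  refine measurable_pi_iff.2 fun j => ?_
  by_cases h : j = i
  · subst h; simpa [Function.uncurry_def] using measurable_snd
  · simp only [Function.uncurry_def, Function.update_of_ne h]
    exact (measurable_pi_apply j).comp measurable_fst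

lemma ell_mono {q : ℝ≥0∞} {u v : ℕ → ℝ≥0∞} (h : ∀ k, u k ≤ v k) : ell q u ≤ ell q v := by
  unfold ell
  split_ifs
  · exact iSup_mono h
  · exact ENNReal.rpow_le_rpow (ENNReal.tsum_le_tsum fun k => ENNReal.rpow_le_rpow (h k) (by positivity))
      (by positivity)

lemma ell_meas {Z : Type} [MeasurableSpace Z] {q : ℝ≥0∞} {u : ℕ → Z → ℝ≥0∞} (h : ∀ k, Measurable (u k)) :
    Measurable fun z => ell q (fun k => u k z) := by
  unfold ell
  split_ifs
  · exact Measurable.iSup h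
  · exact (Measurable.ennreal_tsum fun k => (h k).pow_const _).pow_const _

lemma ell_smul {q : ℝ≥0∞} (hq : 0 < q) (c : ℝ≥0∞) (u : ℕ → ℝ≥0∞) : ell q (fun k => c * u k) = c * ell q u := by
  unfold ell
  split_ifs with h
  · rw [ENNReal.mul_iSup]
  · have h1 : 0 < q.toReal := ENNReal.toReal_pos hq.ne' h
    simp_rw [ENNReal.mul_rpow_of_nonneg _ _ h1.le]
    rw [ENNReal.tsum_mul_left, ENNReal.mul_rpow_of_nonneg _ _ (by positivity), ← ENNReal.rpow_mul]
    simp [h1.ne']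

lemma goodEll (n : ℕ) (e : Fin n → ℝ) {q : ℝ≥0∞} (hq : 0 < q) : ∃ A, GoodN (NC n e q 0) A := by
  have hm : ∀ {v : ℝ → ℕ × RV n → ℝ≥0∞}, Measurable (Function.uncurry v) →
      Measurable fun z : ℝ × RV n => NC n e q 0 z.2 (v z.1) := fun {v} hv => by
    refine ell_meas (u := fun k (z : ℝ × RV n) => v z.1 (k, z.2)) fun k => ?_
    have h2 : Measurable fun z : ℝ × RV n => (z.1, (k, z.2)) :=
      measurable_fst.prodMk (measurable_const.prodMk measurable_snd)
    have h3 := hv.comp h2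
    simpa only [Function.comp_def, Function.uncurry] using h3
  by_cases h : q = ∞
  · refine ⟨1, le_rfl, fun x w w' h => ell_mono fun k => h _, fun x w w' hw hw' => ?_,
      fun x c w _ _ => ell_smul hq c _, hm⟩
    simp only [NC, NNm, ell, h, if_true, ENNReal.ofReal_one, one_mul]
    exact iSup_le fun k => max_le_max (le_iSup (fun k => w (k, x)) k) (le_iSup (fun k => w' (k, x)) k)
  · have h1 : 0 < q.toReal := ENNReal.toReal_pos hq.ne' h
    refine ⟨2 ^ (1 / q.toReal), Real.one_le_rpow (by norm_num) (by positivity), fun x w w' h => ell_mono fun k => h _,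
      fun x w w' hw hw' => ?_, fun x c w _ _ => ell_smul hq c _, hm⟩
    simp only [NC, NNm, ell, h, if_false]
    rw [← max_rpow (by positivity), ← ENNReal.ofReal_rpow_of_pos (by norm_num),
      ← ENNReal.mul_rpow_of_nonneg _ _ (by positivity)]
    refine ENNReal.rpow_le_rpow ?_ (by positivity)
    simp_rw [max_rpow h1.le]
    rw [show ENNReal.ofReal 2 = 2 by simp, two_mul]
    refine (ENNReal.tsum_le_tsum fun k => max_le_add_of_nonneg (by simp) (by simp)).trans ?_
    rw [ENNReal.tsum_add]
    exact add_le_add (le_max_left _ _) (le_max_right _ _)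

lemma goodNC (n : ℕ) {e : Fin n → ℝ} (he : ∀ i, 0 < e i) {q : ℝ≥0∞} (hq : 0 < q) (m : ℕ) :
    ∃ A, GoodN (NC n e q m) A := by
  induction m with
  | zero => exact goodEll n e hq
  | succ m ih =>
    by_cases h : m < n
    · rw [NC_succ n e q m h]
      obtain ⟨A, hA⟩ := ih
      exact ⟨_, goodInt hA (upd_meas n _) (he _)⟩
    · rw [NC_succ' n e q m h]; exact ih

lemma NNm_pow (n : ℕ) (e : Fin n → ℝ) {θ : ℝ} (hθ : 0 < θ) (m : ℕ) (F : RV n → ℝ≥0∞) (x : RV n) :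
    NNm n e m F x ^ (1 / θ) = NNm n (fun i => θ * e i) m (fun z => F z ^ (1 / θ)) x := by
  induction m generalizing x with
  | zero => rfl
  | succ m ih =>
    by_cases h : m < n
    · simp only [NNm, h, dif_pos, ← ih]
      simp_rw [← ENNReal.rpow_mul]
      congr 1
      · congr 1; ext t; congr 1; field_simp
      · field_simp
    · simp only [NNm, h, dif_neg, not_false_iff, ih]

lemma ell_pow {q : ℝ≥0∞} {θ : ℝ} (hθ : 0 < θ) (u : ℕ → ℝ≥0∞) :
    ell q (fun k => u k ^ θ) ^ (1 / θ) = ell (ENNReal.ofReal θ * q) u := by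
  unfold ell
  by_cases h : q = ∞
  · rw [if_pos h, if_pos (by rw [h, ENNReal.mul_top (by simp [hθ])])]
    have := (ENNReal.orderIsoRpow (1 / θ) (by positivity)).map_iSup (fun k => u k ^ θ)
    simp only [ENNReal.orderIsoRpow_apply] at this
    rw [this]
    congr with k
    rw [← ENNReal.rpow_mul]; simp [hθ.ne']
  · rw [if_neg h, if_neg (ENNReal.mul_ne_top (by simp) h), ENNReal.toReal_mul, ENNReal.toReal_ofReal hθ.le]
    simp_rw [← ENNReal.rpow_mul]
    congr 1
    field_simp

lemma NC_pow (n : ℕ) (e : Fin n → ℝ) (q : ℝ≥0∞) {θ : ℝ} (hθ : 0 < θ) (m : ℕ) :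
    (fun x w => NC n e q m x (fun y => w y ^ θ) ^ (1 / θ)) =
      NC n (fun i => θ * e i) (ENNReal.ofReal θ * q) m := by
  funext x w
  simp only [NC, NNm_pow n e hθ, ell_pow hθ]

lemma Grid.Mx_le (G : Grid) (J : ℕ) {f g : ℝ → ℝ≥0∞} (h : ∀ t, f t ≤ g t) (t : ℝ) : G.Mx J f t ≤ G.Mx J g t :=
  iSup₂_mono fun i hi => mul_le_mul_right (lintegral_mono h) _

lemma bddEllTop (n : ℕ) (e : Fin n → ℝ) {p r : ℝ} (hr : 0 < r) (hrp : r < p) : BddN (NC n e ∞ 0) p r := by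
  obtain ⟨K, hK, hd⟩ := doob (p := p / r) ((one_lt_div hr).2 hrp)
  refine ⟨K, hK, fun x G J v hv => ?_⟩
  simp only [NC, NNm, ell, if_true]
  have hm : Measurable fun s => (⨆ k, v s (k, x)) ^ r :=
    (Measurable.iSup fun k => hv.of_uncurry_right (y := (k, x))).pow_const r
  have := hd G J _ hm
  simp_rw [← ENNReal.rpow_mul, mul_div_cancel₀ _ hr.ne'] at this
  refine le_trans (lintegral_mono fun t => ?_) this
  have hp : 0 < p := hr.trans hrp
  rw [show p / r = (1 / r) * p by ring, ENNReal.rpow_mul]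
  refine ENNReal.rpow_le_rpow (iSup_le fun k => ENNReal.rpow_le_rpow ?_ (by positivity)) hp.le
  exact G.Mx_le J (fun s => ENNReal.rpow_le_rpow (le_iSup (fun k => v s (k, x)) k) hr.le) t

lemma bddEllEq (n : ℕ) (e : Fin n → ℝ) {p r : ℝ} (hr : 0 < r) (hrp : r < p) :
    BddN (NC n e (ENNReal.ofReal p) 0) p r := by
  obtain ⟨K, hK, hd⟩ := doob (p := p / r) ((one_lt_div hr).2 hrp)
  have hp : 0 < p := hr.trans hrp
  refine ⟨K, hK, fun x G J v hv => ?_⟩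
  have hvk : ∀ k, Measurable fun s => v s (k, x) := fun k => hv.of_uncurry_right (y := (k, x))
  simp only [NC, NNm, ell, ENNReal.ofReal_ne_top, if_false, ENNReal.toReal_ofReal hp.le]
  have e1 : ∀ a : ℝ≥0∞, (a ^ (1 / p)) ^ p = a := fun a => by rw [← ENNReal.rpow_mul]; simp [hp.ne']
  simp_rw [e1]
  rw [lintegral_tsum (fun k => ((hvk k).pow_const p).aemeasurable), lintegral_tsum (fun k =>
    (((G.Mx_meas1 J ((hvk k).pow_const r)).pow_const _).pow_const _).aemeasurable), ← ENNReal.tsum_mul_left]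
  refine ENNReal.tsum_le_tsum fun k => ?_
  have := hd G J _ ((hvk k).pow_const r)
  simp_rw [← ENNReal.rpow_mul, mul_div_cancel₀ _ hr.ne'] at this
  simp_rw [← ENNReal.rpow_mul, one_div_mul_eq_div]
  exact this

lemma bddTri {n : ℕ} {e : Fin n → ℝ} (he : ∀ i, 0 < e i) {q : ℝ≥0∞} (hq : 0 < q) {m : ℕ} {p0 p : ℝ}
    (hp0 : 0 < p0) (hp : 0 < p) (h1 : ∃ r0 > 0, ∀ r, 0 < r → r ≤ r0 → BddN (NC n e q m) p0 r)
    (h2 : p < p0 → ∃ r0 > 0, ∀ r, 0 < r → r ≤ r0 →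
      BddN (NC n (fun i => p / p0 * e i) (ENNReal.ofReal (p / p0) * q) m) p r) :
    ∃ r0 > 0, ∀ r, 0 < r → r ≤ r0 → BddN (NC n e q m) p r := by
  obtain ⟨A, hA⟩ := goodNC n he hq m
  rcases lt_trichotomy p p0 with h | h | h
  · obtain ⟨r0, hr0, hb⟩ := h2 h
    refine ⟨min r0 (p / 2), lt_min hr0 (by positivity), fun r hr hrr => ?_⟩
    have hθ : 0 < p / p0 := by positivity
    refine downN hA hr ?_ hθ ((div_lt_one hp0).2 h) ?_
    · have := hrr.trans (min_le_right _ _); linarith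
    · rw [NC_pow n e q hθ]; exact hb r hr (hrr.trans (min_le_left _ _))
  · rw [h]; exact h1
  · obtain ⟨r0, hr0, hb⟩ := h1
    exact ⟨r0, hr0, fun r hr hrr => upN hA hr hp0 h (hb r hr hrr)⟩

lemma bddNC (n : ℕ) (m : ℕ) : ∀ {e : Fin n → ℝ} (he : ∀ i, 0 < e i) {q : ℝ≥0∞} (hq : 0 < q) {p : ℝ} (hp : 0 < p),
    ∃ r0 > 0, ∀ r, 0 < r → r ≤ r0 → BddN (NC n e q m) p r := by
  induction m with
  | zero =>
    intro e he q hq p hp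
    by_cases h : q = ∞
    · subst h
      exact ⟨p / 2, by positivity, fun r hr hrp => bddEllTop n e hr (by linarith)⟩
    · have h1 : 0 < q.toReal := ENNReal.toReal_pos hq.ne' h
      have eq : ∀ {e : Fin n → ℝ} {p : ℝ}, 0 < p → ∃ r0 > 0, ∀ r, 0 < r → r ≤ r0 →
          BddN (NC n e (ENNReal.ofReal p) 0) p r := fun {e p} hp =>
        ⟨p / 2, by positivity, fun r hr hrp => bddEllEq n e hr (by linarith)⟩
      refine bddTri he hq h1 hp ?_ fun hlt => ?_
      · have := eq (e := e) h1
        rwa [ENNReal.ofReal_toReal h] at this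
      · have := eq (e := fun i => p / q.toReal * e i) hp
        have e2 : ENNReal.ofReal (p / q.toReal) * q = ENNReal.ofReal p := by
          conv_lhs => rw [← ENNReal.ofReal_toReal h]
          rw [← ENNReal.ofReal_mul (by positivity), ENNReal.toReal_ofReal h1.le]; congr 1; field_simp
        rwa [e2]
  | succ m ih =>
    intro e he q hq p hp
    by_cases h : m < n
    · have eq : ∀ {e : Fin n → ℝ} (he : ∀ i, 0 < e i) {q : ℝ≥0∞} (hq : 0 < q), ∃ r0 > 0, ∀ r, 0 < r → r ≤ r0 →
          BddN (NC n e q (m + 1)) (e ⟨m, h⟩) r := by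
        intro e he q hq
        obtain ⟨r0, hr0, hb⟩ := ih he hq (he ⟨m, h⟩)
        obtain ⟨A, hA⟩ := goodNC n he hq m
        refine ⟨r0, hr0, fun r hr hrr => ?_⟩
        rw [NC_succ n e q m h]
        exact bddInt hA (upd_meas n _) (he _) (hb r hr hrr)
      refine bddTri he hq (he ⟨m, h⟩) hp (eq he hq) fun hlt => ?_
      have hθ : 0 < p / e ⟨m, h⟩ := div_pos hp (he _)
      have := eq (e := fun i => p / e ⟨m, h⟩ * e i) (fun i => mul_pos hθ (he i))
        (q := ENNReal.ofReal (p / e ⟨m, h⟩) * q) (ENNReal.mul_pos (by simpa using hθ) hq.ne')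
      simpa only [div_mul_cancel₀ p (he ⟨m, h⟩).ne'] using this
    · obtain ⟨r0, hr0, hb⟩ := ih he hq hp
      refine ⟨r0, hr0, fun r hr hrr => ?_⟩
      rw [NC_succ' n e q m h]; exact hb r hr hrr


/-- shifted coordinate -/
def gy (b : ℕ) (K i : ℕ) (t : ℝ) : ℝ := (2:ℝ) ^ ((i:ℤ) - K) * t + b * (-1) ^ (i + K) / 3

lemma gy_succ (b K i : ℕ) (t : ℝ) : gy b K (i+1) t = 2 * gy b K i t - ((b * (-1) ^ (i + K) : ℤ) : ℝ) := by
  have : ((i + 1 : ℕ) : ℤ) - K = ((i : ℤ) - K) + 1 := by push_cast; ring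
  unfold gy
  rw [this, zpow_add_one₀ (by norm_num)]
  push_cast
  rw [show i + 1 + K = i + K + 1 by ring, pow_succ]; ring

lemma gy_vol (b K i : ℕ) (k : ℤ) : volume ((fun t => ⌊gy b K i t⌋) ⁻¹' {k}) =
    ENNReal.ofReal ((2:ℝ) ^ ((K:ℤ) - i)) := by
  have hp : (0:ℝ) < (2:ℝ) ^ ((i:ℤ) - K) := by positivity
  have : (fun t => ⌊gy b K i t⌋) ⁻¹' {k} = Set.Ico ((2:ℝ) ^ ((K:ℤ) - i) * (k - b * (-1) ^ (i + K) / 3))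
      ((2:ℝ) ^ ((K:ℤ) - i) * (k + 1 - b * (-1) ^ (i + K) / 3)) := by
    ext t
    simp only [Set.mem_preimage, Set.mem_singleton_iff, Int.floor_eq_iff, Set.mem_Ico, gy]
    have e : (2:ℝ) ^ ((K:ℤ) - i) = ((2:ℝ) ^ ((i:ℤ) - K))⁻¹ := by rw [← zpow_neg]; congr 1; ring
    rw [e, inv_mul_le_iff₀ hp, lt_inv_mul_iff₀ hp]
    constructor <;> rintro ⟨h1, h2⟩ <;> constructor <;> linarith
  rw [this, Real.volume_Ico]; congr 1; ring

def GG (b K : ℕ) : Grid where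
  c i t := ⌊gy b K i t⌋
  meas i := by
    refine Int.measurable_floor.comp ?_
    unfold gy; fun_prop
  nest i s t h := by
    rw [gy_succ, gy_succ, Int.floor_sub_intCast, Int.floor_sub_intCast] at h
    have h' : ⌊2 * gy b K i s⌋ = ⌊2 * gy b K i t⌋ := by linarith
    have key : ∀ y : ℝ, ⌊y⌋ = ⌊2 * y⌋ / 2 := fun y => by
      have h1 := Int.floor_le (2 * y)
      have h2 := Int.lt_floor_add_one (2 * y)
      rw [Int.floor_eq_iff]
      have h3 : 2 * (⌊2 * y⌋ / 2) ≤ ⌊2 * y⌋ := by omega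
      have h4 : ⌊2 * y⌋ + 1 ≤ 2 * (⌊2 * y⌋ / 2) + 2 := by omega
      have h3' : 2 * ((⌊2 * y⌋ / 2 : ℤ) : ℝ) ≤ ⌊2 * y⌋ := by exact_mod_cast h3
      have h4' : (⌊2 * y⌋ : ℝ) + 1 ≤ 2 * ((⌊2 * y⌋ / 2 : ℤ) : ℝ) + 2 := by exact_mod_cast h4
      constructor <;> linarith
    rw [key (gy b K i s), h', ← key]
  fin i k := by rw [gy_vol]; exact ENNReal.ofReal_ne_top
  pos i k := by rw [gy_vol]; simp; positivity

def MK (K : ℕ) (g : ℝ → ℝ≥0∞) (t : ℝ) : ℝ≥0∞ :=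
  max ((GG 0 K).Mx (2 * K + 1) g t) ((GG 1 K).Mx (2 * K + 1) g t)

lemma GG_mono (b K : ℕ) (g : ℝ → ℝ≥0∞) (t : ℝ) :
    (GG b K).Mx (2 * K + 1) g t ≤ (GG b (K+1)).Mx (2 * (K + 1) + 1) g t := by
  refine iSup₂_le fun i hi => ?_
  refine le_trans (le_of_eq ?_) (le_iSup₂ (f := fun i (_ : i ∈ Set.Iio (2 * (K + 1) + 1)) => (GG b (K+1)).avg i g t)
    (i + 1) (by simp at hi ⊢; omega))
  have : (GG b K).c i = (GG b (K+1)).c (i+1) := by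
    funext s
    simp only [GG, gy]
    rw [show ((i + 1 : ℕ) : ℤ) - ((K + 1 : ℕ) : ℤ) = (i:ℤ) - K by push_cast; ring,
      show i + 1 + (K + 1) = i + K + 2 by ring, pow_add _ (i + K) 2]
    norm_num
  simp only [Grid.avg, this]

lemma MK_mono (g : ℝ → ℝ≥0∞) (t : ℝ) : Monotone fun K => MK K g t :=
  monotone_nat_of_le_succ fun K => max_le_max (GG_mono 0 K g t) (GG_mono 1 K g t)

lemma third {y : ℝ} {s : ℝ} (hs : s = 1 ∨ s = -1) :
    (∀ w, |w - y| < 1/6 → ⌊w⌋ = ⌊y⌋) ∨ (∀ w, |w - y| < 1/6 → ⌊w + s/3⌋ = ⌊y + s/3⌋) := by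
  by_contra! hh
  obtain ⟨⟨w, hw, h1⟩, ⟨w', hw', h2⟩⟩ := hh
  have a1 := Int.floor_le w
  have a2 := Int.lt_floor_add_one w
  have a3 := Int.floor_le y
  have a4 := Int.lt_floor_add_one y
  have b1 := Int.floor_le (w' + s/3)
  have b2 := Int.lt_floor_add_one (w' + s/3)
  have b3 := Int.floor_le (y + s/3)
  have b4 := Int.lt_floor_add_one (y + s/3)
  rw [abs_lt] at hw hw'
  have c : ⌊y + s/3⌋ = ⌊y⌋ ∨ ⌊y + s/3⌋ = ⌊y⌋ + 1 ∨ ⌊y + s/3⌋ = ⌊y⌋ - 1 := by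
    have e1 : ⌊y + s/3⌋ < ⌊y⌋ + 2 := by
      rw [Int.floor_lt]; push_cast; rcases hs with rfl | rfl <;> linarith
    have e2 : ⌊y⌋ - 1 ≤ ⌊y + s/3⌋ := by
      rw [Int.le_floor]; push_cast; rcases hs with rfl | rfl <;> linarith
    omega
  have c1 : (⌊w⌋ : ℝ) ≤ ⌊y⌋ - 1 ∨ (⌊y⌋ : ℝ) + 1 ≤ ⌊w⌋ := by
    rcases lt_or_gt_of_ne h1 with h | h
    · left; have : ⌊w⌋ ≤ ⌊y⌋ - 1 := by omega
      exact_mod_cast this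
    · right; have : ⌊y⌋ + 1 ≤ ⌊w⌋ := by omega
      exact_mod_cast this
  have c2 : (⌊w' + s/3⌋ : ℝ) ≤ ⌊y + s/3⌋ - 1 ∨ (⌊y + s/3⌋ : ℝ) + 1 ≤ ⌊w' + s/3⌋ := by
    rcases lt_or_gt_of_ne h2 with h | h
    · left; have : ⌊w' + s/3⌋ ≤ ⌊y + s/3⌋ - 1 := by omega
      exact_mod_cast this
    · right; have : ⌊y + s/3⌋ + 1 ≤ ⌊w' + s/3⌋ := by omega
      exact_mod_cast this
  rcases c with c | c | c <;> rw [c] at b3 b4 c2 <;> push_cast at b3 b4 c2 <;>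
    rcases c1 with c1 | c1 <;> rcases c2 with c2 | c2 <;> rcases hs with rfl | rfl <;> linarith

lemma interval_le {ρ : ℝ} (hρ : 0 < ρ) (g : ℝ → ℝ≥0∞) (t : ℝ) :
    ∫⁻ s in {s | |t - s| ≤ ρ}, g s ≤ ENNReal.ofReal (12 * ρ) * ⨆ K, MK K g t := by
  obtain ⟨m, hm1, hm2⟩ := exists_mem_Ico_zpow (x := 12 * ρ) (y := 2) (by positivity) (by norm_num)
  obtain ⟨K, i, hK, hi⟩ : ∃ K i : ℕ, (K:ℤ) - i = m ∧ i < 2 * K + 1 := by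
    refine ⟨m.natAbs, (m.natAbs - m).toNat, ?_, ?_⟩ <;> omega
  have hp : (0:ℝ) < (2:ℝ) ^ ((i:ℤ) - K) := by positivity
  have e : (2:ℝ) ^ ((i:ℤ) - K) = ((2:ℝ) ^ m)⁻¹ := by rw [← zpow_neg]; congr 1; omega
  have hm0 : (0:ℝ) < (2:ℝ) ^ m := by positivity
  rw [zpow_add_one₀ (by norm_num)] at hm2
  have hc : ∀ s, |t - s| ≤ ρ → |(2:ℝ) ^ ((i:ℤ) - K) * s - (2:ℝ) ^ ((i:ℤ) - K) * t| < 1/6 := fun s hs => by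
    rw [← mul_sub, abs_mul, abs_of_pos hp, abs_sub_comm, e, inv_mul_lt_iff₀ hm0]; linarith
  have fin : ∀ b : ℕ, (∀ s, |t - s| ≤ ρ → ⌊gy b K i s⌋ = ⌊gy b K i t⌋) → (GG b K).Mx (2 * K + 1) g t ≤ MK K g t →
      ∫⁻ s in {s | |t - s| ≤ ρ}, g s ≤ ENNReal.ofReal (12 * ρ) * ⨆ K, MK K g t := by
    intro b hb hle
    have h1 : (GG b K).avg i g t ≤ ⨆ K, MK K g t :=
      ((le_iSup₂ (f := fun i (_ : i ∈ Set.Iio (2 * K + 1)) => (GG b K).avg i g t) i hi).trans hle).trans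
        (le_iSup (fun K => MK K g t) K)
    have hv : volume ((GG b K).c i ⁻¹' {(GG b K).c i t}) = ENNReal.ofReal ((2:ℝ) ^ m) := by
      rw [← hK]; exact gy_vol b K i _
    calc ∫⁻ s in {s | |t - s| ≤ ρ}, g s ≤ ∫⁻ s in (GG b K).c i ⁻¹' {(GG b K).c i t}, g s :=
          lintegral_mono_set fun s hs => hb s hs
      _ = ENNReal.ofReal ((2:ℝ) ^ m) * (GG b K).avg i g t := by
          unfold Grid.avg
          rw [hv, ← mul_assoc, ENNReal.mul_inv_cancel (by simpa using hm0) ENNReal.ofReal_ne_top, one_mul]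
      _ ≤ _ := mul_le_mul' (ENNReal.ofReal_le_ofReal hm1) h1
  rcases third (y := (2:ℝ) ^ ((i:ℤ) - K) * t) (s := (-1) ^ (i + K)) (neg_one_pow_eq_or ℝ _) with h | h
  · refine fin 0 (fun s hs => ?_) (le_max_left _ _)
    simpa [gy] using h _ (hc s hs)
  · refine fin 1 (fun s hs => ?_) (le_max_right _ _)
    simpa [gy] using h _ (hc s hs)

/-- one dimensional kernel -/
def kap (σ x : ℝ) : ℝ≥0∞ := ENNReal.ofReal (σ / (1 + σ * |x|) ^ 2)

lemma kap_le {σ : ℝ} (hσ : 0 < σ) (t s : ℝ) :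
    kap σ (t - s) ≤ ∑' m : ℕ, Set.indicator {s | |t - s| ≤ 2 ^ m / σ} (fun _ => ENNReal.ofReal (σ * (4 * (1/4) ^ m))) s := by
  by_cases h0 : σ * |t - s| ≤ 1
  · refine le_trans ?_ (ENNReal.le_tsum 0)
    rw [Set.indicator_of_mem (by simp only [Set.mem_ofPred_eq, pow_zero]; rw [le_div_iff₀ hσ]; linarith)]
    refine ENNReal.ofReal_le_ofReal ?_
    rw [div_le_iff₀ (by positivity)]
    have : 0 ≤ σ * |t - s| := by positivity
    nlinarith [mul_nonneg hσ.le this, mul_nonneg hσ.le (mul_nonneg this this)]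
  · push Not at h0
    obtain ⟨m, hm1, hm2⟩ := exists_mem_Ioc_zpow (x := σ * |t - s|) (y := 2) (by linarith) (by norm_num)
    have hm : 0 ≤ m := by
      by_contra! h
      have : (2:ℝ) ^ (m + 1) ≤ 2 ^ (0:ℤ) := zpow_le_zpow_right₀ (by norm_num) (by omega)
      rw [zpow_zero] at this; linarith
    lift m to ℕ using hm
    rw [zpow_natCast] at hm1
    have hm2' : σ * |t - s| ≤ 2 ^ (m + 1) := by exact_mod_cast hm2
    refine le_trans ?_ (ENNReal.le_tsum (m + 1))
    rw [Set.indicator_of_mem (by simp only [Set.mem_ofPred_eq]; rw [le_div_iff₀ hσ]; linarith)]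
    refine ENNReal.ofReal_le_ofReal ?_
    rw [div_eq_mul_inv]
    refine mul_le_mul_of_nonneg_left ?_ hσ.le
    rw [inv_le_comm₀ (by positivity) (by positivity)]
    have e4 : (4 * (1/4:ℝ) ^ (m+1))⁻¹ = (2 ^ m) ^ 2 := by
      rw [← pow_mul, mul_comm m 2, pow_mul, pow_succ, one_div, inv_pow]; norm_num; ring
    rw [e4]
    exact pow_le_pow_left₀ (by positivity) (by linarith) 2

lemma kap_meas (σ : ℝ) : Measurable (kap σ) := by unfold kap; fun_prop

def K1 (σ : ℝ) (g : ℝ → ℝ≥0∞) (t : ℝ) : ℝ≥0∞ := ∫⁻ s, kap σ (t - s) * g s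

lemma K1_le {σ : ℝ} (hσ : 0 < σ) {g : ℝ → ℝ≥0∞} (hg : Measurable g) (t : ℝ) :
    K1 σ g t ≤ 96 * ⨆ K, MK K g t := by
  have hms : ∀ m : ℕ, MeasurableSet {s | |t - s| ≤ 2 ^ m / σ} := fun m =>
    measurableSet_le (by fun_prop) measurable_const
  calc K1 σ g t ≤ ∫⁻ s, ∑' m : ℕ, ENNReal.ofReal (σ * (4 * (1/4) ^ m)) *
        Set.indicator {s | |t - s| ≤ 2 ^ m / σ} g s := by
        refine lintegral_mono fun s => ?_
        refine (mul_le_mul' (kap_le hσ t s) le_rfl).trans ?_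
        rw [← ENNReal.tsum_mul_right]
        refine ENNReal.tsum_le_tsum fun m => le_of_eq ?_
        by_cases h : s ∈ {s | |t - s| ≤ 2 ^ m / σ}
        · rw [Set.indicator_of_mem h, Set.indicator_of_mem h]
        · rw [Set.indicator_of_notMem h, Set.indicator_of_notMem h]; simp
    _ = ∑' m : ℕ, ENNReal.ofReal (σ * (4 * (1/4) ^ m)) * ∫⁻ s in {s | |t - s| ≤ 2 ^ m / σ}, g s := by
        rw [lintegral_tsum fun m => ((hg.indicator (hms m)).const_mul _).aemeasurable]
        refine tsum_congr fun m => ?_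
        rw [lintegral_const_mul _ (hg.indicator (hms m)), lintegral_indicator (hms m)]
    _ ≤ ∑' m : ℕ, ENNReal.ofReal (48 * (1/2) ^ m) * ⨆ K, MK K g t := by
        refine ENNReal.tsum_le_tsum fun m => ?_
        refine (mul_le_mul' le_rfl (interval_le (by positivity) g t)).trans (le_of_eq ?_)
        rw [← mul_assoc, ← ENNReal.ofReal_mul (by positivity)]
        congr 2
        have : (1/4:ℝ) ^ m * 2 ^ m = (1/2) ^ m := by rw [← mul_pow]; norm_num
        rw [← this]; field_simp; ring
    _ = 96 * ⨆ K, MK K g t := by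
        rw [ENNReal.tsum_mul_right, ← ENNReal.ofReal_tsum_of_nonneg (fun m => by positivity)
          ((summable_geometric_of_lt_one (by norm_num) (by norm_num)).mul_left _), tsum_mul_left, tsum_geometric_two]
        norm_num


lemma rpow_iSup {ι : Type} (f : ι → ℝ≥0∞) {r : ℝ} (hr : 0 < r) : (⨆ i, f i) ^ r = ⨆ i, f i ^ r := by
  have := (ENNReal.orderIsoRpow r hr).map_iSup f
  simp only [ENNReal.orderIsoRpow_apply] at this
  exact this

lemma tsum_iSup' {f : ℕ → ℕ → ℝ≥0∞} (h : ∀ k, Monotone fun K => f K k) : ∑' k, ⨆ K, f K k = ⨆ K, ∑' k, f K k := by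
  rw [← lintegral_count, lintegral_iSup (fun K => measurable_from_top) (fun i j hij k => h k hij)]
  simp_rw [lintegral_count]

lemma ell_iSup {q : ℝ≥0∞} (hq : 0 < q) {f : ℕ → ℕ → ℝ≥0∞} (h : ∀ k, Monotone fun K => f K k) :
    ell q (fun k => ⨆ K, f K k) = ⨆ K, ell q (f K) := by
  by_cases hh : q = ∞
  · simp only [ell, hh, if_true]; exact iSup_comm
  · have h1 : 0 < q.toReal := ENNReal.toReal_pos hq.ne' hh
    simp only [ell, hh, if_false]
    simp_rw [rpow_iSup _ h1]
    rw [tsum_iSup' fun k i j hij => ENNReal.rpow_le_rpow (h k hij) h1.le, rpow_iSup _ (by positivity)]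

lemma NNm_mono (n : ℕ) {e : Fin n → ℝ} (he : ∀ i, 0 < e i) (m : ℕ) {F G : RV n → ℝ≥0∞} (h : ∀ x, F x ≤ G x) (x : RV n) :
    NNm n e m F x ≤ NNm n e m G x := by
  induction m generalizing x with
  | zero => exact h x
  | succ m ih =>
    unfold NNm; split_ifs with hm
    · have := he ⟨m, hm⟩
      exact ENNReal.rpow_le_rpow (lintegral_mono fun t => ENNReal.rpow_le_rpow (ih _) this.le) (by positivity)
    · exact ih x

lemma NNm_meas (n : ℕ) {e : Fin n → ℝ} (m : ℕ) {F : RV n → ℝ≥0∞} (h : Measurable F) : Measurable (NNm n e m F) := by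
  induction m with
  | zero => exact h
  | succ m ih =>
    by_cases hm : m < n
    · have : NNm n e (m+1) F = fun x => (∫⁻ t : ℝ, (NNm n e m F (Function.update x ⟨m, hm⟩ t)) ^ (e ⟨m, hm⟩)) ^ (1 / e ⟨m, hm⟩) := by
        funext x; simp [NNm, hm]
      rw [this]
      refine Measurable.pow_const (Measurable.lintegral_prod_right' (f := fun z : RV n × ℝ => (NNm n e m F (Function.update z.1 ⟨m, hm⟩ z.2)) ^ (e ⟨m, hm⟩)) ?_) _
      refine Measurable.pow_const ?_ _
      have h3 := ih.comp (upd_meas n ⟨m, hm⟩)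
      simpa only [Function.comp_def, Function.uncurry_def] using h3
    · have : NNm n e (m+1) F = NNm n e m F := by funext x; simp [NNm, hm]
      rw [this]; exact ih

lemma NNm_iSup (n : ℕ) {e : Fin n → ℝ} (he : ∀ i, 0 < e i) (m : ℕ) {F : ℕ → RV n → ℝ≥0∞} (hF : ∀ K, Measurable (F K))
    (h : ∀ x, Monotone fun K => F K x) (x : RV n) : NNm n e m (fun x => ⨆ K, F K x) x = ⨆ K, NNm n e m (F K) x := by
  induction m generalizing x with
  | zero => rfl
  | succ m ih =>
    by_cases hm : m < n
    · have h0 := he ⟨m, hm⟩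
      simp only [NNm, hm, dif_pos]
      simp_rw [ih, rpow_iSup _ h0]
      rw [lintegral_iSup, rpow_iSup _ (by positivity)]
      · intro K
        refine Measurable.pow_const ?_ _
        have h3 := (NNm_meas n (e := e) m (hF K)).comp (measurable_update x (a := ⟨m, hm⟩))
        simpa only [Function.comp_def] using h3
      · intro i j hij t
        exact ENNReal.rpow_le_rpow (NNm_mono n he m (fun z => h z hij) _) h0.le
    · simp only [NNm, hm, dif_neg, not_false_eq_true]; exact ih x

lemma NNm_upd (n : ℕ) (e : Fin n → ℝ) (l : Fin n) (t : ℝ) (m : ℕ) (hm : m ≤ l) (F : RV n → ℝ≥0∞) (x : RV n) :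
    NNm n e m F (Function.update x l t) = NNm n e m (fun z => F (Function.update z l t)) x := by
  induction m generalizing x with
  | zero => rfl
  | succ m ih =>
    have hm' : m < n := by omega
    simp only [NNm, hm', dif_pos]
    congr 2; funext s
    rw [Function.update_comm (by intro h; rw [h] at hm; simp at hm), ih (by omega)]

lemma NNm_ext (n : ℕ) {e : Fin n → ℝ} (he : ∀ i, 0 < e i) {m m' : ℕ} (hmm : m ≤ m') {F G : RV n → ℝ≥0∞} {c : ℝ≥0∞}
    (hc : c ≠ ∞)
    (h : ∀ x, NNm n e m F x ≤ c * NNm n e m G x) (x : RV n) : NNm n e m' F x ≤ c * NNm n e m' G x := by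
  induction hmm generalizing x with
  | refl => exact h x
  | @step m' _ ih =>
    by_cases hm : m' < n
    · have h0 := he ⟨m', hm⟩
      simp only [NNm, hm, dif_pos]
      calc _ ≤ (∫⁻ t : ℝ, c ^ e ⟨m', hm⟩ * (NNm n e m' G (Function.update x ⟨m', hm⟩ t)) ^ (e ⟨m', hm⟩)) ^ (1 / e ⟨m', hm⟩) := by
            refine ENNReal.rpow_le_rpow (lintegral_mono fun t => ?_) (by positivity)
            rw [← ENNReal.mul_rpow_of_nonneg _ _ h0.le]
            exact ENNReal.rpow_le_rpow (ih _) h0.le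
        _ = _ := by
            rw [lintegral_const_mul' _ _ (ENNReal.rpow_ne_top_of_nonneg h0.le hc),
              ENNReal.mul_rpow_of_nonneg _ _ (by positivity), ← ENNReal.rpow_mul, mul_one_div_cancel h0.ne', ENNReal.rpow_one]
    · simp only [NNm, hm, dif_neg, not_false_eq_true]; exact ih x

/-- coordinate operator -/
def Tl (n : ℕ) (l : Fin n) (σ : ℝ) (v : RV n → ℝ≥0∞) (x : RV n) : ℝ≥0∞ :=
  ∫⁻ s, kap σ (x l - s) * v (Function.update x l s)

lemma Tl_meas (n : ℕ) (l : Fin n) (σ : ℝ) {v : RV n → ℝ≥0∞} (hv : Measurable v) : Measurable (Tl n l σ v) := by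
  refine Measurable.lintegral_prod_right' (f := fun z : RV n × ℝ => kap σ (z.1 l - z.2) * v (Function.update z.1 l z.2)) ?_
  refine Measurable.mul ((kap_meas σ).comp ?_) ?_
  · exact ((measurable_pi_apply l).comp measurable_fst).sub measurable_snd
  · have h3 := hv.comp (upd_meas n l)
    simpa only [Function.comp_def, Function.uncurry_def] using h3

lemma NC_iSup (n : ℕ) {e : Fin n → ℝ} (he : ∀ i, 0 < e i) {q : ℝ≥0∞} (hq : 0 < q) (l : ℕ) {w : ℕ → ℕ × RV n → ℝ≥0∞}
    (hw : ∀ K, Measurable (w K)) (hm : ∀ y, Monotone fun K => w K y) (x : RV n) :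
    NC n e q l x (fun y => ⨆ K, w K y) = ⨆ K, NC n e q l x (w K) := by
  unfold NC
  rw [← NNm_iSup n he]
  · congr 1; funext z
    exact ell_iSup hq fun k => hm (k, z)
  · intro K
    refine ell_meas (u := fun k (z : RV n) => w K (k, z)) fun k => ?_
    have h3 := (hw K).comp (measurable_prodMk_left (x := k))
    simpa only [Function.comp_def] using h3
  · exact fun z i j hij => ell_mono fun k => hm (k, z) hij

set_option maxHeartbeats 800000 in
/-- coordinatewise bound -/
lemma coordB (n : ℕ) {e : Fin n → ℝ} (he : ∀ i, 0 < e i) {q : ℝ≥0∞} (hq : 0 < q) (l : Fin n) :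
    ∃ r0 > (0:ℝ), ∀ r : ℝ, 0 < r → r ≤ r0 → ∃ C : ℝ≥0∞, C ≠ ∞ ∧ ∀ (σ : ℕ → ℝ), (∀ k, 0 < σ k) → ∀ u : ℕ → RV n → ℝ≥0∞,
      (∀ k, Measurable (u k)) → ∀ x,
      NNm n e (l+1) (fun x => ell q fun k => Tl n l (σ k) (fun z => u k z ^ r) x ^ (1/r)) x ≤
        C * NNm n e (l+1) (fun x => ell q fun k => u k x) x := by
  obtain ⟨r0, hr0, hb⟩ := bddNC n l he hq (he l)
  refine ⟨r0, hr0, fun r hr hrr => ?_⟩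
  obtain ⟨D, hD, hb⟩ := hb r hr hrr
  obtain ⟨A, hA⟩ := goodNC n he hq l
  have el := he l
  have h1r : 0 < 1 / r := by positivity
  refine ⟨(((96:ℝ≥0∞) ^ (1/r)) ^ e l * (ENNReal.ofReal A ^ e l * (D + D))) ^ (1 / e l), ?_, ?_⟩
  · refine ENNReal.rpow_ne_top_of_nonneg (by positivity) (ENNReal.mul_ne_top ?_ (ENNReal.mul_ne_top ?_ (by simp [hD])))
    · exact ENNReal.rpow_ne_top_of_nonneg el.le (ENNReal.rpow_ne_top_of_nonneg h1r.le (by simp))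
    · exact ENNReal.rpow_ne_top_of_nonneg el.le (by simp)
  intro σ hσ u hu x
  set v : ℝ → ℕ × RV n → ℝ≥0∞ := fun t w => u w.1 (Function.update w.2 l t) with hv
  have hvm : Measurable (Function.uncurry v) := by
    have : Measurable fun w : ℕ × (ℝ × RV n) => u w.1 (Function.update w.2.2 l w.2.1) := by
      refine measurable_from_prod_countable_right fun k => ?_
      have h3 := (hu k).comp ((upd_meas n l).comp measurable_swap)
      simpa only [Function.comp_def, Function.uncurry_def, Prod.fst_swap, Prod.snd_swap] using h3
    have h3 := this.comp (show Measurable fun w : ℝ × (ℕ × RV n) => (w.2.1, (w.1, w.2.2)) by fun_prop)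
    simpa only [Function.comp_def, Function.uncurry_def] using h3
  have hMm : ∀ b K, Measurable fun z : ℝ × (ℕ × RV n) => (GG b K).Mx (2*K+1) (fun s => v s z.2 ^ r) z.1 := by
    intro b K
    have h2 := (GG b K).Mx_meas (2*K+1) (v := fun s y => v s y ^ r) (hvm.pow_const r)
    exact h2
  have hMKm : ∀ K, Measurable fun z : ℝ × (ℕ × RV n) => MK K (fun s => v s z.2 ^ r) z.1 ^ (1/r) := fun K =>
    ((hMm 0 K).max (hMm 1 K)).pow_const _
  set I := ∫⁻ t, NC n e q l x (v t) ^ e l with hI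
  have hK : ∀ K, ∫⁻ t, NC n e q l x (fun y => MK K (fun s => v s y ^ r) t ^ (1/r)) ^ e l ≤ ENNReal.ofReal A ^ e l * ((D + D) * I) := by
    intro K
    have b0 := hb x (GG 0 K) (2*K+1) v hvm
    have b1 := hb x (GG 1 K) (2*K+1) v hvm
    have hsec : ∀ b t, Measurable fun y => (GG b K).Mx (2*K+1) (fun s => v s y ^ r) t ^ (1/r) := fun b t => by
      have h3 := ((hMm b K).comp (measurable_prodMk_left (x := t))).pow_const (1/r)
      simpa only [Function.comp_def] using h3
    have hm0 : Measurable fun t => NC n e q l x (fun y => (GG 0 K).Mx (2*K+1) (fun s => v s y ^ r) t ^ (1/r)) ^ e l :=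
      (hA.meas1 x (v := fun t y => (GG 0 K).Mx (2*K+1) (fun s => v s y ^ r) t ^ (1/r)) ((hMm 0 K).pow_const _)).pow_const _
    calc _ ≤ ∫⁻ t, ENNReal.ofReal A ^ e l * (NC n e q l x (fun y => (GG 0 K).Mx (2*K+1) (fun s => v s y ^ r) t ^ (1/r)) ^ e l
            + NC n e q l x (fun y => (GG 1 K).Mx (2*K+1) (fun s => v s y ^ r) t ^ (1/r)) ^ e l) := by
          refine lintegral_mono fun t => ?_
          have h1 := hA.sup x (hsec 0 t) (hsec 1 t)
          have h2 : NC n e q l x (fun y => MK K (fun s => v s y ^ r) t ^ (1/r)) =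
              NC n e q l x (fun y => max ((GG 0 K).Mx (2 * K + 1) (fun s => v s y ^ r) t ^ (1 / r))
                ((GG 1 K).Mx (2 * K + 1) (fun s => v s y ^ r) t ^ (1 / r))) := by
            congr 1; funext y; exact max_rpow h1r.le
          rw [h2]
          refine (ENNReal.rpow_le_rpow h1 el.le).trans ?_
          rw [ENNReal.mul_rpow_of_nonneg _ _ el.le, max_rpow el.le]
          exact mul_le_mul' le_rfl (max_le le_self_add le_add_self)
      _ ≤ _ := by
          rw [lintegral_const_mul' _ _ (ENNReal.rpow_ne_top_of_nonneg el.le (by simp)), lintegral_add_left hm0, add_mul]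
          gcongr
  have key : ∀ t, NNm n e l (fun x => ell q fun k => Tl n l (σ k) (fun z => u k z ^ r) x ^ (1/r)) (Function.update x l t) ≤
      (96:ℝ≥0∞) ^ (1/r) * ⨆ K, NC n e q l x (fun y => MK K (fun s => v s y ^ r) t ^ (1/r)) := by
    intro t
    rw [NNm_upd n e l t l le_rfl]
    have hsec : ∀ K, Measurable fun y => MK K (fun s => v s y ^ r) t ^ (1/r) := fun K => by
      have h3 := (hMKm K).comp (measurable_prodMk_left (x := t))
      simpa only [Function.comp_def] using h3
    have e1 : ⨆ K, NC n e q l x (fun y => MK K (fun s => v s y ^ r) t ^ (1/r)) =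
        NC n e q l x (fun y => ⨆ K, MK K (fun s => v s y ^ r) t ^ (1/r)) := by
      exact (NC_iSup n he hq l hsec (fun y i j hij => ENNReal.rpow_le_rpow (MK_mono _ _ hij) h1r.le) x).symm
    rw [e1, ← hA.smul x _ (ENNReal.rpow_ne_top_of_nonneg h1r.le (by simp)) (Measurable.iSup hsec)]
    refine NNm_mono n he l (fun z => ell_mono fun k => ?_) x
    simp only [← rpow_iSup _ h1r]
    rw [← ENNReal.mul_rpow_of_nonneg _ _ h1r.le]
    refine ENNReal.rpow_le_rpow ?_ h1r.le
    have e2 : Tl n l (σ k) (fun z => u k z ^ r) (Function.update z l t) = K1 (σ k) (fun s => v s (k, z) ^ r) t := by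
      unfold Tl K1; simp [hv]
    rw [e2]
    refine K1_le (hσ k) (Measurable.pow_const ?_ _) t
    have h3 := hvm.comp (measurable_prodMk_right (y := (k, z)))
    simpa only [Function.comp_def, Function.uncurry] using h3
  have hl : (l:ℕ) < n := l.2
  simp only [NNm, hl, dif_pos]
  rw [← ENNReal.mul_rpow_of_nonneg _ _ (by positivity)]
  refine ENNReal.rpow_le_rpow ?_ (by positivity)
  calc _ ≤ ∫⁻ t, ((96:ℝ≥0∞) ^ (1/r)) ^ e l * ⨆ K, NC n e q l x (fun y => MK K (fun s => v s y ^ r) t ^ (1/r)) ^ e l := by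
        refine lintegral_mono fun t => ?_
        rw [← rpow_iSup _ el, ← ENNReal.mul_rpow_of_nonneg _ _ el.le]
        exact ENNReal.rpow_le_rpow (key t) el.le
    _ ≤ ((96:ℝ≥0∞) ^ (1/r)) ^ e l * (ENNReal.ofReal A ^ e l * ((D + D) * I)) := by
        rw [lintegral_const_mul' _ _ (ENNReal.rpow_ne_top_of_nonneg el.le (ENNReal.rpow_ne_top_of_nonneg h1r.le (by simp))),
          lintegral_iSup]
        · exact mul_le_mul' le_rfl (iSup_le hK)
        · intro K
          exact (hA.meas1 x (v := fun t y => MK K (fun s => v s y ^ r) t ^ (1/r)) (hMKm K)).pow_const _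
        · exact fun i j hij t => ENNReal.rpow_le_rpow (hA.mono x fun y => ENNReal.rpow_le_rpow (MK_mono _ _ hij) h1r.le) el.le
    _ = _ := by
        have : I = ∫⁻ t, NNm n e l (fun x => ell q fun k => u k x) (Function.update x l t) ^ e l := by
          rw [hI]; congr 1; funext t; rw [NNm_upd n e l t l le_rfl]; rfl
        rw [← this]; ring


def Tm (n : ℕ) (σ : Fin n → ℝ) (v : RV n → ℝ≥0∞) : ℕ → RV n → ℝ≥0∞
  | 0 => v
  | m + 1 => if h : m < n then Tl n ⟨m, h⟩ (σ ⟨m, h⟩) (Tm n σ v m) else Tm n σ v m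

lemma Tm_meas (n : ℕ) (σ : Fin n → ℝ) {v : RV n → ℝ≥0∞} (hv : Measurable v) (m : ℕ) : Measurable (Tm n σ v m) := by
  induction m with
  | zero => exact hv
  | succ m ih =>
    unfold Tm; split_ifs
    · exact Tl_meas n _ _ ih
    · exact ih

lemma FSm (n : ℕ) {e : Fin n → ℝ} (he : ∀ i, 0 < e i) {q : ℝ≥0∞} (hq : 0 < q) (m : ℕ) :
    ∃ r0 > (0:ℝ), ∀ r : ℝ, 0 < r → r ≤ r0 → ∃ C : ℝ≥0∞, C ≠ ∞ ∧ ∀ (σ : ℕ → Fin n → ℝ), (∀ k l, 0 < σ k l) →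
      ∀ u : ℕ → RV n → ℝ≥0∞, (∀ k, Measurable (u k)) → ∀ x,
      NNm n e n (fun x => ell q fun k => Tm n (σ k) (fun z => u k z ^ r) m x ^ (1/r)) x ≤
        C * NNm n e n (fun x => ell q fun k => u k x) x := by
  induction m with
  | zero =>
    refine ⟨1, one_pos, fun r hr _ => ⟨1, by simp, fun σ _ u _ x => ?_⟩⟩
    simp only [Tm, ← ENNReal.rpow_mul, mul_one_div_cancel hr.ne', ENNReal.rpow_one, one_mul, le_refl]
  | succ m ih =>
    by_cases h : m < n
    · obtain ⟨r0, hr0, ih⟩ := ih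
      obtain ⟨r1, hr1, hc⟩ := coordB n he hq ⟨m, h⟩
      refine ⟨min r0 r1, lt_min hr0 hr1, fun r hr hrr => ?_⟩
      obtain ⟨C, hC, ih⟩ := ih r hr (hrr.trans (min_le_left _ _))
      obtain ⟨D, hD, hc⟩ := hc r hr (hrr.trans (min_le_right _ _))
      refine ⟨D * C, ENNReal.mul_ne_top hD hC, fun σ hσ u hu x => ?_⟩
      have h1 := NNm_ext n he (show m + 1 ≤ n from h) hD (hc (fun k => σ k ⟨m, h⟩) (fun k => hσ k _)
        (fun k x => Tm n (σ k) (fun z => u k z ^ r) m x ^ (1/r))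
        (fun k => (Tm_meas n (σ k) ((hu k).pow_const r) m).pow_const _)) x
      simp only [← ENNReal.rpow_mul, one_div_mul_cancel hr.ne', ENNReal.rpow_one] at h1
      simp only [Tm, h, dif_pos]
      refine h1.trans ?_
      rw [mul_assoc]
      exact mul_le_mul' le_rfl (ih σ hσ u hu x)
    · simp only [Tm, h, dif_neg, not_false_eq_true]; exact ih

def WB (n : ℕ) (σ : Fin n → ℝ) (v : RV n → ℝ≥0∞) (x : RV n) : ℝ≥0∞ :=
  ∫⁻ z, (∏ l, kap (σ l) (x l - z l)) * v z

lemma Tm_eq (n : ℕ) (σ : Fin n → ℝ) {v : RV n → ℝ≥0∞} (hv : Measurable v) (m : ℕ) (hm : m ≤ n) (x : RV n) :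
    Tm n σ v m x = lmarginal (fun _ => volume) (Finset.univ.filter fun i : Fin n => (i:ℕ) < m)
      (fun z => (∏ l ∈ Finset.univ.filter fun i : Fin n => (i:ℕ) < m, kap (σ l) (x l - z l)) * v z) x := by
  induction m generalizing x with
  | zero => simp [Tm]
  | succ m ih =>
    have h : m < n := hm
    have hs : (Finset.univ.filter fun i : Fin n => (i:ℕ) < m + 1) =
        insert ⟨m, h⟩ (Finset.univ.filter fun i : Fin n => (i:ℕ) < m) := by
      ext i; simp [Fin.ext_iff]; omega
    have hni : (⟨m, h⟩ : Fin n) ∉ (Finset.univ.filter fun i : Fin n => (i:ℕ) < m) := by simp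
    have hmeas : ∀ s : Finset (Fin n), Measurable fun z : RV n => (∏ l ∈ s, kap (σ l) (x l - z l)) * v z := fun s => by
      refine Measurable.mul (Finset.measurable_prod _ fun l _ => (kap_meas _).comp ?_) hv
      exact measurable_const.sub (measurable_pi_apply l)
    rw [hs, lmarginal_insert _ (hmeas _) hni]
    simp only [Tm, h, dif_pos, Tl]
    refine lintegral_congr fun s => ?_
    rw [ih (by omega)]
    unfold lmarginal
    rw [← lintegral_const_mul' _ _ (by unfold kap; exact ENNReal.ofReal_ne_top)]
    refine lintegral_congr fun y => ?_
    beta_reduce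
    rw [Finset.prod_insert hni, mul_assoc]
    congr 1
    · congr 2; simp [Function.updateFinset]
    · congr 1
      refine Finset.prod_congr rfl fun l hl => ?_
      rw [Function.update_of_ne]; rintro rfl; exact hni hl

lemma WB_eq (n : ℕ) (σ : Fin n → ℝ) {v : RV n → ℝ≥0∞} (hv : Measurable v) (x : RV n) : WB n σ v x = Tm n σ v n x := by
  rw [Tm_eq n σ hv n le_rfl]
  have : (Finset.univ.filter fun i : Fin n => (i:ℕ) < n) = Finset.univ := by ext; simp
  rw [this, lmarginal_univ]; rfl

lemma mixAux_eq (n : ℕ) {p : Fin n → ℝ≥0∞} (hp : ∀ i, 0 < p i ∧ p i ≠ ∞) (m : ℕ) (F : RV n → ℝ≥0∞) :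
    mixAux n p m F = NNm n (fun i => (p i).toReal) m F := by
  induction m with
  | zero => rfl
  | succ m ih => funext x; simp only [mixAux, NNm, ih, (hp _).2, if_false]

lemma seqNorm_eq (n : ℕ) {p : Fin n → ℝ≥0∞} (hp : ∀ i, 0 < p i ∧ p i ≠ ∞) (q : ℝ≥0∞) (u : ℕ → RV n → ℝ≥0∞) :
    seqNorm n p q u = NNm n (fun i => (p i).toReal) n (fun x => ell q fun k => u k x) (fun _ => 0) := by
  unfold seqNorm mixedNorm; rw [mixAux_eq n hp]; rfl

/-- vector valued maximal inequality -/
theorem FS (n : ℕ) {p : Fin n → ℝ≥0∞} (hp : ∀ i, 0 < p i ∧ p i ≠ ∞) {q : ℝ≥0∞} (hq : 0 < q) :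
    ∃ r0 > (0:ℝ), ∀ r : ℝ, 0 < r → r ≤ r0 → ∃ C : ℝ≥0∞, C ≠ ∞ ∧ ∀ (σ : ℕ → Fin n → ℝ), (∀ k l, 0 < σ k l) →
      ∀ u : ℕ → RV n → ℝ≥0∞, (∀ k, Measurable (u k)) →
      seqNorm n p q (fun k x => WB n (σ k) (fun z => u k z ^ r) x ^ (1/r)) ≤ C * seqNorm n p q u := by
  obtain ⟨r0, hr0, h⟩ := FSm n (e := fun i => (p i).toReal) (fun i => ENNReal.toReal_pos (hp i).1.ne' (hp i).2) hq n
  refine ⟨r0, hr0, fun r hr hrr => ?_⟩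
  obtain ⟨C, hC, h⟩ := h r hr hrr
  refine ⟨C, hC, fun σ hσ u hu => ?_⟩
  rw [seqNorm_eq n hp, seqNorm_eq n hp]
  have := h σ hσ u hu (fun _ => 0)
  simpa only [WB_eq n _ ((hu _).pow_const r)] using this

/-- monotone / dominated version -/
lemma seqNorm_dom (n : ℕ) {p : Fin n → ℝ≥0∞} (hp : ∀ i, 0 < p i ∧ p i ≠ ∞) {q : ℝ≥0∞} {u v : ℕ → RV n → ℝ≥0∞} {c : ℝ≥0∞}
    (hc : c ≠ ∞) (h : ∀ x, ell q (fun k => u k x) ≤ c * ell q (fun k => v k x)) : seqNorm n p q u ≤ c * seqNorm n p q v := by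
  rw [seqNorm_eq n hp, seqNorm_eq n hp]
  exact NNm_ext n (fun i => ENNReal.toReal_pos (hp i).1.ne' (hp i).2) (Nat.zero_le n) hc (fun x => h x) _


def T2 (x : ℝ) : ℝ≥0∞ := (2:ℝ≥0∞) ^ x

lemma T2_add (x y : ℝ) : T2 (x + y) = T2 x * T2 y := ENNReal.rpow_add x y (by simp) (by simp)
lemma T2_zero : T2 0 = 1 := ENNReal.rpow_zero
lemma T2_ne_top (x : ℝ) : T2 x ≠ ∞ := by unfold T2; exact ENNReal.rpow_ne_top_of_ne_zero (by simp) (by simp)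
lemma T2_ne_zero (x : ℝ) : T2 x ≠ 0 := by unfold T2; simp
lemma T2_mono {x y : ℝ} (h : x ≤ y) : T2 x ≤ T2 y := ENNReal.rpow_le_rpow_of_exponent_le (by simp) h
lemma T2_rpow (x r : ℝ) : T2 x ^ r = T2 (x * r) := (ENNReal.rpow_mul _ _ _).symm
lemma T2_pow (x : ℝ) (m : ℕ) : T2 x ^ m = T2 (m * x) := by
  rw [← ENNReal.rpow_natCast, T2_rpow, mul_comm]
lemma T2_ofReal (x : ℝ) : ENNReal.ofReal ((2:ℝ) ^ x) = T2 x := by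
  rw [← ENNReal.ofReal_rpow_of_pos (by norm_num)]; simp [T2]
lemma T2_le_one {x : ℝ} (h : x ≤ 0) : T2 x ≤ 1 := T2_zero ▸ T2_mono h

lemma T2_geom {δ : ℝ} (hδ : 0 < δ) : ∑' i : ℕ, T2 (-(i * δ)) ≠ ∞ := by
  have : ∀ i : ℕ, T2 (-(i * δ)) = T2 (-δ) ^ i := fun i => by rw [T2_pow]; congr 1; ring
  simp_rw [this, ENNReal.tsum_geometric]
  rw [ENNReal.inv_ne_top]
  have : T2 (-δ) < 1 := ENNReal.rpow_lt_one_of_one_lt_of_neg (by simp) (by linarith)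
  exact (tsub_pos_of_lt this).ne'

/-- data for the Rychkov argument -/
structure Wt (n : ℕ) (V : ℕ → ℝ≥0∞) (w : ℕ → RV n → ℝ≥0∞) (b : ℝ) (C0 : ℝ≥0∞) : Prop where
  one : ∀ k, w k 0 = 1
  le1 : ∀ k z, w k z ≤ 1
  pos : ∀ k z, w k z ≠ 0
  meas : ∀ k, Measurable (w k)
  Vt : ∀ k, V k ≠ ∞
  tri : ∀ k i x y z, w k (x - y) * w (k + i) (y - z) ≤ T2 (i * b) * w (k + i) (x - z)
  tri0 : ∀ k x y, w k (x - y) * w 0 x ≤ w 0 y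
  hb : 0 ≤ b
  hC0 : C0 ≠ ∞
  int : ∀ k x, ∫⁻ z, V k * w k (x - z) ^ 2 ≤ C0

section R
variable {n : ℕ} {V : ℕ → ℝ≥0∞} {w : ℕ → RV n → ℝ≥0∞} {b : ℝ} {C0 : ℝ≥0∞} 

def XX (w : ℕ → RV n → ℝ≥0∞) (A : ℝ) (N : ℕ) (h : ℕ → RV n → ℝ≥0∞) (j : ℕ) (x : RV n) (i : ℕ) (y : RV n) : ℝ≥0∞ :=
  T2 (-(i * A)) * (w (j + i) (x - y) ^ N * h (j + i) y)

def DD (w : ℕ → RV n → ℝ≥0∞) (A : ℝ) (N : ℕ) (h : ℕ → RV n → ℝ≥0∞) (j : ℕ) (x : RV n) : ℝ≥0∞ := ⨆ i, ⨆ y, XX w A N h j x i y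

def SS (V : ℕ → ℝ≥0∞) (w : ℕ → RV n → ℝ≥0∞) (A : ℝ) (N : ℕ) (r : ℝ) (h : ℕ → RV n → ℝ≥0∞) (j : ℕ) (x : RV n) : ℝ≥0∞ :=
  ∑' i, ∫⁻ z, V (j + i) * XX w A N h j x i z ^ r

lemma XX_le_DD (A : ℝ) (N : ℕ) (h : ℕ → RV n → ℝ≥0∞) (j : ℕ) (x : RV n) (i : ℕ) (y : RV n) :
    XX w A N h j x i y ≤ DD w A N h j x := le_iSup₂ (f := fun i y => XX w A N h j x i y) i y

/-- composition estimate -/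
lemma XX_comp (hw : Wt n V w b C0) (A A1 : ℝ) (N N1 : ℕ) (hN : N ≤ N1) (hA : A + b * N ≤ A1) (h : ℕ → RV n → ℝ≥0∞) (j : ℕ) (x : RV n) (i : ℕ) (y : RV n) (m : ℕ) (z : RV n) :
    T2 (-(i * A)) * w (j + i) (x - y) ^ N * XX w A1 N1 h (j + i) y m z ≤ XX w A N h j x (i + m) z := by
  unfold XX
  have h1 := hw.tri (j + i) m x y z
  have h2 : w (j + i) (x - y) ^ N * w (j + i + m) (y - z) ^ N1 ≤ T2 (m * (b * N)) * w (j + i + m) (x - z) ^ N := by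
    calc _ ≤ w (j + i) (x - y) ^ N * w (j + i + m) (y - z) ^ N :=
          mul_le_mul' le_rfl (pow_le_pow_right_of_le_one' (hw.le1 _ _) hN)
      _ = (w (j + i) (x - y) * w (j + i + m) (y - z)) ^ N := (mul_pow _ _ _).symm
      _ ≤ (T2 (m * b) * w (j + i + m) (x - z)) ^ N := pow_le_pow_left' h1 N
      _ = _ := by rw [mul_pow, T2_pow]; congr 2; ring
  rw [show j + (i + m) = j + i + m by ring]
  calc _ = T2 (-(i * A)) * T2 (-(m * A1)) * (w (j + i) (x - y) ^ N * w (j + i + m) (y - z) ^ N1) * h (j + i + m) z := by ring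
    _ ≤ T2 (-(i * A)) * T2 (-(m * A1)) * (T2 (m * (b * N)) * w (j + i + m) (x - z) ^ N) * h (j + i + m) z := by gcongr
    _ = T2 (-(i * A) + -(m * A1) + m * (b * N)) * (w (j + i + m) (x - z) ^ N * h (j + i + m) z) := by
        rw [T2_add, T2_add]; ring
    _ ≤ _ := by
        gcongr
        refine T2_mono ?_
        push_cast
        nlinarith [(Nat.cast_nonneg m : (0:ℝ) ≤ m)]

def I1 (V : ℕ → ℝ≥0∞) (w : ℕ → RV n → ℝ≥0∞) (A : ℝ) (N : ℕ) (C : ℝ≥0∞) (h : ℕ → RV n → ℝ≥0∞) : Prop :=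
  ∀ j y, h j y ≤ C * ∑' i : ℕ, T2 (-(i * A)) * ∫⁻ z, V (j + i) * (w (j + i) (y - z) ^ N * h (j + i) z)

lemma I1_XX (A : ℝ) (N : ℕ) (C : ℝ≥0∞) (h : ℕ → RV n → ℝ≥0∞) (H : I1 V w A N C h) (j : ℕ) (y : RV n) :
    h j y ≤ C * ∑' i : ℕ, ∫⁻ z, V (j + i) * XX w A N h j y i z := by
  refine (H j y).trans (le_of_eq ?_)
  congr 1; refine tsum_congr fun i => ?_
  rw [← lintegral_const_mul' _ _ (T2_ne_top _)]
  refine lintegral_congr fun z => ?_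
  unfold XX; ring

lemma tsum_shift (f : ℕ → ℝ≥0∞) (i : ℕ) : ∑' m, f (i + m) ≤ ∑' m, f m := by
  exact ENNReal.tsum_comp_le_tsum_of_injective (add_right_injective i) f

lemma R1 (hw : Wt n V w b C0) {A : ℝ} {N : ℕ} {C : ℝ≥0∞} {r : ℝ} (hr : 0 < r) (hr1 : r ≤ 1) {h : ℕ → RV n → ℝ≥0∞}
    (H : I1 V w (A + b * N) N C h) {j : ℕ} {x : RV n} (hD : DD w A N h j x ≠ ∞) :
    DD w A N h j x ^ r ≤ C * SS V w A N r h j x := by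
  set D := DD w A N h j x with hDd
  by_cases h0 : D = 0
  · rw [h0, ENNReal.zero_rpow_of_pos hr]; exact zero_le
  have key : D ≤ C * (D ^ (1 - r) * SS V w A N r h j x) := by
    refine iSup₂_le fun i y => ?_
    have h1 := I1_XX _ _ _ _ H (j + i) y
    calc XX w A N h j x i y = T2 (-(i * A)) * w (j + i) (x - y) ^ N * h (j + i) y := by unfold XX; ring
      _ ≤ T2 (-(i * A)) * w (j + i) (x - y) ^ N * (C * ∑' m : ℕ, ∫⁻ z, V (j + i + m) * XX w (A + b * N) N h (j + i) y m z) := by gcongr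
      _ = C * ∑' m : ℕ, ∫⁻ z, V (j + i + m) * (T2 (-(i * A)) * w (j + i) (x - y) ^ N * XX w (A + b * N) N h (j + i) y m z) := by
          rw [mul_left_comm, ← ENNReal.tsum_mul_left]
          congr 1; refine tsum_congr fun m => ?_
          rw [← lintegral_const_mul' _ _ (ENNReal.mul_ne_top (T2_ne_top _) (ENNReal.pow_ne_top (ne_top_of_le_ne_top ENNReal.one_ne_top (hw.le1 _ _))))]
          refine lintegral_congr fun z => ?_
          ring
      _ ≤ C * ∑' m : ℕ, ∫⁻ z, V (j + (i + m)) * (D ^ (1 - r) * XX w A N h j x (i + m) z ^ r) := by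
          refine mul_le_mul' le_rfl (ENNReal.tsum_le_tsum fun m => lintegral_mono fun z => ?_)
          rw [← add_assoc]
          refine mul_le_mul' le_rfl ((XX_comp hw A _ N N le_rfl le_rfl h j x i y m z).trans ?_)
          have hle := XX_le_DD (w := w) A N h j x (i + m) z
          rw [← hDd] at hle
          calc XX w A N h j x (i + m) z = XX w A N h j x (i + m) z ^ ((1 - r) + r) := by simp
            _ = XX w A N h j x (i + m) z ^ (1 - r) * XX w A N h j x (i + m) z ^ r :=
                ENNReal.rpow_add_of_nonneg _ _ (by linarith) hr.le
            _ ≤ _ := mul_le_mul' (ENNReal.rpow_le_rpow hle (by linarith)) le_rfl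
      _ ≤ C * ∑' m : ℕ, ∫⁻ z, V (j + m) * (D ^ (1 - r) * XX w A N h j x m z ^ r) := by
          exact mul_le_mul' le_rfl <| tsum_shift (fun m => ∫⁻ z, V (j + m) * (D ^ (1 - r) * XX w A N h j x m z ^ r)) i
      _ = _ := by
          unfold SS
          congr 1
          rw [← ENNReal.tsum_mul_left]
          refine tsum_congr fun m => ?_
          rw [← lintegral_const_mul' _ _ (ENNReal.rpow_ne_top_of_nonneg (by linarith) hD)]
          refine lintegral_congr fun z => ?_
          ring
  have hp : D ^ (1 - r) ≠ 0 := by simp [h0, hD]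
  have ht : D ^ (1 - r) ≠ ∞ := ENNReal.rpow_ne_top_of_nonneg (by linarith) hD
  have e : D = D ^ (1 - r) * D ^ r := by rw [← ENNReal.rpow_add_of_nonneg _ _ (by linarith) hr.le]; simp
  have k2 : D ^ (1 - r) * D ^ r ≤ D ^ (1 - r) * (C * SS V w A N r h j x) := by
    rw [← e]; refine key.trans (le_of_eq (by ring))
  exact (ENNReal.mul_le_mul_iff_right hp ht).1 k2

lemma R2 (hw : Wt n V w b C0) {A : ℝ} {N : ℕ} {C : ℝ≥0∞} (hC : 1 ≤ C) {r : ℝ} (hr : 0 < r) (hr1 : r ≤ 1) {h : ℕ → RV n → ℝ≥0∞}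
    (H : I1 V w (A + b * N) N C h) (Hall : ∀ (A : ℝ) (N : ℕ), ∃ C : ℝ≥0∞, C ≠ ∞ ∧ I1 V w A N C h)
    (I3 : ∃ (Cf : ℝ≥0∞) (N0 : ℕ), Cf ≠ ∞ ∧ ∀ k y, h k y * w 0 y ^ N0 ≤ Cf * T2 (k * N0)) (j : ℕ) (x : RV n) :
    DD w A N h j x ^ r ≤ C * SS V w A N r h j x := by
  by_cases hS : SS V w A N r h j x = ∞
  · rw [hS, ENNReal.mul_top (by positivity)]; exact le_top
  refine R1 hw hr hr1 H ?_
  obtain ⟨Cf, N0, hCf, hg⟩ := I3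
  set N1 := max N N0
  set A1 : ℝ := max (A + b * N) N0
  obtain ⟨C1, hC1, H1⟩ := Hall (A1 + b * N1) N1
  have fin : ∀ j x, DD w A1 N1 h j x ≠ ∞ := by
    intro j x
    have hw0 : w 0 x ^ N0 ≠ 0 := pow_ne_zero _ (hw.pos _ _)
    have hwt : w 0 x ^ N0 ≠ ∞ := ENNReal.pow_ne_top (ne_top_of_le_ne_top ENNReal.one_ne_top (hw.le1 _ _))
    refine ne_top_of_le_ne_top (b := Cf * T2 (j * N0) / w 0 x ^ N0) (ENNReal.div_ne_top (ENNReal.mul_ne_top hCf (T2_ne_top _)) hw0) ?_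
    refine iSup₂_le fun i y => ?_
    rw [ENNReal.le_div_iff_mul_le (Or.inl hw0) (Or.inl hwt)]
    calc XX w A1 N1 h j x i y * w 0 x ^ N0 = T2 (-(i * A1)) * h (j + i) y * (w (j + i) (x - y) ^ N1 * w 0 x ^ N0) := by unfold XX; ring
      _ ≤ T2 (-(i * N0)) * h (j + i) y * (w (j + i) (x - y) ^ N0 * w 0 x ^ N0) := by
          refine mul_le_mul' (mul_le_mul' ?_ le_rfl) (mul_le_mul' ?_ le_rfl)
          · refine T2_mono ?_
            have : (N0 : ℝ) ≤ A1 := le_max_right _ _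
            have : (i:ℝ) * N0 ≤ i * A1 := by gcongr
            linarith
          · exact pow_le_pow_right_of_le_one' (hw.le1 _ _) (le_max_right _ _)
      _ ≤ T2 (-(i * N0)) * h (j + i) y * w 0 y ^ N0 := by
          rw [← mul_pow]; gcongr; exact hw.tri0 _ _ _
      _ ≤ T2 (-(i * N0)) * (Cf * T2 ((j + i : ℕ) * N0)) := by
          rw [mul_assoc]; exact mul_le_mul' le_rfl (hg _ _)
      _ = _ := by
          rw [mul_left_comm, ← T2_add]; congr 2; push_cast; ring
  have hb : DD w A N h j x ^ r ≤ C1 * SS V w A N r h j x := by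
    unfold DD
    rw [rpow_iSup _ hr]
    refine iSup_le fun i => ?_
    rw [rpow_iSup _ hr]
    refine iSup_le fun y => ?_
    have h1 : h (j + i) y ≤ DD w A1 N1 h (j + i) y := by
      refine le_trans (le_of_eq ?_) (XX_le_DD A1 N1 h (j + i) y 0 y)
      simp [XX, hw.one, T2_zero]
    have e0 : XX w A N h j x i y = T2 (-(i * A)) * w (j + i) (x - y) ^ N * h (j + i) y := by unfold XX; ring
    have hP : (T2 (-(i * A)) * w (j + i) (x - y) ^ N) ^ r ≠ ∞ := ENNReal.rpow_ne_top_of_nonneg hr.le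
      (ENNReal.mul_ne_top (T2_ne_top _) (ENNReal.pow_ne_top (ne_top_of_le_ne_top ENNReal.one_ne_top (hw.le1 _ _))))
    have h2 := R1 hw hr hr1 H1 (fin (j + i) y)
    calc XX w A N h j x i y ^ r = (T2 (-(i * A)) * w (j + i) (x - y) ^ N) ^ r * h (j + i) y ^ r := by
          rw [e0, ENNReal.mul_rpow_of_nonneg _ _ hr.le]
      _ ≤ (T2 (-(i * A)) * w (j + i) (x - y) ^ N) ^ r * (C1 * SS V w A1 N1 r h (j + i) y) :=
          mul_le_mul' le_rfl ((ENNReal.rpow_le_rpow h1 hr.le).trans h2)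
      _ = C1 * ∑' m : ℕ, ∫⁻ z, V (j + i + m) * (T2 (-(i * A)) * w (j + i) (x - y) ^ N * XX w A1 N1 h (j + i) y m z) ^ r := by
          unfold SS
          rw [mul_left_comm, ← ENNReal.tsum_mul_left]
          congr 1; refine tsum_congr fun m => ?_
          rw [← lintegral_const_mul' _ _ hP]
          refine lintegral_congr fun z => ?_
          rw [ENNReal.mul_rpow_of_nonneg (T2 (-(i * A)) * w (j + i) (x - y) ^ N) _ hr.le]; ring
      _ ≤ C1 * ∑' m : ℕ, ∫⁻ z, V (j + (i + m)) * XX w A N h j x (i + m) z ^ r := by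
          refine mul_le_mul' le_rfl (ENNReal.tsum_le_tsum fun m => lintegral_mono fun z => ?_)
          rw [← add_assoc]
          exact mul_le_mul' le_rfl (ENNReal.rpow_le_rpow
            (XX_comp hw A A1 N N1 (le_max_left _ _) (le_max_left _ _) h j x i y m z) hr.le)
      _ ≤ _ := mul_le_mul' le_rfl <| tsum_shift (fun m => ∫⁻ z, V (j + m) * XX w A N h j x m z ^ r) i
  intro hh
  rw [hh, ENNReal.top_rpow_of_pos hr, top_le_iff] at hb
  exact ENNReal.mul_ne_top hC1 hS hb
end R


lemma rpow_tsum_le {r : ℝ} (hr : 0 < r) (hr1 : r ≤ 1) (f : ℕ → ℝ≥0∞) : (∑' k, f k) ^ r ≤ ∑' k, f k ^ r := by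
  rw [ENNReal.tsum_eq_iSup_sum, rpow_iSup _ hr]
  refine iSup_le fun s => le_trans ?_ (ENNReal.sum_le_tsum s)
  classical
  induction s using Finset.induction_on with
  | empty => simp [hr]
  | insert a s ha ih =>
    rw [Finset.sum_insert ha, Finset.sum_insert ha]
    exact (ENNReal.rpow_add_le_add_rpow _ _ hr.le hr1).trans (add_le_add le_rfl ih)

lemma schur {Q : ℝ≥0∞} (hQ : 1 ≤ Q) {K : ℕ → ℕ → ℝ≥0∞} {R : ℝ≥0∞} (h1 : ∀ j, ∑' k, K j k ≤ R) (h2 : ∀ k, ∑' j, K j k ≤ R)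
    (H : ℕ → ℝ≥0∞) : ell Q (fun j => ∑' k, K j k * H k) ≤ R * ell Q H := by
  by_cases hq : Q = ∞
  · simp only [ell, hq, if_true]
    refine iSup_le fun j => ?_
    calc _ ≤ ∑' k, K j k * ⨆ k, H k := ENNReal.tsum_le_tsum fun k => mul_le_mul' le_rfl (le_iSup H k)
      _ = (∑' k, K j k) * ⨆ k, H k := ENNReal.tsum_mul_right
      _ ≤ _ := mul_le_mul' (h1 j) le_rfl
  have hs : 1 ≤ Q.toReal := by rw [← ENNReal.toReal_one]; exact ENNReal.toReal_mono hq hQ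
  set s := Q.toReal with hsd
  have hs0 : 0 < s := by linarith
  have key : ∀ j, (∑' k, K j k * H k) ^ s ≤ R ^ (s - 1) * ∑' k, K j k * H k ^ s := by
    intro j
    rcases hs.eq_or_lt with h | h
    · rw [← h]; simp
    · have hc : (s / (s - 1)).HolderConjugate s := (Real.HolderConjugate.conjExponent h).symm
      have := ENNReal.lintegral_mul_le_Lp_mul_Lq Measure.count hc (f := fun k => K j k ^ ((s - 1) / s)) (g := fun k => K j k ^ (1/s) * H k)
        (measurable_from_top.aemeasurable) (measurable_from_top.aemeasurable)
      simp only [lintegral_count, Pi.mul_apply] at this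
      have e1 : ∀ k, K j k ^ ((s - 1) / s) * (K j k ^ (1/s) * H k) = K j k * H k := fun k => by
        rw [← mul_assoc, ← ENNReal.rpow_add_of_nonneg _ _ (div_nonneg (by linarith) hs0.le) (by positivity)]
        rw [show (s - 1) / s + 1 / s = 1 by field_simp; ring, ENNReal.rpow_one]
      have e2 : ∀ k, (K j k ^ ((s - 1) / s)) ^ (s / (s - 1)) = K j k := fun k => by
        have : s - 1 ≠ 0 := by linarith
        rw [← ENNReal.rpow_mul, show (s - 1) / s * (s / (s - 1)) = 1 by field_simp, ENNReal.rpow_one]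
      have e3 : ∀ k, (K j k ^ (1 / s) * H k) ^ s = K j k * H k ^ s := fun k => by
        rw [ENNReal.mul_rpow_of_nonneg _ _ hs0.le, ← ENNReal.rpow_mul, one_div_mul_cancel hs0.ne', ENNReal.rpow_one]
      simp_rw [e1, e2, e3] at this
      refine (ENNReal.rpow_le_rpow this hs0.le).trans ?_
      rw [ENNReal.mul_rpow_of_nonneg _ _ hs0.le, ← ENNReal.rpow_mul, ← ENNReal.rpow_mul, one_div_mul_cancel hs0.ne', ENNReal.rpow_one]
      refine mul_le_mul' ?_ le_rfl
      have : s - 1 ≠ 0 := by linarith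
      rw [show 1 / (s / (s - 1)) * s = s - 1 by field_simp]
      exact ENNReal.rpow_le_rpow (h1 j) (by linarith)
  simp only [ell, hq, if_false, ← hsd]
  calc _ ≤ (∑' j, R ^ (s - 1) * ∑' k, K j k * H k ^ s) ^ (1 / s) :=
        ENNReal.rpow_le_rpow (ENNReal.tsum_le_tsum key) (by positivity)
    _ ≤ (R ^ (s - 1) * (R * ∑' k, H k ^ s)) ^ (1 / s) := by
        refine ENNReal.rpow_le_rpow ?_ (by positivity)
        rw [ENNReal.tsum_mul_left, ENNReal.tsum_comm]
        refine mul_le_mul' le_rfl ?_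
        rw [← ENNReal.tsum_mul_left]
        refine ENNReal.tsum_le_tsum fun k => ?_
        rw [ENNReal.tsum_mul_right]
        exact mul_le_mul' (h2 k) le_rfl
    _ = _ := by
        have : R ^ (s - 1) * R = R ^ s := by
          nth_rewrite 2 [← ENNReal.rpow_one R]
          rw [← ENNReal.rpow_add_of_nonneg _ _ (by linarith) (by norm_num)]; simp
        rw [← mul_assoc, this, ENNReal.mul_rpow_of_nonneg _ _ (by positivity), ← ENNReal.rpow_mul, mul_one_div_cancel hs0.ne', ENNReal.rpow_one]

def KK (δ : ℝ) (j k : ℕ) : ℝ≥0∞ := T2 (-(|(j:ℝ) - k| * δ))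

lemma KK_sum {δ : ℝ} (hδ : 0 < δ) : ∃ R : ℝ≥0∞, R ≠ ∞ ∧ (∀ j, ∑' k, KK δ j k ≤ R) ∧ ∀ k, ∑' j, KK δ j k ≤ R := by
  have sym : ∀ j k, KK δ j k = KK δ k j := fun j k => by unfold KK; rw [abs_sub_comm]
  have h1 : ∀ j, ∑' k, KK δ j k ≤ ∑' z : ℤ, T2 (-(|(z:ℝ)| * δ)) := fun j => by
    refine le_trans (le_of_eq ?_) (ENNReal.tsum_comp_le_tsum_of_injective (f := fun k : ℕ => (j:ℤ) - k)
      (fun a b h => by simpa using h) _)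
    refine tsum_congr fun k => ?_
    simp [KK]
  refine ⟨_, ?_, h1, fun k => by simp_rw [sym _ k]; exact h1 k⟩
  rw [tsum_of_nat_of_neg_add_one ENNReal.summable ENNReal.summable]
  refine ENNReal.add_ne_top.2 ⟨?_, ?_⟩
  · simpa using T2_geom hδ
  · refine ne_top_of_le_ne_top (T2_geom hδ) (ENNReal.tsum_le_tsum fun i => T2_mono ?_)
    push_cast
    rw [abs_neg, abs_of_nonneg (by positivity)]
    nlinarith

def cc (μ A : ℝ) (j k : ℕ) : ℝ≥0∞ := if k ≤ j then T2 (-(((j:ℝ) - k) * μ)) else T2 (-(((k:ℝ) - j) * A))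

theorem combine (n : ℕ) {V : ℕ → ℝ≥0∞} {w : ℕ → RV n → ℝ≥0∞} {b : ℝ} {C0 : ℝ≥0∞} (hw : Wt n V w b C0)
    {σ : ℕ → Fin n → ℝ} (hσ : ∀ k l, 0 < σ k l) (hV : ∀ k z, V k * w k z ^ 2 = ∏ l, kap (σ k l) (z l))
    {p : Fin n → ℝ≥0∞} (hp : ∀ i, 0 < p i ∧ p i ≠ ∞) {q : ℝ≥0∞} (hq : 0 < q) {s μ : ℝ} (hs : s < μ)
    (P : (ℕ → RV n → ℝ≥0∞) → (ℕ → RV n → ℝ≥0∞) → Prop)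
    (hI1 : ∀ (A : ℝ) (N : ℕ), ∃ C : ℝ≥0∞, C ≠ ∞ ∧ ∀ h g, P h g → I1 V w A N C h)
    (hI2 : ∀ (A : ℝ) (N : ℕ), ∃ C : ℝ≥0∞, C ≠ ∞ ∧ ∀ h g, P h g → ∀ j y, g j y ≤
      C * ∑' k, cc μ A j k * ∫⁻ z, V k * (w k (y - z) ^ N * h k z))
    (hI3 : ∀ h g, P h g → ∃ (Cf : ℝ≥0∞) (N0 : ℕ), Cf ≠ ∞ ∧ ∀ k y, h k y * w 0 y ^ N0 ≤ Cf * T2 (k * N0))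
    (hI4 : ∀ h g, P h g → ∀ k, Measurable (h k)) :
    ∃ C : ℝ≥0∞, C ≠ ∞ ∧ ∀ h g, P h g →
      seqNorm n p q (fun j x => T2 (j * s) * g j x) ≤ C * seqNorm n p q (fun j x => T2 (j * s) * h j x) := by
  obtain ⟨r0, hr0, hFS⟩ := FS n hp hq
  obtain ⟨m, hm0, hm1, hm2⟩ : ∃ m : ℕ, 0 < m ∧ 1 / (m:ℝ) ≤ r0 ∧ 1 ≤ (m:ℝ≥0∞) * q := by
    obtain ⟨m1, h1⟩ := exists_nat_ge (1 / r0)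
    obtain ⟨m2, h2⟩ : ∃ m2 : ℕ, 1 / q ≤ m2 := ENNReal.exists_nat_gt (by simp [hq.ne']) |>.imp fun _ h => h.le
    refine ⟨max (max m1 m2) 1, by positivity, ?_, ?_⟩
    · rw [div_le_comm₀ (by positivity) hr0]
      exact h1.trans (by exact_mod_cast (le_max_left _ _).trans (le_max_left _ _))
    · have : 1 / q ≤ ((max (max m1 m2) 1 : ℕ) : ℝ≥0∞) := h2.trans (by exact_mod_cast (le_max_right _ _).trans (le_max_left _ _))
      rcases eq_or_ne q ∞ with rfl | hqt
      · rw [ENNReal.mul_top (by simp)]; simp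
      · rwa [ENNReal.div_le_iff hq.ne' hqt] at this
  have hm0' : (0:ℝ) < m := by exact_mod_cast hm0
  set r : ℝ := 1 / m with hr
  have hr0 : 0 < r := by positivity
  have hr1 : r ≤ 1 := by rw [hr, div_le_one hm0']; exact_mod_cast hm0
  have h1r : 1 / r = m := by rw [hr]; simp
  obtain ⟨CF, hCF, hFS⟩ := hFS r hr0 hm1
  set A : ℝ := 1 + |s| with hA
  set N := 2 * m with hN
  obtain ⟨C1, hC1, h1⟩ := hI1 (A + b * N) N
  obtain ⟨C2, hC2, h2⟩ := hI2 A (N + 2)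
  set δ := r * min (μ - s) 1 with hδ
  have hδ0 : 0 < δ := mul_pos hr0 (lt_min (by linarith) one_pos)
  obtain ⟨R, hR, hR1, hR2⟩ := KK_sum hδ0
  set C3 := (C2 * C0) ^ r * max C1 1 with hC3
  have hC3t : C3 ≠ ∞ := ENNReal.mul_ne_top (ENNReal.rpow_ne_top_of_nonneg hr0.le (ENNReal.mul_ne_top hC2 hw.hC0)) (by simp [hC1])
  have hCt : (C3 * (R * R)) ^ (1/r) ≠ ∞ := ENNReal.rpow_ne_top_of_nonneg (by positivity) (ENNReal.mul_ne_top hC3t (ENNReal.mul_ne_top hR hR))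
  refine ⟨(C3 * (R * R)) ^ (1/r) * CF, ENNReal.mul_ne_top hCt hCF, fun h g hP => ?_⟩
  have hD : ∀ j x, DD w A N h j x ^ r ≤ max C1 1 * SS V w A N r h j x := fun j x =>
    R2 hw (le_max_right _ _) hr0 hr1 (fun j y => ((h1 h g hP) j y).trans (mul_le_mul' (le_max_left _ _) le_rfl))
      (fun A N => (hI1 A N).imp fun C hC => ⟨hC.1, hC.2 h g hP⟩) (hI3 h g hP) j x
  have hg : ∀ j x, g j x ^ r ≤ C3 * ∑' k, cc μ A j k ^ r * SS V w A N r h k x := by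
    intro j x
    have e1 : g j x ≤ C2 * C0 * ∑' k, cc μ A j k * DD w A N h k x := by
      refine (h2 h g hP j x).trans ?_
      rw [mul_assoc, ← ENNReal.tsum_mul_left (a := C0)]
      refine mul_le_mul' le_rfl (ENNReal.tsum_le_tsum fun k => ?_)
      rw [mul_left_comm C0]
      refine mul_le_mul' le_rfl ?_
      calc _ ≤ ∫⁻ z, V k * w k (x - z) ^ 2 * DD w A N h k x := by
            refine lintegral_mono fun z => ?_
            have := XX_le_DD (w := w) A N h k x 0 z
            simp only [XX, Nat.cast_zero, zero_mul, neg_zero, T2_zero, one_mul, add_zero] at this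
            rw [pow_add, mul_comm (w k (x - z) ^ N), mul_assoc, ← mul_assoc]
            exact mul_le_mul' le_rfl this
        _ = (∫⁻ z, V k * w k (x - z) ^ 2) * DD w A N h k x := by
            refine lintegral_mul_const _ (Measurable.const_mul (Measurable.pow_const ?_ _) _)
            have h3 := (hw.meas k).comp (measurable_const.sub measurable_id : Measurable fun z : RV n => x - z)
            exact h3
        _ ≤ _ := mul_le_mul' (hw.int k x) le_rfl
    calc _ ≤ (C2 * C0 * ∑' k, cc μ A j k * DD w A N h k x) ^ r := ENNReal.rpow_le_rpow e1 hr0.le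
      _ ≤ (C2 * C0) ^ r * ∑' k, (cc μ A j k * DD w A N h k x) ^ r := by
          rw [ENNReal.mul_rpow_of_nonneg _ _ hr0.le]; exact mul_le_mul' le_rfl (rpow_tsum_le hr0 hr1 _)
      _ ≤ (C2 * C0) ^ r * ∑' k, max C1 1 * (cc μ A j k ^ r * SS V w A N r h k x) := by
          refine mul_le_mul' le_rfl (ENNReal.tsum_le_tsum fun k => ?_)
          rw [ENNReal.mul_rpow_of_nonneg _ _ hr0.le, mul_left_comm]
          exact mul_le_mul' le_rfl (hD k x)
      _ = _ := by rw [ENNReal.tsum_mul_left, ← mul_assoc]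
  set u : ℕ → RV n → ℝ≥0∞ := fun k x => T2 (k * s) * h k x with hu
  set H : ℕ → RV n → ℝ≥0∞ := fun k x => WB n (σ k) (fun z => u k z ^ r) x with hH
  have hXX : ∀ k i x, T2 ((k + i : ℕ) * s) ^ r * ∫⁻ z, V (k + i) * XX w A N h k x i z ^ r = T2 (-(i * A)) ^ r * H (k + i) x := by
    intro k i x
    rw [hH, ← lintegral_const_mul' _ _ (ENNReal.rpow_ne_top_of_nonneg hr0.le (T2_ne_top _))]
    simp only [WB]
    rw [← lintegral_const_mul' _ _ (ENNReal.rpow_ne_top_of_nonneg hr0.le (T2_ne_top _))]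
    refine lintegral_congr fun z => ?_
    have e1 : ∏ l, kap (σ (k + i) l) (x l - z l) = V (k + i) * w (k + i) (x - z) ^ 2 := (hV (k + i) (x - z)).symm
    have e2 : (w (k + i) (x - z) ^ N) ^ r = w (k + i) (x - z) ^ 2 := by
      rw [← ENNReal.rpow_natCast, ← ENNReal.rpow_mul, hN, hr, ← ENNReal.rpow_natCast]
      congr 1; push_cast; field_simp
    rw [e1]; unfold XX
    rw [hu, ENNReal.mul_rpow_of_nonneg _ _ hr0.le, ENNReal.mul_rpow_of_nonneg _ _ hr0.le, e2, ENNReal.mul_rpow_of_nonneg _ _ hr0.le]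
    ring
  have hSS : ∀ (k : ℕ) (x : RV n), T2 (k * s) ^ r * SS V w A N r h k x ≤ ∑' l, KK δ k l * H l x := by
    intro k x
    unfold SS
    rw [← ENNReal.tsum_mul_left]
    refine le_trans ?_ (tsum_shift _ k)
    refine ENNReal.tsum_le_tsum fun i => ?_
    have e1 : T2 (k * s) ^ r = T2 (-(i * s * r)) * T2 ((k + i : ℕ) * s) ^ r := by
      rw [T2_rpow, T2_rpow, ← T2_add]; congr 1; push_cast; ring
    rw [e1, mul_assoc, hXX, ← mul_assoc]
    refine mul_le_mul' ?_ le_rfl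
    rw [T2_rpow, ← T2_add]
    unfold KK
    refine T2_mono ?_
    have e3 : |(k:ℝ) - (k + i : ℕ)| = i := by push_cast; rw [sub_add_cancel_left, abs_neg, abs_of_nonneg (by positivity)]
    rw [e3]
    have e4 : δ ≤ r * (s + A) := by
      rw [hδ]; refine mul_le_mul_of_nonneg_left ?_ hr0.le
      refine (min_le_right _ _).trans ?_
      have := neg_abs_le s; linarith
    nlinarith [(Nat.cast_nonneg i : (0:ℝ) ≤ i)]
  have hcc : ∀ j k : ℕ, T2 (j * s) ^ r * cc μ A j k ^ r ≤ KK δ j k * T2 (k * s) ^ r := by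
    intro j k
    unfold cc KK
    simp only [T2_rpow]
    split_ifs with hjk
    · have : (k:ℝ) ≤ j := by exact_mod_cast hjk
      rw [T2_rpow, ← T2_add, ← T2_add, abs_of_nonneg (by linarith)]
      refine T2_mono ?_
      have e4 : δ ≤ r * (μ - s) := by
        rw [hδ]; exact mul_le_mul_of_nonneg_left (min_le_left _ _) hr0.le
      nlinarith
    · have : (j:ℝ) ≤ k := by exact_mod_cast (not_le.1 hjk).le
      rw [T2_rpow, ← T2_add, ← T2_add, abs_sub_comm, abs_of_nonneg (by linarith)]
      refine T2_mono ?_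
      have e4 : δ ≤ r * (s + A) := by
        rw [hδ]; refine mul_le_mul_of_nonneg_left ?_ hr0.le
        refine (min_le_right _ _).trans ?_
        have := neg_abs_le s; linarith
      nlinarith
  have hpt : ∀ (j : ℕ) (x : RV n), (T2 (j * s) * g j x) ^ r ≤ C3 * ∑' k, KK δ j k * ∑' l, KK δ k l * H l x := by
    intro j x
    rw [ENNReal.mul_rpow_of_nonneg _ _ hr0.le]
    refine (mul_le_mul' le_rfl (hg j x)).trans ?_
    rw [mul_left_comm, ← ENNReal.tsum_mul_left]
    refine mul_le_mul' le_rfl (ENNReal.tsum_le_tsum fun k => ?_)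
    rw [← mul_assoc]
    refine (mul_le_mul' (hcc j k) le_rfl).trans ?_
    rw [mul_assoc]
    exact mul_le_mul' le_rfl (hSS k x)
  have hQ : ENNReal.ofReal r * ((m:ℝ≥0∞) * q) = q := by
    rw [← mul_assoc, hr, ENNReal.ofReal_div_of_pos hm0']
    simp only [ENNReal.ofReal_one, ENNReal.ofReal_natCast]
    rw [ENNReal.div_mul_cancel (by simp [hm0.ne']) (by simp), one_mul]
  have hfin : ∀ x, ell q (fun j : ℕ => T2 (j * s) * g j x) ≤ (C3 * (R * R)) ^ (1/r) * ell q (fun k => H k x ^ (1/r)) := by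
    intro x
    have e1 := ell_pow (q := (m:ℝ≥0∞) * q) hr0 (fun j : ℕ => T2 (j * s) * g j x)
    have e2 := ell_pow (q := (m:ℝ≥0∞) * q) hr0 (fun k => H k x ^ (1/r))
    rw [hQ] at e1 e2
    rw [← e1, ← e2, ← ENNReal.mul_rpow_of_nonneg _ _ (by positivity)]
    refine ENNReal.rpow_le_rpow ?_ (by positivity)
    have e3 : (fun k => (H k x ^ (1/r)) ^ r) = fun k => H k x := by
      funext k; rw [← ENNReal.rpow_mul, one_div_mul_cancel hr0.ne', ENNReal.rpow_one]
    rw [e3]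
    refine (ell_mono fun j => hpt j x).trans ?_
    rw [ell_smul (by exact lt_of_lt_of_le one_pos hm2), mul_assoc C3, mul_assoc R]
    refine mul_le_mul' le_rfl ((schur hm2 hR1 hR2 _).trans (mul_le_mul' le_rfl (schur hm2 hR1 hR2 _)))
  refine (seqNorm_dom n hp hCt hfin).trans ?_
  rw [mul_assoc _ CF]
  exact mul_le_mul' le_rfl (hFS σ hσ u fun k => (hI4 h g hP k).const_mul _)


lemma kap_int {σ : ℝ} (hσ : 0 < σ) (t : ℝ) : ∫⁻ s, kap σ (t - s) ≤ 16 := by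
  refine (lintegral_mono fun s => kap_le hσ t s).trans ?_
  have hms : ∀ m : ℕ, MeasurableSet {s : ℝ | |t - s| ≤ 2 ^ m / σ} := fun m =>
    measurableSet_le (by fun_prop) (by fun_prop)
  rw [lintegral_tsum fun m => (measurable_const.indicator (hms m)).aemeasurable]
  have e : ∀ m : ℕ, ∫⁻ s, Set.indicator {s : ℝ | |t - s| ≤ 2 ^ m / σ} (fun _ => ENNReal.ofReal (σ * (4 * (1/4) ^ m))) s
      = 8 * (1/2 : ℝ≥0∞) ^ m := by
    intro m
    rw [lintegral_indicator_const (hms m)]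
    have : {s : ℝ | |t - s| ≤ 2 ^ m / σ} = Metric.closedBall t (2 ^ m / σ) := by
      ext s; simp [Real.dist_eq, abs_sub_comm]
    rw [this, Real.volume_closedBall, ← ENNReal.ofReal_mul (by positivity)]
    rw [show σ * (4 * (1/4 : ℝ) ^ m) * (2 * (2 ^ m / σ)) = 8 * (1/2) ^ m by
      field_simp
      rw [show (1/2:ℝ) = (1/4) * 2 by norm_num, mul_pow]; ring]
    rw [ENNReal.ofReal_mul (by norm_num), ENNReal.ofReal_pow (by norm_num), ENNReal.ofReal_div_of_pos (by norm_num)]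
    simp
  simp_rw [e]
  rw [ENNReal.tsum_mul_left, ENNReal.tsum_geometric]
  simp
  norm_num

lemma kapN_int (n : ℕ) (σ : Fin n → ℝ) (hσ : ∀ l, 0 < σ l) (x : RV n) : ∫⁻ z : RV n, ∏ l, kap (σ l) (x l - z l) ≤ 16 ^ n := by
  have h1 : ∀ m x, Tm n σ (fun _ => 1) m x ≤ 16 ^ m := by
    intro m
    induction m with
    | zero => intro x; simp [Tm]
    | succ m ih =>
      intro x
      unfold Tm; split_ifs with h
      · unfold Tl
        calc _ ≤ ∫⁻ s, kap (σ ⟨m, h⟩) (x ⟨m, h⟩ - s) * 16 ^ m := lintegral_mono fun s => mul_le_mul' le_rfl (ih _)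
          _ = (∫⁻ s, kap (σ ⟨m, h⟩) (x ⟨m, h⟩ - s)) * 16 ^ m := lintegral_mul_const' _ _ (by simp)
          _ ≤ 16 * 16 ^ m := mul_le_mul' (kap_int (hσ _) _) le_rfl
          _ = _ := by ring
      · exact (ih x).trans (pow_le_pow_right₀ (by norm_num) (by omega))
  have h2 := WB_eq n σ (v := fun _ => 1) measurable_const x
  unfold WB at h2
  simp only [mul_one] at h2
  rw [h2]; exact h1 n x

/-- dilation exponents -/
def sg (n : ℕ) (a : Fin n → ℝ) (k : ℕ) (l : Fin n) : ℝ := (2:ℝ) ^ ((k:ℝ) * a l)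
lemma sg_pos (n : ℕ) (a : Fin n → ℝ) (k : ℕ) (l : Fin n) : 0 < sg n a k l := by unfold sg; positivity
lemma sg_one (n : ℕ) {a : Fin n → ℝ} (ha : ∀ i, 1 ≤ a i) (k : ℕ) (l : Fin n) : 1 ≤ sg n a k l :=
  Real.one_le_rpow (by norm_num) (mul_nonneg (by positivity) (by linarith [ha l]))
lemma sg_add (n : ℕ) (a : Fin n → ℝ) (k i : ℕ) (l : Fin n) : sg n a (k + i) l = sg n a k l * sg n a i l := by
  unfold sg; rw [← Real.rpow_add (by norm_num)]; congr 1; push_cast; ring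
lemma sg_zero (n : ℕ) (a : Fin n → ℝ) (l : Fin n) : sg n a 0 l = 1 := by simp [sg]
lemma sg_prod (n : ℕ) (a : Fin n → ℝ) (k : ℕ) : ∏ l, sg n a k l = (2:ℝ) ^ ((k:ℝ) * ∑ i, a i) := by
  unfold sg; rw [Finset.mul_sum, Real.rpow_sum_of_pos (by norm_num)]

/-- product weight -/
def WW (n : ℕ) (σ : Fin n → ℝ) (z : RV n) : ℝ := ∏ l, (1 + σ l * |z l|)
lemma WW_one (n : ℕ) {σ : Fin n → ℝ} (hσ : ∀ l, 0 < σ l) (z : RV n) : 1 ≤ WW n σ z :=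
  by
  have : ∏ l : Fin n, (1:ℝ) ≤ WW n σ z :=
    Finset.prod_le_prod (fun _ _ => zero_le_one) (fun l _ => by nlinarith [hσ l, abs_nonneg (z l), mul_nonneg (hσ l).le (abs_nonneg (z l))])
  simpa using this
lemma WW_pos (n : ℕ) {σ : Fin n → ℝ} (hσ : ∀ l, 0 < σ l) (z : RV n) : 0 < WW n σ z := lt_of_lt_of_le one_pos (WW_one n hσ z)
lemma WW_cont (n : ℕ) (σ : Fin n → ℝ) : Continuous (WW n σ) := by unfold WW; fun_prop
lemma WW_tri (n : ℕ) {σ τ : Fin n → ℝ} (hσ : ∀ l, 0 < σ l) (hτ : ∀ l, 1 ≤ τ l) (x y : RV n) :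
    WW n (fun l => σ l * τ l) (x + y) ≤ (∏ l, τ l) * (WW n σ x * WW n (fun l => σ l * τ l) y) := by
  unfold WW
  rw [← Finset.prod_mul_distrib, ← Finset.prod_mul_distrib]
  refine Finset.prod_le_prod (fun l _ => ?_) fun l _ => ?_
  · have := mul_nonneg (mul_nonneg (hσ l).le (zero_le_one.trans (hτ l))) (abs_nonneg ((x + y) l)); linarith
  · have h1 := abs_add_le (x l) (y l)
    have h2 : 0 ≤ σ l * τ l := mul_nonneg (hσ l).le (zero_le_one.trans (hτ l))
    have h3 := mul_le_mul_of_nonneg_left h1 h2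
    have h4 := mul_nonneg h2 (abs_nonneg (x l))
    have h5 := mul_nonneg h2 (abs_nonneg (y l))
    have h6 := mul_nonneg h4 h5
    have h7 := hτ l
    simp only [Pi.add_apply]
    nlinarith

def ww (n : ℕ) (a : Fin n → ℝ) (k : ℕ) (z : RV n) : ℝ≥0∞ := ENNReal.ofReal (WW n (sg n a k) z)⁻¹
def VV (n : ℕ) (a : Fin n → ℝ) (k : ℕ) : ℝ≥0∞ := T2 (k * ∑ i, a i)

lemma VV_ww (n : ℕ) (a : Fin n → ℝ) (k : ℕ) (z : RV n) : VV n a k * ww n a k z ^ 2 = ∏ l, kap (sg n a k l) (z l) := by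
  unfold VV ww kap WW
  rw [← T2_ofReal, ← sg_prod, ← ENNReal.ofReal_pow, ← ENNReal.ofReal_mul, ← ENNReal.ofReal_prod_of_nonneg]
  · congr 1
    rw [← Finset.prod_inv_distrib, ← Finset.prod_pow, ← Finset.prod_mul_distrib]
    refine Finset.prod_congr rfl fun l _ => ?_
    rw [inv_pow]; rfl
  · intro l _; have := sg_pos n a k l; positivity
  · exact Finset.prod_nonneg fun l _ => (sg_pos n a k l).le
  · exact inv_nonneg.2 (WW_pos n (sg_pos n a k) z).le

lemma wtC (n : ℕ) {a : Fin n → ℝ} (ha : ∀ i, 1 ≤ a i) : Wt n (VV n a) (ww n a) (∑ i, a i) (16 ^ n) where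
  one k := by simp [ww, WW]
  le1 k z := by
    unfold ww; rw [← ENNReal.ofReal_one]; exact ENNReal.ofReal_le_ofReal (inv_le_one_of_one_le₀ (WW_one n (sg_pos n a k) z))
  pos k z := by
    unfold ww; rw [ne_eq, ENNReal.ofReal_eq_zero, not_le]; exact inv_pos.2 (WW_pos n (sg_pos n a k) z)
  meas k := by
    unfold ww; exact ENNReal.measurable_ofReal.comp (WW_cont n _).measurable.inv
  Vt k := T2_ne_top _
  tri k i x y z := by
    unfold ww
    rw [← T2_ofReal, ← sg_prod, ← ENNReal.ofReal_mul (inv_nonneg.2 (WW_pos n (sg_pos n a k) _).le), ← ENNReal.ofReal_mul (Finset.prod_nonneg fun l _ => (sg_pos n a i l).le)]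
    refine ENNReal.ofReal_le_ofReal ?_
    have h1 := WW_tri n (sg_pos n a k) (sg_one n ha i) (x - y) (y - z)
    rw [sub_add_sub_cancel] at h1
    have e : (fun l => sg n a k l * sg n a i l) = sg n a (k + i) := by funext l; rw [sg_add]
    rw [e] at h1
    have p1 := WW_pos n (sg_pos n a k) (x - y)
    have p2 := WW_pos n (sg_pos n a (k + i)) (y - z)
    have p3 := WW_pos n (sg_pos n a (k + i)) (x - z)
    rw [← mul_inv, ← div_eq_mul_inv, inv_eq_one_div, div_le_div_iff₀ (mul_pos p1 p2) p3]
    linarith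
  tri0 k x y := by
    unfold ww
    rw [← ENNReal.ofReal_mul (inv_nonneg.2 (WW_pos n (sg_pos n a k) _).le)]
    refine ENNReal.ofReal_le_ofReal ?_
    have p1 := WW_pos n (sg_pos n a k) (x - y)
    have p2 := WW_pos n (sg_pos n a 0) x
    have p3 := WW_pos n (sg_pos n a 0) y
    rw [← mul_inv]
    refine inv_anti₀ p3 ?_
    have h1 := WW_tri n (sg_pos n a 0) (τ := fun _ => 1) (fun _ => le_rfl) (y - x) x
    simp only [mul_one, Finset.prod_const_one, one_mul, sub_add_cancel] at h1
    refine h1.trans (mul_le_mul_of_nonneg_right ?_ p2.le)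
    unfold WW
    refine Finset.prod_le_prod (fun l _ => ?_) fun l _ => ?_
    · have := mul_nonneg (sg_pos n a 0 l).le (abs_nonneg ((y - x) l)); linarith
    · rw [sg_zero, Pi.sub_apply, Pi.sub_apply, abs_sub_comm]
      have := sg_one n ha k l
      nlinarith [abs_nonneg (x l - y l)]
  hb := Finset.sum_nonneg fun i _ => by linarith [ha i]
  hC0 := by simp
  int k x := by
    have := kapN_int n (sg n a k) (sg_pos n a k) x
    refine le_trans (le_of_eq (lintegral_congr fun z => ?_)) this
    rw [VV_ww]; rfl


abbrev Sc (n : ℕ) := SchwartzMap (RV n) ℂ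
abbrev En (n : ℕ) := EuclideanSpace ℝ (Fin n)
abbrev eqv (n : ℕ) : En n ≃L[ℝ] RV n := EuclideanSpace.equiv (Fin n) ℝ
def toE (n : ℕ) : Sc n →L[ℂ] SchwartzMap (En n) ℂ := SchwartzMap.compCLMOfContinuousLinearEquiv ℂ (eqv n)
def ofE (n : ℕ) : SchwartzMap (En n) ℂ →L[ℂ] Sc n := SchwartzMap.compCLMOfContinuousLinearEquiv ℂ (eqv n).symm
lemma toE_apply (n : ℕ) (g : Sc n) (x : En n) : toE n g x = g (x.ofLp) := rfl
lemma ofE_apply (n : ℕ) (g : SchwartzMap (En n) ℂ) (x : RV n) : ofE n g x = g (WithLp.toLp 2 x) := rfl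
lemma ofE_toE (n : ℕ) (g : Sc n) : ofE n (toE n g) = g := by ext x; rfl
lemma toE_ofE (n : ℕ) (g : SchwartzMap (En n) ℂ) : toE n (ofE n g) = g := by ext x; rfl

lemma int_toLp (n : ℕ) (F : En n → ℂ) : ∫ x : RV n, F (WithLp.toLp 2 x) = ∫ x, F x :=
  (PiLp.volume_preserving_toLp (Fin n)).integral_comp (MeasurableEquiv.toLp 2 (RV n)).measurableEmbedding F

open scoped FourierTransform in
lemma FT_eq (n : ℕ) (g : Sc n) (ξ : RV n) :
    FT n g ξ = (FourierTransform.fourier (toE n g) : SchwartzMap (En n) ℂ) (WithLp.toLp 2 ((2 * Real.pi)⁻¹ • ξ)) := by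
  rw [SchwartzMap.fourier_coe, Real.fourier_eq', ← int_toLp]
  unfold FT
  refine integral_congr_ae (Filter.Eventually.of_forall fun x => ?_)
  simp only [smul_eq_mul, toE_apply]
  congr 2
  rw [PiLp.inner_apply]
  simp only [RCLike.inner_apply, conj_trivial, Pi.smul_apply, smul_eq_mul]
  have : ∑ i, (2 * Real.pi)⁻¹ * ξ i * x i = (2 * Real.pi)⁻¹ * ∑ i, x i * ξ i := by
    rw [Finset.mul_sum]; exact Finset.sum_congr rfl fun i _ => by ring
  rw [this]
  have hpi : (Real.pi : ℂ) ≠ 0 := by exact_mod_cast Real.pi_ne_zero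
  push_cast
  field_simp

lemma FT_inj (n : ℕ) {g h : Sc n} (H : ∀ ξ, FT n g ξ = FT n h ξ) : g = h := by
  have h1 : (FourierTransform.fourier (toE n g) : SchwartzMap (En n) ℂ) = FourierTransform.fourier (toE n h) := by
    ext x
    have := H ((2 * Real.pi) • x.ofLp)
    rw [FT_eq, FT_eq, smul_smul, inv_mul_cancel₀ (by positivity), one_smul] at this
    exact this
  have h2 := congrArg (FourierTransformInv.fourierInv : SchwartzMap (En n) ℂ → SchwartzMap (En n) ℂ) h1
  simp only [FourierTransform.fourierInv_fourier_eq] at h2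
  rw [← ofE_toE n g, h2, ofE_toE]

lemma FT_surj (n : ℕ) (G : Sc n) : ∃ g : Sc n, ∀ ξ, FT n g ξ = G ξ := by
  let u : RV n ≃L[ℝ] RV n := ContinuousLinearEquiv.smulLeft (Units.mk0 (2 * Real.pi) (by positivity))
  let G1 : Sc n := SchwartzMap.compCLMOfContinuousLinearEquiv ℂ u G
  refine ⟨ofE n (FourierTransformInv.fourierInv (toE n G1)), fun ξ => ?_⟩
  rw [FT_eq, toE_ofE, FourierTransform.fourier_fourierInv_eq, toE_apply]
  show G (u _) = _
  congr 1
  show (2 * Real.pi) • ((2 * Real.pi)⁻¹ • ξ) = ξ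
  rw [smul_smul, mul_inv_cancel₀ (by positivity), one_smul]

def cvl (n : ℕ) (g h : Sc n) : Sc n := ofE n (SchwartzMap.convolution (ContinuousLinearMap.mul ℂ ℂ) (toE n g) (toE n h))

lemma cvl_apply (n : ℕ) (g h : Sc n) (x : RV n) : cvl n g h x = ∫ y, g y * h (x - y) := by
  unfold cvl
  rw [ofE_apply, SchwartzMap.convolution_apply, convolution_def, ← int_toLp]
  rfl

lemma FT_cvl (n : ℕ) (g h : Sc n) (ξ : RV n) : FT n (cvl n g h) ξ = FT n g ξ * FT n h ξ := by
  rw [FT_eq, FT_eq, FT_eq]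
  unfold cvl
  rw [toE_ofE, SchwartzMap.fourier_convolution, SchwartzMap.pairing_apply_apply]
  rfl

lemma convE_deriv (n : ℕ) (g h : SchwartzMap (En n) ℂ) (m : En n) :
    LineDeriv.lineDerivOp m (SchwartzMap.convolution (ContinuousLinearMap.mul ℂ ℂ) g h) =
    SchwartzMap.convolution (ContinuousLinearMap.mul ℂ ℂ) g (LineDeriv.lineDerivOp m h) := by
  have h1 : (FourierTransform.fourier (LineDeriv.lineDerivOp m (SchwartzMap.convolution (ContinuousLinearMap.mul ℂ ℂ) g h)) : SchwartzMap (En n) ℂ)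
     = FourierTransform.fourier (SchwartzMap.convolution (ContinuousLinearMap.mul ℂ ℂ) g (LineDeriv.lineDerivOp m h)) := by
    have ht : (fun x : En n => inner ℝ x m).HasTemperateGrowth := ((innerSL ℝ).flip m).hasTemperateGrowth
    rw [SchwartzMap.fourier_lineDerivOp_eq, SchwartzMap.fourier_convolution, SchwartzMap.fourier_convolution, SchwartzMap.fourier_lineDerivOp_eq]
    ext x
    simp only [SchwartzMap.smul_apply, SchwartzMap.smulLeftCLM_apply_apply ht, SchwartzMap.pairing_apply_apply, ContinuousLinearMap.mul_apply', smul_eq_mul, Complex.real_smul]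
    ring
  have h2 := congrArg (FourierTransformInv.fourierInv : SchwartzMap (En n) ℂ → SchwartzMap (En n) ℂ) h1
  simpa only [FourierTransform.fourierInv_fourier_eq] using h2

lemma cvl_deriv (n : ℕ) (g h : Sc n) (m : RV n) : LineDeriv.lineDerivOp m (cvl n g h) = cvl n g (LineDeriv.lineDerivOp m h) := by
  unfold cvl
  have e1 : toE n (LineDeriv.lineDerivOp m h) = LineDeriv.lineDerivOp ((eqv n).symm m) (toE n h) := by
    unfold toE
    rw [SchwartzMap.lineDerivOp_compCLMOfContinuousLinearEquiv]; rfl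
  rw [e1, ← convE_deriv]
  unfold ofE
  rw [SchwartzMap.lineDerivOp_compCLMOfContinuousLinearEquiv]

lemma cvl_iter (n : ℕ) (g h : Sc n) : ∀ (k : ℕ) (m : Fin k → RV n) (x : RV n),
    iteratedFDeriv ℝ k (cvl n g h) x m = ∫ y, g y * iteratedFDeriv ℝ k h (x - y) m := by
  have : ∀ (k : ℕ) (m : Fin k → RV n), LineDeriv.iteratedLineDerivOp m (cvl n g h) = cvl n g (LineDeriv.iteratedLineDerivOp m h) := by
    intro k
    induction k with
    | zero => intro m; rfl
    | succ k ih =>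
      intro m
      rw [LineDeriv.iteratedLineDerivOp_succ_left, LineDeriv.iteratedLineDerivOp_succ_left, ih, cvl_deriv]
  intro k m x
  rw [← SchwartzMap.iteratedLineDerivOp_eq_iteratedFDeriv, this, cvl_apply]
  simp_rw [SchwartzMap.iteratedLineDerivOp_eq_iteratedFDeriv]


lemma sdec (n : ℕ) (g : Sc n) (N : ℕ) : ∃ C, 0 ≤ C ∧ ∀ m ≤ N, ∀ x, (1 + ‖x‖) ^ N * ‖iteratedFDeriv ℝ m g x‖ ≤ C :=
  ⟨2 ^ N * ((Finset.Iic (N, N)).sup fun m => SchwartzMap.seminorm ℂ m.1 m.2) g, by positivity,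
    fun m hm x => SchwartzMap.one_add_le_sup_seminorm_apply (𝕜 := ℂ) (m := (N, N)) le_rfl hm g x⟩

/-- reflected translate -/
def RS (n : ℕ) (x : RV n) : Sc n →L[ℂ] Sc n :=
  (SchwartzMap.compSubConstCLM ℂ x).comp (SchwartzMap.compCLMOfContinuousLinearEquiv ℂ (ContinuousLinearEquiv.neg ℝ))
lemma RS_apply (n : ℕ) (x y : RV n) (g : Sc n) : RS n x g y = g (x - y) := by
  show g (-(y - x)) = _
  rw [neg_sub]

lemma RS_iter (n : ℕ) (x w : RV n) (g : Sc n) (m : ℕ) :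
    iteratedFDeriv ℝ m (RS n x g) w = (-1 : ℝ) ^ m • iteratedFDeriv ℝ m g (x - w) := by
  have e : (RS n x g : RV n → ℂ) = fun y => (fun z => g (-z)) (y - x) := by
    funext y; rw [RS_apply]; simp only [neg_sub]
  have h1 := iteratedFDeriv_comp_sub (𝕜 := ℝ) (f := fun z => g (-z)) m x w
  rw [e, h1]
  have h2 := ContinuousLinearMap.iteratedFDeriv_comp_right (-ContinuousLinearMap.id ℝ (RV n)) (g.smooth ⊤) (w - x) (i := m) (by exact_mod_cast le_top)
  have e2 : (fun z => g (-z)) = ⇑g ∘ ⇑(-ContinuousLinearMap.id ℝ (RV n)) := rfl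
  rw [e2, h2]
  ext v
  rw [ContinuousMultilinearMap.compContinuousLinearMap_apply, ContinuousMultilinearMap.smul_apply]
  have h3 := (iteratedFDeriv ℝ m g (x - w)).map_smul_univ (fun _ => (-1:ℝ)) v
  simp only [Finset.prod_const, Finset.card_univ, Fintype.card_fin] at h3
  rw [← h3]
  simp

structure Jx (n N : ℕ) where
  m : ℕ
  hm : m ≤ N
  x : RV n
  v : Fin m → RV n

instance (n N : ℕ) : TopologicalSpace (Jx n N) := ⊥
instance (n N : ℕ) : DiscreteTopology (Jx n N) := ⟨rfl⟩
abbrev XB (n N : ℕ) := BoundedContinuousFunction (Jx n N) ℂ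

def Jv (n N : ℕ) (g : Sc n) (i : Jx n N) : ℂ :=
  (((1 + ‖i.x‖) ^ N / ∏ l, ‖i.v l‖ : ℝ) : ℂ) * iteratedFDeriv ℝ i.m g i.x i.v

lemma Jv_le (n N : ℕ) (g : Sc n) (i : Jx n N) : ‖Jv n N g i‖ ≤ (1 + ‖i.x‖) ^ N * ‖iteratedFDeriv ℝ i.m g i.x‖ := by
  unfold Jv
  rw [norm_mul, Complex.norm_real, Real.norm_of_nonneg (by positivity), div_mul_eq_mul_div, mul_div_assoc]
  refine mul_le_mul_of_nonneg_left ?_ (by positivity)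
  exact div_le_of_le_mul₀ (Finset.prod_nonneg fun _ _ => norm_nonneg _) (norm_nonneg _) (ContinuousMultilinearMap.le_opNorm _ _)

lemma sdecJ (n N : ℕ) (g : Sc n) : ∃ C, ∀ i, ‖Jv n N g i‖ ≤ C := by
  obtain ⟨C, h0, hC⟩ := sdec n g N
  exact ⟨C, fun i => (Jv_le n N g i).trans (hC i.m i.hm i.x)⟩

def JJ (n N : ℕ) : Sc n →ₗ[ℂ] XB n N where
  toFun g := BoundedContinuousFunction.ofNormedAddCommGroupDiscrete (Jv n N g) _ (sdecJ n N g).choose_spec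
  map_add' g h := by
    ext i
    show Jv n N (g + h) i = Jv n N g i + Jv n N h i
    unfold Jv
    have e : ⇑(g + h) = ⇑g + ⇑h := rfl
    rw [e, iteratedFDeriv_add_apply (g.smooth _).contDiffAt (h.smooth _).contDiffAt]
    rw [ContinuousMultilinearMap.add_apply]; ring
  map_smul' c g := by
    ext i
    show Jv n N (c • g) i = c * Jv n N g i
    unfold Jv
    have e : ⇑(c • g) = c • ⇑g := rfl
    rw [e, iteratedFDeriv_const_smul_apply (g.smooth _).contDiffAt]
    rw [ContinuousMultilinearMap.smul_apply, smul_eq_mul]; ring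

lemma JJ_apply (n N : ℕ) (g : Sc n) (i : Jx n N) : JJ n N g i = Jv n N g i := rfl

lemma JJ_le (n N : ℕ) (g : Sc n) {C : ℝ} (hC : 0 ≤ C) (h : ∀ m ≤ N, ∀ x, (1 + ‖x‖) ^ N * ‖iteratedFDeriv ℝ m g x‖ ≤ C) :
    ‖JJ n N g‖ ≤ C :=
  (BoundedContinuousFunction.norm_le hC).2 fun i => (Jv_le n N g i).trans (h i.m i.hm i.x)

lemma le_JJ (n N : ℕ) (g : Sc n) {m : ℕ} (hm : m ≤ N) (x : RV n) : (1 + ‖x‖) ^ N * ‖iteratedFDeriv ℝ m g x‖ ≤ ‖JJ n N g‖ := by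
  have h0 : 0 < (1 + ‖x‖) ^ N := by positivity
  rw [← le_div_iff₀' h0]
  refine ContinuousMultilinearMap.opNorm_le_bound (by positivity) fun v => ?_
  have h1 := (JJ n N g).norm_coe_le_norm ⟨m, hm, x, v⟩
  rw [JJ_apply, Jv, norm_mul, Complex.norm_real, Real.norm_of_nonneg (by positivity)] at h1
  rcases (Finset.prod_nonneg fun l _ => norm_nonneg (v l) : 0 ≤ ∏ l, ‖v l‖).eq_or_lt with h2 | h2
  · have := (iteratedFDeriv ℝ m g x).le_opNorm v
    rw [← h2, mul_zero] at this ⊢; exact this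
  · simp only at h1
    rw [div_mul_eq_mul_div, div_le_iff₀ h2] at h1
    rw [div_mul_eq_mul_div, le_div_iff₀ h0]; linarith

/-- continuous functionals factor through JJ -/
lemma fJ (n : ℕ) (f : TD n) : ∃ (N : ℕ) (F : XB n N →L[ℂ] ℂ), ∀ g, f g = F (JJ n N g) := by
  obtain ⟨s, C, hC, hb⟩ := Seminorm.bound_of_continuous (schwartz_withSeminorms ℂ (RV n) ℂ)
    ((normSeminorm ℂ ℂ).comp f.toLinearMap) (by
      show Continuous fun g => ‖f g‖
      exact f.continuous.norm)
  obtain ⟨N, hN⟩ : ∃ N, ∀ i ∈ s, i.1 ≤ N ∧ i.2 ≤ N :=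
    ⟨s.sup (fun i => max i.1 i.2), fun i hi => by
      have := Finset.le_sup (f := fun i : ℕ × ℕ => max i.1 i.2) hi
      exact ⟨(le_max_left _ _).trans this, (le_max_right _ _).trans this⟩⟩
  have hb2 : ∀ g, ‖f g‖ ≤ C * ‖JJ n N g‖ := by
    intro g
    refine (hb g).trans ?_
    show (C:ℝ) * (s.sup (schwartzSeminormFamily ℂ (RV n) ℂ)) g ≤ _
    refine mul_le_mul_of_nonneg_left ?_ C.2
    refine Seminorm.finset_sup_apply_le (norm_nonneg _) fun i hi => ?_
    refine SchwartzMap.seminorm_le_bound ℂ _ _ _ (norm_nonneg _) fun x => ?_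
    refine le_trans ?_ (le_JJ n N g (hN i hi).2 x)
    refine mul_le_mul_of_nonneg_right ?_ (norm_nonneg _)
    exact (pow_le_pow_left₀ (norm_nonneg _) (by linarith) _).trans (pow_le_pow_right₀ (by linarith [norm_nonneg x]) (hN i hi).1)
  have hinj : Function.Injective (JJ n N) := by
    rw [injective_iff_map_eq_zero]
    intro g hg
    ext x
    have := le_JJ n N g (Nat.zero_le N) x
    rw [hg, norm_zero, norm_iteratedFDeriv_zero] at this
    have h0 : 0 < (1 + ‖x‖) ^ N := by positivity
    have h3 : ‖g x‖ ≤ 0 := by by_contra h; exact absurd this (not_le.2 (mul_pos h0 (not_le.1 h)))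
    simpa using h3
  let eq := LinearEquiv.ofInjective (JJ n N) hinj
  let f1 : (LinearMap.range (JJ n N)) →ₗ[ℂ] ℂ := f.toLinearMap.comp eq.symm.toLinearMap
  let f2 : (LinearMap.range (JJ n N)) →L[ℂ] ℂ := f1.mkContinuous C (by
    intro y
    have e : ‖y‖ = ‖JJ n N (eq.symm y)‖ := by
      have : eq (eq.symm y) = y := eq.apply_symm_apply y
      conv_lhs => rw [← this]
      rfl
    rw [e]; exact hb2 _)
  obtain ⟨F, hF, -⟩ := exists_extension_norm_eq _ f2
  refine ⟨N, F, fun g => ?_⟩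
  have := hF (eq g)
  rw [show ((eq g : LinearMap.range (JJ n N)) : XB n N) = JJ n N g from rfl] at this
  rw [this]
  show f g = f (eq.symm (eq g))
  rw [eq.symm_apply_apply]

lemma JRS_le (n N : ℕ) (g : Sc n) : ∃ C, 0 ≤ C ∧ ∀ x, ‖JJ n N (RS n x g)‖ ≤ C * (1 + ‖x‖) ^ N := by
  obtain ⟨C, h0, hC⟩ := sdec n g N
  refine ⟨C, h0, fun x => JJ_le n N _ (by positivity) fun m hm w => ?_⟩
  rw [RS_iter, norm_smul]
  simp only [norm_pow, norm_neg, norm_one, one_pow, one_mul]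
  have h1 : 1 + ‖w‖ ≤ (1 + ‖x - w‖) * (1 + ‖x‖) := by
    have : ‖w‖ ≤ ‖x‖ + ‖x - w‖ := by have := norm_sub_norm_le w x; rw [norm_sub_rev] at this; linarith
    nlinarith [norm_nonneg x, norm_nonneg (x - w)]
  calc _ ≤ ((1 + ‖x - w‖) * (1 + ‖x‖)) ^ N * ‖iteratedFDeriv ℝ m g (x - w)‖ := by gcongr
    _ = ((1 + ‖x - w‖) ^ N * ‖iteratedFDeriv ℝ m g (x - w)‖) * (1 + ‖x‖) ^ N := by rw [mul_pow]; ring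
    _ ≤ _ := by gcongr; exact hC m hm _

lemma JRS_cont (n N : ℕ) (g : Sc n) : Continuous fun x => JJ n N (RS n x g) := by
  obtain ⟨C, h0, hC⟩ := sdec n g (N + 1)
  rw [continuous_iff_continuousAt]
  intro x0
  have key : ∀ x, ‖x - x0‖ ≤ 1 → ‖JJ n N (RS n x g) - JJ n N (RS n x0 g)‖ ≤ C * (2 + ‖x0‖) ^ N * ‖x - x0‖ := by
    intro x hx
    rw [← map_sub]
    refine JJ_le n N _ (by positivity) fun m hm w => ?_
    have e : iteratedFDeriv ℝ m (RS n x g - RS n x0 g : Sc n) w = (-1:ℝ) ^ m • (iteratedFDeriv ℝ m g (x - w) - iteratedFDeriv ℝ m g (x0 - w)) := by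
      have e : ⇑(RS n x g - RS n x0 g) = ⇑(RS n x g) - ⇑(RS n x0 g) := rfl
      rw [e, iteratedFDeriv_sub_apply ((RS n x g).smooth _).contDiffAt ((RS n x0 g).smooth _).contDiffAt, RS_iter, RS_iter, smul_sub]
    rw [e, norm_smul]
    simp only [norm_pow, norm_neg, norm_one, one_pow, one_mul]
    have hw0 : 0 < (1 + ‖w‖) ^ N := by positivity
    have h2 : ‖iteratedFDeriv ℝ m g (x - w) - iteratedFDeriv ℝ m g (x0 - w)‖ ≤ (C * (2 + ‖x0‖) ^ N / (1 + ‖w‖) ^ N) * ‖(x - w) - (x0 - w)‖ := by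
      refine Convex.norm_image_sub_le_of_norm_fderiv_le (𝕜 := ℝ) (s := Metric.closedBall (x0 - w) 1) ?_ ?_ (convex_closedBall _ _) (by simp) (by simpa [dist_eq_norm] using hx)
      · intro y _
        exact ((g.smooth ⊤).differentiable_iteratedFDeriv (by exact_mod_cast WithTop.coe_lt_top m)) y
      · intro y hy
        rw [norm_fderiv_iteratedFDeriv, le_div_iff₀ hw0]
        rw [Metric.mem_closedBall, dist_eq_norm] at hy
        have h1 : 1 + ‖w‖ ≤ (1 + ‖y‖) * (2 + ‖x0‖) := by
          have : ‖w‖ ≤ ‖x0‖ + ‖y‖ + ‖y - (x0 - w)‖ := by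
            have e : w = x0 - y + (y - (x0 - w)) := by abel
            calc ‖w‖ = ‖x0 - y + (y - (x0 - w))‖ := by rw [← e]
              _ ≤ ‖x0 - y‖ + _ := norm_add_le _ _
              _ ≤ _ := by linarith [norm_sub_le x0 y]
          nlinarith [norm_nonneg x0, norm_nonneg y]
        calc _ ≤ ‖iteratedFDeriv ℝ (m + 1) g y‖ * ((1 + ‖y‖) * (2 + ‖x0‖)) ^ N := by gcongr
          _ = ((1 + ‖y‖) ^ N * ‖iteratedFDeriv ℝ (m + 1) g y‖) * (2 + ‖x0‖) ^ N := by rw [mul_pow]; ring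
          _ ≤ _ := by
            gcongr
            refine le_trans ?_ (hC (m + 1) (by omega) y)
            gcongr
            · linarith [norm_nonneg y]
            · omega
    rw [sub_sub_sub_cancel_right] at h2
    calc _ ≤ (1 + ‖w‖) ^ N * ((C * (2 + ‖x0‖) ^ N / (1 + ‖w‖) ^ N) * ‖x - x0‖) := by gcongr
      _ = _ := by field_simp
  rw [ContinuousAt, tendsto_iff_norm_sub_tendsto_zero]
  refine squeeze_zero' (Filter.Eventually.of_forall fun _ => norm_nonneg _) (g := fun x => C * (2 + ‖x0‖) ^ N * ‖x - x0‖) ?_ ?_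
  · filter_upwards [Metric.closedBall_mem_nhds x0 one_pos] with x hx
    exact key x (by simpa [dist_eq_norm] using hx)
  · have : Continuous fun x => C * (2 + ‖x0‖) ^ N * ‖x - x0‖ := by fun_prop
    simpa using this.tendsto x0

/-- the key integral formula -/
lemma conv_int (n : ℕ) (f : TD n) (κ g : Sc n) (y : RV n) :
    f (RS n y (cvl n κ g)) = ∫ z, κ z * f (RS n (y - z) g) := by
  obtain ⟨N, F, hF⟩ := fJ n f
  obtain ⟨C, h0, hC⟩ := JRS_le n N g
  have hi : Integrable fun z => κ z • JJ n N (RS n (y - z) g) := by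
    have hd : Integrable fun z => C * (1 + ‖y‖) ^ N * ((1 + ‖z‖) ^ N * ‖κ z‖) := by
      refine Integrable.const_mul ?_ _
      have h1 : Integrable fun z => 2 ^ (N) * (‖κ z‖ + ‖z‖ ^ N * ‖κ z‖) :=
        Integrable.const_mul ((κ.integrable (μ := volume)).norm.add (κ.integrable_pow_mul volume N)) _
      refine h1.mono' (by exact (Continuous.aestronglyMeasurable (by have := κ.continuous; fun_prop))) (Filter.Eventually.of_forall fun z => ?_)
      rw [Real.norm_of_nonneg (by positivity)]
      have h2 : (1 + ‖z‖) ^ N ≤ 2 ^ N * (1 + ‖z‖ ^ N) := by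
        rcases le_total ‖z‖ 1 with h | h
        · calc (1 + ‖z‖) ^ N ≤ 2 ^ N := by gcongr; linarith
            _ ≤ _ := le_mul_of_one_le_right (by positivity) (by linarith [pow_nonneg (norm_nonneg z) N])
        · calc (1 + ‖z‖) ^ N ≤ (2 * ‖z‖) ^ N := by gcongr; linarith
            _ ≤ _ := by rw [mul_pow]; gcongr; linarith
      calc _ ≤ 2 ^ N * (1 + ‖z‖ ^ N) * ‖κ z‖ := by gcongr
        _ = _ := by ring
    refine hd.mono' ?_ (Filter.Eventually.of_forall fun z => ?_)
    · have h1 := (JRS_cont n N g).comp (continuous_const.sub continuous_id : Continuous fun z : RV n => y - z)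
      exact (κ.continuous.smul h1).aestronglyMeasurable
    · rw [norm_smul]
      have h1 : 1 + ‖y - z‖ ≤ (1 + ‖y‖) * (1 + ‖z‖) := by nlinarith [norm_sub_le y z, norm_nonneg y, norm_nonneg z]
      calc _ ≤ ‖κ z‖ * (C * ((1 + ‖y‖) * (1 + ‖z‖)) ^ N) := by
            refine mul_le_mul_of_nonneg_left ((hC _).trans ?_) (norm_nonneg _)
            gcongr
        _ = _ := by rw [mul_pow]; ring
  have e1 : JJ n N (RS n y (cvl n κ g)) = ∫ z, κ z • JJ n N (RS n (y - z) g) := by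
    ext i
    have h1 := ContinuousLinearMap.integral_comp_comm (BoundedContinuousFunction.evalCLM ℂ i : XB n N →L[ℂ] ℂ) hi
    have h2 : (∫ z, κ z • JJ n N (RS n (y - z) g)) i = ∫ z, κ z * JJ n N (RS n (y - z) g) i := h1.symm
    rw [h2]
    simp only [JJ_apply, Jv, RS_iter, ContinuousMultilinearMap.smul_apply, cvl_iter, Complex.real_smul]
    rw [← integral_const_mul, ← integral_const_mul]
    refine integral_congr_ae (Filter.Eventually.of_forall fun z => ?_)
    simp only
    rw [show y - z - i.x = y - i.x - z by abel]
    ring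
  rw [hF, e1, ← ContinuousLinearMap.integral_comp_comm F hi]
  refine integral_congr_ae (Filter.Eventually.of_forall fun z => ?_)
  simp only
  rw [map_smul, smul_eq_mul, hF]


lemma sgl_le {n : ℕ} (F : Fin n → ℝ) (h : ∀ l, 1 ≤ F l) (l : Fin n) : F l ≤ ∏ l, F l := by
  rw [← Finset.mul_prod_erase Finset.univ F (Finset.mem_univ l)]
  have h1 : ∏ i ∈ Finset.univ.erase l, (1:ℝ) ≤ ∏ i ∈ Finset.univ.erase l, F i := Finset.prod_le_prod (fun _ _ => zero_le_one) fun i _ => h i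
  rw [Finset.prod_const_one] at h1
  exact le_mul_of_one_le_right (by linarith [h l]) h1

lemma dil_int (n : ℕ) (σ : Fin n → ℝ) (hσ : ∀ l, 0 < σ l) (F : RV n → ℂ) :
    ∫ x, F x = ((∏ l, σ l : ℝ) : ℂ) * ∫ x : RV n, F (fun l => σ l * x l) := by
  have hd : (Matrix.diagonal σ).det = ∏ l, σ l := Matrix.det_diagonal
  have hpos : 0 < ∏ l, σ l := Finset.prod_pos fun l _ => hσ l
  have h1 := Real.smul_map_diagonal_volume_pi (D := σ) (by rw [hd]; exact hpos.ne')
  conv_lhs => rw [← h1]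
  rw [integral_smul_measure, hd, abs_of_pos hpos, ENNReal.toReal_ofReal hpos.le, Complex.real_smul]
  congr 1
  let D : RV n ≃L[ℝ] RV n := ContinuousLinearEquiv.piCongrRight fun l => ContinuousLinearEquiv.smulLeft (Units.mk0 (σ l) (hσ l).ne')
  have e : ⇑((Matrix.diagonal σ).toLin') = ⇑D := by
    funext x; funext l
    rw [Matrix.toLin'_apply, Matrix.mulVec_diagonal]; rfl
  rw [e]
  rw [show (⇑D : RV n → RV n) = ⇑D.toHomeomorph.toMeasurableEquiv from rfl, integral_map_equiv]
  rfl

def DG (n : ℕ) (a : Fin n → ℝ) (k : ℕ) : RV n ≃L[ℝ] RV n :=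
  ContinuousLinearEquiv.piCongrRight fun l => ContinuousLinearEquiv.smulLeft (Units.mk0 (sg n a k l) (sg_pos n a k l).ne')

lemma DG_apply (n : ℕ) (a : Fin n → ℝ) (k : ℕ) (x : RV n) : DG n a k x = fun l => sg n a k l * x l := rfl

def VR (n : ℕ) (a : Fin n → ℝ) (k : ℕ) : ℝ := ∏ l, sg n a k l
lemma VR_pos (n : ℕ) (a : Fin n → ℝ) (k : ℕ) : 0 < VR n a k := Finset.prod_pos fun l _ => sg_pos n a k l
lemma VR_add (n : ℕ) (a : Fin n → ℝ) (k i : ℕ) : VR n a (k + i) = VR n a k * VR n a i := by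
  unfold VR; rw [← Finset.prod_mul_distrib]; exact Finset.prod_congr rfl fun l _ => sg_add n a k i l

def dl (n : ℕ) (a : Fin n → ℝ) (k : ℕ) (g : Sc n) : Sc n :=
  ((VR n a k : ℝ) : ℂ) • SchwartzMap.compCLMOfContinuousLinearEquiv ℂ (DG n a k) g

lemma dl_apply (n : ℕ) (a : Fin n → ℝ) (k : ℕ) (g : Sc n) (x : RV n) :
    dl n a k g x = ((VR n a k : ℝ) : ℂ) * g (fun l => sg n a k l * x l) := rfl

lemma dl_zero (n : ℕ) (a : Fin n → ℝ) (g : Sc n) : dl n a 0 g = g := by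
  ext x; rw [dl_apply]; simp [VR, sg_zero]

lemma dl_dl (n : ℕ) (a : Fin n → ℝ) (k i : ℕ) (g : Sc n) : dl n a (k + i) g = dl n a k (dl n a i g) := by
  ext x; simp only [dl_apply, VR_add, sg_add]; push_cast
  rw [mul_assoc]; congr 3; funext l; ring

/-- change of variables -/
lemma dl_int (n : ℕ) (a : Fin n → ℝ) (k : ℕ) (g : Sc n) (F : RV n → ℂ) :
    ∫ z, dl n a k g z * F z = ∫ z, g z * F (fun l => z l / sg n a k l) := by
  rw [dil_int n (sg n a k) (sg_pos n a k) (fun z => g z * F (fun l => z l / sg n a k l)), ← integral_const_mul]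
  refine integral_congr_ae (Filter.Eventually.of_forall fun z => ?_)
  simp only [dl_apply]
  rw [mul_assoc]
  congr 3
  funext l
  rw [mul_div_cancel_left₀ _ (sg_pos n a k l).ne']

lemma FT_dl (n : ℕ) (a : Fin n → ℝ) (k : ℕ) (g : Sc n) (ξ : RV n) :
    FT n (dl n a k g) ξ = FT n g (fun l => ξ l / sg n a k l) := by
  unfold FT
  have h := dl_int n a k g (fun x => Complex.exp (-Complex.I * ((∑ i, x i * ξ i : ℝ) : ℂ)))
  simp only [mul_comm (dl n a k g _), mul_comm (g _)] at h
  rw [h]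
  refine integral_congr_ae (Filter.Eventually.of_forall fun z => ?_)
  simp only
  congr 4
  refine Finset.sum_congr rfl fun l _ => ?_
  ring

lemma cvl_comm (n : ℕ) (g h : Sc n) : cvl n g h = cvl n h g := FT_inj n fun ξ => by rw [FT_cvl, FT_cvl, mul_comm]
lemma cvl_dl (n : ℕ) (a : Fin n → ℝ) (k : ℕ) (g h : Sc n) : cvl n (dl n a k g) (dl n a k h) = dl n a k (cvl n g h) :=
  FT_inj n fun ξ => by rw [FT_cvl, FT_dl, FT_dl, FT_dl, FT_cvl]

def bs (n : ℕ) (φ0 φ : Sc n) (k : ℕ) : Sc n := if k = 0 then φ0 else φ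
def fm (n : ℕ) (a : Fin n → ℝ) (φ0 φ : Sc n) (k : ℕ) : Sc n := dl n a k (bs n φ0 φ k)

lemma fm_fam (n : ℕ) (a : Fin n → ℝ) (φ0 φ : Sc n) (k : ℕ) (x : RV n) : fm n a φ0 φ k x = fam n a φ0 φ k x := by
  cases k with
  | zero => unfold fm; rw [dl_zero]; rfl
  | succ k =>
    unfold fm; rw [dl_apply]
    simp only [fam, bs, if_neg (Nat.succ_ne_zero k), VR, sg_prod]
    simp only [sg, Nat.cast_add, Nat.cast_one]

lemma DG_norm (n : ℕ) {a : Fin n → ℝ} (ha : ∀ i, 1 ≤ a i) (k : ℕ) : ‖(DG n a k : RV n →L[ℝ] RV n)‖ ≤ VR n a k := by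
  refine ContinuousLinearMap.opNorm_le_bound _ (VR_pos n a k).le fun x => ?_
  refine (pi_norm_le_iff_of_nonneg (mul_nonneg (VR_pos n a k).le (norm_nonneg _))).2 fun l => ?_
  show ‖sg n a k l * x l‖ ≤ _
  rw [norm_mul, Real.norm_of_nonneg (sg_pos n a k l).le]
  refine mul_le_mul ?_ (norm_le_pi_norm x l) (norm_nonneg _) (VR_pos n a k).le
  unfold VR
  exact sgl_le (fun l => sg n a k l) (fun l => sg_one n ha k l) l

lemma VR_one (n : ℕ) {a : Fin n → ℝ} (ha : ∀ i, 1 ≤ a i) (k : ℕ) : 1 ≤ VR n a k := by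
  have : ∏ l : Fin n, (1:ℝ) ≤ VR n a k := Finset.prod_le_prod (fun _ _ => zero_le_one) fun l _ => sg_one n ha k l
  simpa using this

lemma norm_le_DG (n : ℕ) {a : Fin n → ℝ} (ha : ∀ i, 1 ≤ a i) (k : ℕ) (x : RV n) : ‖x‖ ≤ ‖DG n a k x‖ := by
  refine (pi_norm_le_iff_of_nonneg (norm_nonneg _)).2 fun l => ?_
  refine le_trans ?_ (norm_le_pi_norm _ l)
  rw [DG_apply]
  simp only [norm_mul, Real.norm_of_nonneg (sg_pos n a k l).le]
  exact le_mul_of_one_le_left (norm_nonneg _) (sg_one n ha k l)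

lemma dl_sdec (n : ℕ) {a : Fin n → ℝ} (ha : ∀ i, 1 ≤ a i) (g : Sc n) (N : ℕ) : ∃ C, 0 ≤ C ∧ ∀ k : ℕ, ∀ m ≤ N, ∀ x,
    (1 + ‖x‖) ^ N * ‖iteratedFDeriv ℝ m (dl n a k g) x‖ ≤ C * VR n a k ^ (N + 1) := by
  obtain ⟨C, h0, hC⟩ := sdec n g N
  refine ⟨C, h0, fun k m hm x => ?_⟩
  have hV := VR_pos n a k
  have e : ⇑(dl n a k g) = ((VR n a k : ℝ) : ℂ) • (⇑g ∘ ⇑(DG n a k : RV n →L[ℝ] RV n)) := rfl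
  have hsm : ContDiff ℝ m (⇑g ∘ ⇑(DG n a k : RV n →L[ℝ] RV n)) := (g.smooth m).comp (ContinuousLinearMap.contDiff _)
  rw [e, iteratedFDeriv_const_smul_apply hsm.contDiffAt, norm_smul, Complex.norm_real, Real.norm_of_nonneg hV.le,
    ContinuousLinearMap.iteratedFDeriv_comp_right _ (g.smooth m) x le_rfl]
  have h1 := ContinuousMultilinearMap.norm_compContinuousLinearMap_le (iteratedFDeriv ℝ m g (DG n a k x)) (fun _ : Fin m => (DG n a k : RV n →L[ℝ] RV n))
  simp only [Finset.prod_const, Finset.card_univ, Fintype.card_fin] at h1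
  have h2 := norm_le_DG n ha k x
  calc _ ≤ (1 + ‖DG n a k x‖) ^ N * (VR n a k * (‖iteratedFDeriv ℝ m g (DG n a k x)‖ * VR n a k ^ N)) := by
        refine mul_le_mul (by gcongr) (mul_le_mul_of_nonneg_left (h1.trans ?_) hV.le) (by positivity) (by positivity)
        refine mul_le_mul_of_nonneg_left ?_ (norm_nonneg _)
        exact (pow_le_pow_left₀ (norm_nonneg _) (DG_norm n ha k) _).trans (pow_le_pow_right₀ (VR_one n ha k) hm)
    _ = ((1 + ‖DG n a k x‖) ^ N * ‖iteratedFDeriv ℝ m g (DG n a k x)‖) * VR n a k ^ (N + 1) := by ring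
    _ ≤ _ := by gcongr; exact hC m hm _

lemma JRS_le2 (n N : ℕ) (g : Sc n) {C : ℝ} (h0 : 0 ≤ C) (hC : ∀ m ≤ N, ∀ x, (1 + ‖x‖) ^ N * ‖iteratedFDeriv ℝ m g x‖ ≤ C) (x : RV n) :
    ‖JJ n N (RS n x g)‖ ≤ C * (1 + ‖x‖) ^ N := by
  refine JJ_le n N _ (by positivity) fun m hm w => ?_
  rw [RS_iter, norm_smul]
  simp only [norm_pow, norm_neg, norm_one, one_pow, one_mul]
  have h1 : 1 + ‖w‖ ≤ (1 + ‖x - w‖) * (1 + ‖x‖) := by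
    have : ‖w‖ ≤ ‖x‖ + ‖x - w‖ := by have := norm_sub_norm_le w x; rw [norm_sub_rev] at this; linarith
    nlinarith [norm_nonneg x, norm_nonneg (x - w)]
  calc _ ≤ ((1 + ‖x - w‖) * (1 + ‖x‖)) ^ N * ‖iteratedFDeriv ℝ m g (x - w)‖ := by gcongr
    _ = ((1 + ‖x - w‖) ^ N * ‖iteratedFDeriv ℝ m g (x - w)‖) * (1 + ‖x‖) ^ N := by rw [mul_pow]; ring
    _ ≤ _ := by gcongr; exact hC m hm _

lemma WW0_ge (n : ℕ) (σ : Fin n → ℝ) (hσ : ∀ l, 1 ≤ σ l) (y : RV n) : 1 + ‖y‖ ≤ WW n σ y := by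
  have h0 := fun l => lt_of_lt_of_le one_pos (hσ l)
  have h1 : ∀ l, 1 + |y l| ≤ WW n σ y := fun l => by
    refine le_trans ?_ (sgl_le (fun l => 1 + σ l * |y l|) (fun l => ?_) l)
    · nlinarith [hσ l, abs_nonneg (y l)]
    · nlinarith [mul_nonneg (h0 l).le (abs_nonneg (y l))]
  have : ‖y‖ ≤ WW n σ y - 1 := (pi_norm_le_iff_of_nonneg (by linarith [WW_one n h0 y])).2 fun l => by
    have := h1 l; rw [Real.norm_eq_abs]; linarith
  linarith

/-- hI3 -/
lemma growth (n : ℕ) {a : Fin n → ℝ} (ha : ∀ i, 1 ≤ a i) (φ0 φ : Sc n) (f : TD n) : ∃ (Cf : ℝ≥0∞) (N0 : ℕ), Cf ≠ ∞ ∧ ∀ (k : ℕ) y,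
    ‖f (RS n y (fm n a φ0 φ k))‖ₑ * ww n a 0 y ^ N0 ≤ Cf * T2 (k * N0) := by
  obtain ⟨N, F, hF⟩ := fJ n f
  obtain ⟨C1, h1, hC1⟩ := dl_sdec n ha φ0 N
  obtain ⟨C2, h2, hC2⟩ := dl_sdec n ha φ N
  obtain ⟨N1, hN1⟩ := exists_nat_ge ((N + 1) * ∑ i, a i)
  have hS : 0 ≤ ∑ i, a i := Finset.sum_nonneg fun i _ => by linarith [ha i]
  refine ⟨ENNReal.ofReal (‖F‖ * (C1 + C2)), max N N1, ENNReal.ofReal_ne_top, fun k y => ?_⟩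
  set N0 := max N N1
  have hV := VR_pos n a k
  have hb : ‖f (RS n y (fm n a φ0 φ k))‖ ≤ ‖F‖ * ((C1 + C2) * VR n a k ^ (N + 1) * (1 + ‖y‖) ^ N) := by
    rw [hF]
    refine (F.le_opNorm _).trans (mul_le_mul_of_nonneg_left ?_ (norm_nonneg _))
    refine JRS_le2 n N _ (by positivity) (fun m hm x => ?_) y
    unfold fm bs
    split_ifs
    · refine (hC1 k m hm x).trans ?_; gcongr; linarith
    · refine (hC2 k m hm x).trans ?_; gcongr; linarith
  have hsp : ∀ l, 0 < sg n a 0 l := sg_pos n a 0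
  have hW := WW_pos n hsp y
  have hW2 := WW0_ge n (sg n a 0) (fun l => (sg_zero n a l).ge) y
  rw [← ofReal_norm, ww, ← ENNReal.ofReal_pow (inv_nonneg.2 hW.le), ← ENNReal.ofReal_mul (norm_nonneg _), ← T2_ofReal, ← ENNReal.ofReal_mul (by positivity)]
  refine ENNReal.ofReal_le_ofReal ?_
  have h3 : VR n a k ^ (N + 1) ≤ (2:ℝ) ^ ((k:ℝ) * (N0:ℝ)) := by
    unfold VR; rw [sg_prod, ← Real.rpow_natCast, ← Real.rpow_mul (by norm_num)]
    refine Real.rpow_le_rpow_of_exponent_le (by norm_num) ?_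
    rw [mul_assoc]
    refine mul_le_mul_of_nonneg_left ?_ (by positivity)
    have : (N1:ℝ) ≤ N0 := by exact_mod_cast le_max_right _ _
    push_cast; linarith
  have h4 : (1 + ‖y‖) ^ N * (WW n (sg n a 0) y)⁻¹ ^ N0 ≤ 1 := by
    rw [inv_pow, ← div_eq_mul_inv, div_le_one (by positivity)]
    calc _ ≤ (1 + ‖y‖) ^ N0 := pow_le_pow_right₀ (by linarith [norm_nonneg y]) (le_max_left _ _)
      _ ≤ _ := by gcongr
  calc _ ≤ ‖F‖ * ((C1 + C2) * VR n a k ^ (N + 1) * (1 + ‖y‖) ^ N) * (WW n (sg n a 0) y)⁻¹ ^ N0 := by gcongr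
    _ = ‖F‖ * (C1 + C2) * VR n a k ^ (N + 1) * ((1 + ‖y‖) ^ N * (WW n (sg n a 0) y)⁻¹ ^ N0) := by ring
    _ ≤ ‖F‖ * (C1 + C2) * VR n a k ^ (N + 1) * 1 := by gcongr
    _ ≤ _ := by rw [mul_one]; gcongr

lemma Fcont (n : ℕ) (f : TD n) (g : Sc n) : Continuous fun x => f (RS n x g) := by
  obtain ⟨N, F, hF⟩ := fJ n f
  simp only [hF]
  exact F.continuous.comp (JRS_cont n N g)

lemma Fpoly (n : ℕ) (f : TD n) (g : Sc n) : ∃ N C, 0 ≤ C ∧ ∀ x, ‖f (RS n x g)‖ ≤ C * (1 + ‖x‖) ^ N := by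
  obtain ⟨N, F, hF⟩ := fJ n f
  obtain ⟨C, h0, hC⟩ := JRS_le n N g
  refine ⟨N, ‖F‖ * C, by positivity, fun x => ?_⟩
  rw [hF, mul_assoc]
  exact (F.le_opNorm _).trans (mul_le_mul_of_nonneg_left (hC x) (norm_nonneg _))


lemma int_w (n : ℕ) (κ : Sc n) (N : ℕ) : Integrable fun z => (1 + ‖z‖) ^ N * ‖κ z‖ := by
  have h1 : Integrable fun z => 2 ^ (N) * (‖κ z‖ + ‖z‖ ^ N * ‖κ z‖) :=
    Integrable.const_mul ((κ.integrable (μ := volume)).norm.add (κ.integrable_pow_mul volume N)) _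
  refine h1.mono' (by exact (Continuous.aestronglyMeasurable (by have := κ.continuous; fun_prop))) (Filter.Eventually.of_forall fun z => ?_)
  rw [Real.norm_of_nonneg (by positivity)]
  have h2 : (1 + ‖z‖) ^ N ≤ 2 ^ N * (1 + ‖z‖ ^ N) := by
    rcases le_total ‖z‖ 1 with h | h
    · calc (1 + ‖z‖) ^ N ≤ 2 ^ N := by gcongr; linarith
        _ ≤ _ := le_mul_of_one_le_right (by positivity) (by linarith [pow_nonneg (norm_nonneg z) N])
    · calc (1 + ‖z‖) ^ N ≤ (2 * ‖z‖) ^ N := by gcongr; linarith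
        _ ≤ _ := by rw [mul_pow]; gcongr; linarith
  calc _ ≤ 2 ^ N * (1 + ‖z‖ ^ N) * ‖κ z‖ := by gcongr
    _ = _ := by ring

def Mom (n R : ℕ) (η : RV n → ℂ) : Prop := ∀ k < R, ∀ r : Fin k → Fin n, ∫ y : RV n, η y * ((∏ i, y (r i) : ℝ) : ℂ) = 0

lemma mono_int (n : ℕ) (η : Sc n) (k : ℕ) (r : Fin k → Fin n) : Integrable fun y : RV n => η y * ((∏ i, y (r i) : ℝ) : ℂ) := by
  refine (int_w n η k).mono' (Continuous.aestronglyMeasurable (by have := η.continuous; fun_prop)) (Filter.Eventually.of_forall fun y => ?_)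
  rw [norm_mul, mul_comm, Complex.norm_real, norm_prod]
  refine mul_le_mul_of_nonneg_right ?_ (norm_nonneg _)
  calc _ ≤ ∏ i : Fin k, (1 + ‖y‖) := Finset.prod_le_prod (fun _ _ => norm_nonneg _) fun i _ => by linarith [norm_le_pi_norm y (r i)]
    _ = _ := by simp

lemma mlin (n k : ℕ) (T : ContinuousMultilinearMap ℝ (fun _ : Fin k => RV n) ℂ) (σ : Fin n → ℝ) (y : RV n) :
    T (fun _ => fun l => -(y l / σ l)) = ∑ r : Fin k → Fin n, ((∏ i, y (r i) : ℝ) : ℂ) * (((∏ i, -(σ (r i))⁻¹ : ℝ) : ℂ) * T (fun i => Pi.single (r i) 1)) := by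
  have e : (fun l => -(y l / σ l) : RV n) = ∑ l, (-(y l / σ l)) • (Pi.single l 1 : RV n) := by
    rw [← pi_eq_sum_univ']
  rw [e]
  rw [ContinuousMultilinearMap.map_sum T (fun (_ : Fin k) (l : Fin n) => (-(y l / σ l)) • (Pi.single l 1 : RV n))]
  refine Finset.sum_congr rfl fun r _ => ?_
  have := T.map_smul_univ (fun i => -(y (r i) / σ (r i))) (fun i => (Pi.single (r i) 1 : RV n))
  rw [this, Complex.real_smul, ← mul_assoc, ← Complex.ofReal_mul, ← Finset.prod_mul_distrib]
  congr 3
  funext i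
  ring

lemma mom_T (n R : ℕ) (η : Sc n) (hη : Mom n R η) (k : ℕ) (hk : k < R) (T : ContinuousMultilinearMap ℝ (fun _ : Fin k => RV n) ℂ) (σ : Fin n → ℝ) :
    Integrable (fun y : RV n => η y * T (fun _ => fun l => -(y l / σ l))) ∧ ∫ y : RV n, η y * T (fun _ => fun l => -(y l / σ l)) = 0 := by
  simp only [mlin, Finset.mul_sum, ← mul_assoc (η _)]
  have h1 : ∀ r ∈ (Finset.univ : Finset (Fin k → Fin n)), Integrable fun y : RV n => η y * ((∏ i, y (r i) : ℝ) : ℂ) * (((∏ i, -(σ (r i))⁻¹ : ℝ) : ℂ) * T (fun i => Pi.single (r i) 1)) :=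
    fun r _ => (mono_int n η k r).mul_const _
  refine ⟨integrable_finset_sum _ h1, ?_⟩
  rw [integral_finset_sum _ h1]
  refine Finset.sum_eq_zero fun r _ => ?_
  rw [integral_mul_const, hη k hk r, zero_mul]

lemma line_der (n : ℕ) (g : Sc n) (x v : RV n) (k : ℕ) :
    iteratedDeriv k (fun t : ℝ => g (x + t • v)) = fun t => iteratedFDeriv ℝ k g (x + t • v) (fun _ => v) := by
  induction k with
  | zero => funext t; simp
  | succ k ih =>
    funext t
    rw [iteratedDeriv_succ, ih]
    have h1 : HasFDerivAt (iteratedFDeriv ℝ k g) (fderiv ℝ (iteratedFDeriv ℝ k g) (x + t • v)) (x + t • v) :=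
      (((g.smooth ⊤).differentiable_iteratedFDeriv (by exact_mod_cast WithTop.coe_lt_top k)) _).hasFDerivAt
    have h2 : HasDerivAt (fun t : ℝ => x + t • v) v t := by
      simpa using ((hasDerivAt_id t).smul_const v).const_add x
    have h3 := h1.comp_hasDerivAt t h2
    have h4 := (ContinuousMultilinearMap.apply ℝ (fun _ : Fin k => RV n) ℂ (fun _ => v)).hasFDerivAt.comp_hasDerivAt t h3
    rw [iteratedFDeriv_succ_apply_left]
    exact h4.deriv

lemma taylorS (n : ℕ) (g : Sc n) (x v : RV n) (R : ℕ) (B : ℝ) (hB : ∀ t ∈ Set.Icc (0:ℝ) 1, ‖iteratedFDeriv ℝ R g (x + t • v)‖ ≤ B) :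
    ‖g (x + v) - ∑ k ∈ Finset.range R, ((k.factorial : ℝ)⁻¹ : ℂ) * iteratedFDeriv ℝ k g x (fun _ => v)‖ ≤ B * ‖v‖ ^ R := by
  have hB0 : 0 ≤ B := (norm_nonneg _).trans (hB 0 (by simp))
  cases R with
  | zero =>
    have := hB 1 (by simp)
    simpa using this
  | succ R =>
    have hsm : ContDiff ℝ ((⊤ : ℕ∞) : WithTop ℕ∞) (fun t : ℝ => g (x + t • v)) := (g.smooth ⊤).comp (g := ⇑g) (f := fun t : ℝ => x + t • v) (by fun_prop)
    have hw : ∀ k : ℕ, ∀ t ∈ Set.Icc (0:ℝ) 1, iteratedDerivWithin k (fun t : ℝ => g (x + t • v)) (Set.Icc 0 1) t = iteratedFDeriv ℝ k g (x + t • v) (fun _ => v) := by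
      intro k t ht
      rw [iteratedDerivWithin_eq_iteratedDeriv (uniqueDiffOn_Icc one_pos) ((hsm.of_le (by exact_mod_cast le_top)).contDiffAt) ht, line_der]
    have h1 := taylor_mean_remainder_bound (f := fun t : ℝ => g (x + t • v)) (a := 0) (b := 1) (x := 1) (n := R) (C := B * ‖v‖ ^ (R + 1)) zero_le_one
      ((hsm.of_le (by exact_mod_cast le_top)).contDiffOn) (by simp) (by
        intro t ht
        rw [hw (R + 1) t ht]
        refine (ContinuousMultilinearMap.le_opNorm _ _).trans ?_
        simp only [Finset.prod_const, Finset.card_univ, Fintype.card_fin]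
        exact mul_le_mul_of_nonneg_right (hB t ht) (by positivity))
    rw [taylor_within_apply] at h1
    have e : ∑ k ∈ Finset.range (R + 1), (((k.factorial : ℝ))⁻¹ * (1 - 0) ^ k) • iteratedDerivWithin k (fun t : ℝ => g (x + t • v)) (Set.Icc 0 1) 0
       = ∑ k ∈ Finset.range (R + 1), ((k.factorial : ℝ)⁻¹ : ℂ) * iteratedFDeriv ℝ k g x (fun _ => v) := by
      refine Finset.sum_congr rfl fun k _ => ?_
      rw [hw k 0 (by simp), Complex.real_smul]
      simp
    rw [e] at h1
    simp only [one_smul, sub_zero, one_pow, mul_one] at h1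
    refine h1.trans (div_le_self (by positivity) ?_)
    exact_mod_cast Nat.one_le_iff_ne_zero.2 (Nat.factorial_ne_zero R)

lemma kern0 (n R : ℕ) {a : Fin n → ℝ} (a0 : ℝ) (ha0 : 0 ≤ a0) (ha : ∀ i, a0 ≤ a i) (η μ : Sc n) (hη : Mom n R η) (L : ℕ) :
    ∃ C, 0 ≤ C ∧ ∀ (m : ℕ) (x : RV n), ‖cvl n (dl n a m η) μ x‖ ≤ C * (2:ℝ) ^ (-((m:ℝ) * (R * a0))) * ((1 + ‖x‖) ^ L)⁻¹ := by
  set L' := max L R with hL'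
  obtain ⟨C, h0, hC⟩ := sdec n μ L'
  refine ⟨C * ∫ y, (1 + ‖y‖) ^ (L' + R) * ‖η y‖, by positivity, fun m x => ?_⟩
  rw [cvl_apply, dl_int n a m η (fun y => μ (x - y))]
  set δ : ℝ := (2:ℝ) ^ (-((m:ℝ) * a0)) with hδ
  have hδ0 : 0 < δ := by positivity
  have hδ1 : δ ≤ 1 := Real.rpow_le_one_of_one_le_of_nonpos (by norm_num) (by nlinarith [mul_nonneg (Nat.cast_nonneg (α := ℝ) m) ha0])
  have hv : ∀ y : RV n, ‖(fun l => -(y l / sg n a m l) : RV n)‖ ≤ δ * ‖y‖ := by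
    intro y
    refine (pi_norm_le_iff_of_nonneg (by positivity)).2 fun l => ?_
    rw [norm_neg, norm_div, Real.norm_of_nonneg (sg_pos n a m l).le, div_eq_inv_mul]
    refine mul_le_mul ?_ (norm_le_pi_norm y l) (norm_nonneg _) hδ0.le
    rw [hδ, sg, ← Real.rpow_neg (by norm_num)]
    refine Real.rpow_le_rpow_of_exponent_le (by norm_num) ?_
    have := mul_le_mul_of_nonneg_left (ha l) (Nat.cast_nonneg (α := ℝ) m)
    linarith
  have hx0 : 0 < (1 + ‖x‖) ^ L' := by positivity
  have hpt : ∀ y : RV n, ‖μ (x + fun l => -(y l / sg n a m l)) - ∑ k ∈ Finset.range R, ((k.factorial : ℝ)⁻¹ : ℂ) * iteratedFDeriv ℝ k μ x (fun _ => fun l => -(y l / sg n a m l))‖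
      ≤ (C * (1 + ‖y‖) ^ L' / (1 + ‖x‖) ^ L') * (δ * ‖y‖) ^ R := by
    intro y
    have h1 := taylorS n μ x (fun l => -(y l / sg n a m l)) R (C * (1 + ‖y‖) ^ L' / (1 + ‖x‖) ^ L') (by
      intro t ht
      set v : RV n := fun l => -(y l / sg n a m l)
      have hvy : ‖v‖ ≤ ‖y‖ := (hv y).trans (mul_le_of_le_one_left (norm_nonneg _) hδ1)
      rw [le_div_iff₀ hx0]
      have h2 : 1 + ‖x‖ ≤ (1 + ‖x + t • v‖) * (1 + ‖y‖) := by
        have h3 : ‖x‖ ≤ ‖x + t • v‖ + ‖t • v‖ := by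
          have := norm_sub_le (x + t • v) (t • v); rwa [add_sub_cancel_right] at this
        have h4 : ‖t • v‖ ≤ ‖y‖ := by
          rw [norm_smul, Real.norm_of_nonneg ht.1]
          exact (mul_le_of_le_one_left (norm_nonneg _) ht.2).trans hvy
        nlinarith [norm_nonneg (x + t • v), norm_nonneg y]
      calc _ ≤ ‖iteratedFDeriv ℝ R μ (x + t • v)‖ * ((1 + ‖x + t • v‖) * (1 + ‖y‖)) ^ L' := by gcongr
        _ = ((1 + ‖x + t • v‖) ^ L' * ‖iteratedFDeriv ℝ R μ (x + t • v)‖) * (1 + ‖y‖) ^ L' := by rw [mul_pow]; ring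
        _ ≤ _ := by gcongr; exact hC R (le_max_right _ _) _)
    refine h1.trans ?_
    gcongr
    exact hv y
  have hIT := fun k (hk : k ∈ Finset.range R) => mom_T n R η hη k (Finset.mem_range.1 hk) (iteratedFDeriv ℝ k μ x) (sg n a m)
  have hIT2 : ∀ k ∈ Finset.range R, Integrable fun y : RV n => ((k.factorial : ℝ)⁻¹ : ℂ) * (η y * iteratedFDeriv ℝ k μ x (fun _ => fun l => -(y l / sg n a m l))) :=
    fun k hk => (hIT k hk).1.const_mul _
  have e1 : ∀ y : RV n, η y * μ (x - fun l => y l / sg n a m l) = η y * (μ (x + fun l => -(y l / sg n a m l)) - ∑ k ∈ Finset.range R, ((k.factorial : ℝ)⁻¹ : ℂ) * iteratedFDeriv ℝ k μ x (fun _ => fun l => -(y l / sg n a m l)))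
      + ∑ k ∈ Finset.range R, ((k.factorial : ℝ)⁻¹ : ℂ) * (η y * iteratedFDeriv ℝ k μ x (fun _ => fun l => -(y l / sg n a m l))) := by
    intro y
    have : (x + fun l => -(y l / sg n a m l)) = x - fun l => y l / sg n a m l := by rw [sub_eq_add_neg]; rfl
    rw [this, mul_sub, Finset.mul_sum]
    simp only [mul_left_comm (η y)]
    ring
  have hmaj : ∀ y : RV n, ‖η y * (μ (x + fun l => -(y l / sg n a m l)) - ∑ k ∈ Finset.range R, ((k.factorial : ℝ)⁻¹ : ℂ) * iteratedFDeriv ℝ k μ x (fun _ => fun l => -(y l / sg n a m l)))‖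
      ≤ (C * δ ^ R / (1 + ‖x‖) ^ L') * ((1 + ‖y‖) ^ (L' + R) * ‖η y‖) := by
    intro y
    rw [norm_mul]
    calc _ ≤ ‖η y‖ * ((C * (1 + ‖y‖) ^ L' / (1 + ‖x‖) ^ L') * (δ * ‖y‖) ^ R) := mul_le_mul_of_nonneg_left (hpt y) (norm_nonneg _)
      _ ≤ ‖η y‖ * ((C * (1 + ‖y‖) ^ L' / (1 + ‖x‖) ^ L') * (δ * (1 + ‖y‖)) ^ R) := by gcongr; linarith
      _ = _ := by rw [mul_pow, pow_add]; ring
  have hI0 : Integrable fun y : RV n => η y * μ (x - fun l => y l / sg n a m l) := by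
    obtain ⟨B, hB0, hB⟩ := sdec n μ 0
    refine (Integrable.const_mul (η.integrable (μ := volume)).norm B).mono' (Continuous.aestronglyMeasurable (by
      have := η.continuous; have := μ.continuous; fun_prop)) (Filter.Eventually.of_forall fun y => ?_)
    rw [norm_mul, mul_comm]
    refine mul_le_mul_of_nonneg_right ?_ (norm_nonneg _)
    simpa using hB 0 le_rfl (x - fun l => y l / sg n a m l)
  have hI1 := hI0.sub (integrable_finset_sum _ hIT2)
  have e2 : ∫ y : RV n, η y * μ (x - fun l => y l / sg n a m l) = ∫ y : RV n, η y * (μ (x + fun l => -(y l / sg n a m l)) - ∑ k ∈ Finset.range R, ((k.factorial : ℝ)⁻¹ : ℂ) * iteratedFDeriv ℝ k μ x (fun _ => fun l => -(y l / sg n a m l))) := by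
    have h5 : ∫ y : RV n, ∑ k ∈ Finset.range R, ((k.factorial : ℝ)⁻¹ : ℂ) * (η y * iteratedFDeriv ℝ k μ x (fun _ => fun l => -(y l / sg n a m l))) = 0 := by
      rw [integral_finset_sum _ hIT2]
      refine Finset.sum_eq_zero fun k hk => ?_
      rw [integral_const_mul, (hIT k hk).2, mul_zero]
    have h6 := integral_sub hI0 (integrable_finset_sum _ hIT2)
    rw [h5, sub_zero] at h6
    rw [← h6]
    refine integral_congr_ae (Filter.Eventually.of_forall fun y => ?_)
    simp only
    rw [e1 y, add_sub_cancel_right]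
  rw [e2]
  refine (norm_integral_le_of_norm_le ((int_w n η (L' + R)).const_mul _) (Filter.Eventually.of_forall hmaj)).trans ?_
  rw [integral_const_mul]
  have e3 : δ ^ R = (2:ℝ) ^ (-((m:ℝ) * (R * a0))) := by
    rw [hδ, ← Real.rpow_natCast, ← Real.rpow_mul (by norm_num)]; congr 1; ring
  have e4 : ((1 + ‖x‖) ^ L')⁻¹ ≤ ((1 + ‖x‖) ^ L)⁻¹ := by
    gcongr
    · linarith [norm_nonneg x]
    · exact le_max_left _ _
  rw [← e3]
  have hI : 0 ≤ ∫ y, (1 + ‖y‖) ^ (L' + R) * ‖η y‖ := by positivity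
  calc _ = C * (∫ y, (1 + ‖y‖) ^ (L' + R) * ‖η y‖) * δ ^ R * ((1 + ‖x‖) ^ L')⁻¹ := by ring
    _ ≤ _ := by gcongr

lemma WW_le (n : ℕ) (a : Fin n → ℝ) (k : ℕ) (z : RV n) : WW n (sg n a k) z ≤ (1 + ‖(fun l => sg n a k l * z l : RV n)‖) ^ n := by
  unfold WW
  calc _ ≤ ∏ l : Fin n, (1 + ‖(fun l => sg n a k l * z l : RV n)‖) := by
        refine Finset.prod_le_prod (fun l _ => by have := sg_pos n a k l; positivity) fun l _ => ?_
        have := norm_le_pi_norm (fun l => sg n a k l * z l : RV n) l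
        simp only [Real.norm_eq_abs, abs_mul, abs_of_pos (sg_pos n a k l)] at this
        linarith
    _ = _ := by simp

/-- main kernel bound -/
lemma kern (n R : ℕ) {a : Fin n → ℝ} (a0 : ℝ) (ha0 : 0 ≤ a0) (ha : ∀ i, a0 ≤ a i) (η0 η μ0 μ : Sc n) (hη : Mom n R η) (N : ℕ) :
    ∃ C : ℝ≥0∞, C ≠ ∞ ∧ ∀ (k m : ℕ) (z : RV n), ‖cvl n (fm n a η0 η (k + m)) (fm n a μ0 μ k) z‖ₑ ≤ C * T2 (-((m:ℝ) * (R * a0))) * (VV n a k * ww n a k z ^ N) := by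
  obtain ⟨C1, h1, hC1⟩ := kern0 n 0 a0 ha0 ha η0 μ0 (fun k hk => absurd hk (Nat.not_lt_zero k)) (n * N)
  obtain ⟨C2, h2, hC2⟩ := kern0 n R a0 ha0 ha η μ0 hη (n * N)
  obtain ⟨C3, h3, hC3⟩ := kern0 n R a0 ha0 ha η μ hη (n * N)
  refine ⟨ENNReal.ofReal (C1 + C2 + C3), ENNReal.ofReal_ne_top, fun k m z => ?_⟩
  have e : cvl n (fm n a η0 η (k + m)) (fm n a μ0 μ k) = dl n a k (cvl n (dl n a m (bs n η0 η (k + m))) (bs n μ0 μ k)) := by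
    unfold fm; rw [dl_dl, cvl_dl]
  rw [e, dl_apply]
  set x : RV n := fun l => sg n a k l * z l with hx
  have hb : ‖cvl n (dl n a m (bs n η0 η (k + m))) (bs n μ0 μ k) x‖ ≤ (C1 + C2 + C3) * (2:ℝ) ^ (-((m:ℝ) * (R * a0))) * ((1 + ‖x‖) ^ (n * N))⁻¹ := by
    have hp : 0 ≤ (2:ℝ) ^ (-((m:ℝ) * (R * a0))) * ((1 + ‖x‖) ^ (n * N))⁻¹ := by positivity
    rcases Nat.eq_zero_or_pos (k + m) with h | h
    · obtain ⟨rfl, rfl⟩ : k = 0 ∧ m = 0 := by omega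
      have := hC1 0 x
      simp only [bs, Nat.add_zero, if_true, Nat.cast_zero, zero_mul, neg_zero, Real.rpow_zero, mul_one] at this ⊢
      refine this.trans ?_
      gcongr; linarith
    · simp only [bs, if_neg h.ne']
      rw [mul_assoc]
      split_ifs
      · have := hC2 m x
        rw [mul_assoc] at this
        exact this.trans (mul_le_mul_of_nonneg_right (by linarith) hp)
      · have := hC3 m x
        rw [mul_assoc] at this
        exact this.trans (mul_le_mul_of_nonneg_right (by linarith) hp)
  have hW := WW_pos n (sg_pos n a k) z
  rw [← ofReal_norm, ww, ← ENNReal.ofReal_pow (inv_nonneg.2 hW.le), VV, ← T2_ofReal, ← T2_ofReal, ← sg_prod, ← ENNReal.ofReal_mul (by positivity),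
    ← ENNReal.ofReal_mul (Finset.prod_nonneg fun l _ => (sg_pos n a k l).le), ← ENNReal.ofReal_mul (by positivity)]
  refine ENNReal.ofReal_le_ofReal ?_
  rw [norm_mul, Complex.norm_real, Real.norm_of_nonneg (VR_pos n a k).le]
  have hV := VR_pos n a k
  have h5 : ((1 + ‖x‖) ^ (n * N))⁻¹ ≤ (WW n (sg n a k) z)⁻¹ ^ N := by
    rw [inv_pow, pow_mul]
    gcongr
    exact WW_le n a k z
  change _ ≤ _ * (VR n a k * _)
  calc _ ≤ VR n a k * ((C1 + C2 + C3) * (2:ℝ) ^ (-((m:ℝ) * (R * a0))) * (WW n (sg n a k) z)⁻¹ ^ N) := by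
        refine mul_le_mul_of_nonneg_left (hb.trans ?_) hV.le
        gcongr
    _ = _ := by ring


lemma cx_tg (n : ℕ) (i : Fin n) : (fun x : RV n => ((x i : ℝ) : ℂ)).HasTemperateGrowth :=
  (Complex.ofRealCLM.comp (ContinuousLinearMap.proj (R := ℝ) (φ := fun _ : Fin n => ℝ) i)).hasTemperateGrowth

def mx (n : ℕ) (i : Fin n) (g : Sc n) : Sc n := (-Complex.I) • SchwartzMap.smulLeftCLM ℂ (fun x : RV n => ((x i : ℝ) : ℂ)) g
lemma mx_apply (n : ℕ) (i : Fin n) (g : Sc n) (x : RV n) : mx n i g x = -Complex.I * x i * g x := by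
  unfold mx
  rw [SchwartzMap.smul_apply, SchwartzMap.smulLeftCLM_apply_apply (cx_tg n i), smul_eq_mul, smul_eq_mul, mul_assoc]

lemma pd_FT (n : ℕ) (i : Fin n) (g : Sc n) : pderiv1 n i (FT n g) = FT n (mx n i g) := by
  funext ξ
  let A : RV n →L[ℝ] En n := (2 * Real.pi)⁻¹ • ((eqv n).symm : RV n →L[ℝ] En n)
  have hA : ∀ ξ, A ξ = WithLp.toLp 2 ((2 * Real.pi)⁻¹ • ξ) := fun ξ => rfl
  set G : SchwartzMap (En n) ℂ := FourierTransform.fourier (toE n g) with hG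
  have e : FT n g = ⇑G ∘ ⇑A := by funext ξ; rw [FT_eq]; rfl
  unfold pderiv1
  rw [e, fderiv_comp _ (G.differentiableAt) A.differentiableAt, ContinuousLinearMap.fderiv]
  have h1 : (fderiv ℝ G (A ξ)) (A (Pi.single i 1)) = (LineDeriv.lineDerivOp (A (Pi.single i 1)) G : SchwartzMap (En n) ℂ) (A ξ) := by
    rw [SchwartzMap.lineDerivOp_apply_eq_fderiv]
  rw [ContinuousLinearMap.comp_apply, h1, hG, SchwartzMap.lineDerivOp_fourier_eq, FT_eq, ← hA]
  congr 2
  ext x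
  have ht : (fun x : En n => inner ℝ x (A (Pi.single i 1))).HasTemperateGrowth := ((innerSL ℝ).flip (A (Pi.single i 1))).hasTemperateGrowth
  rw [toE_apply, mx_apply, SchwartzMap.smul_apply, SchwartzMap.smulLeftCLM_apply_apply ht, toE_apply, hA, PiLp.inner_apply]
  simp only [RCLike.inner_apply, conj_trivial, Pi.smul_apply, smul_eq_mul, Complex.real_smul]
  have h2 : ∑ l, (2 * Real.pi)⁻¹ * (Pi.single i 1 : RV n) l * x.ofLp l = (2 * Real.pi)⁻¹ * x.ofLp i := by
    rw [Finset.sum_eq_single i]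
    · simp
    · intro l _ hl; simp [hl]
    · simp
  rw [h2]
  have hpi : (Real.pi : ℂ) ≠ 0 := by exact_mod_cast Real.pi_ne_zero
  push_cast
  field_simp

lemma pdI_FT (n : ℕ) (i : Fin n) (g : Sc n) (k : ℕ) : ∃ h : Sc n, pderivIter n i k (FT n g) = FT n h ∧ ∀ x, h x = (-Complex.I * x i) ^ k * g x := by
  induction k with
  | zero => exact ⟨g, rfl, fun x => by simp⟩
  | succ k ih =>
    obtain ⟨h, h1, h2⟩ := ih
    refine ⟨mx n i h, ?_, fun x => ?_⟩
    · show pderiv1 n i (pderivIter n i k (FT n g)) = _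
      rw [h1, pd_FT]
    · rw [mx_apply, h2]; ring

lemma pdL_FT (n : ℕ) (α : Fin n → ℕ) (g : Sc n) (l : List (Fin n)) : ∃ h : Sc n, l.foldr (fun i h => pderivIter n i (α i) h) (FT n g) = FT n h ∧
    ∀ x, h x = (l.map fun i => (-Complex.I * x i) ^ (α i)).prod * g x := by
  induction l with
  | nil => exact ⟨g, rfl, fun x => by simp⟩
  | cons i l ih =>
    obtain ⟨h, h1, h2⟩ := ih
    obtain ⟨h', h3, h4⟩ := pdI_FT n i h (α i)
    refine ⟨h', ?_, fun x => ?_⟩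
    · rw [List.foldr_cons, h1, h3]
    · rw [h4, h2, List.map_cons, List.prod_cons, mul_assoc]

lemma mom_of (n : ℕ) (M : ℤ) (g : Sc n) (h : MomentCond n M g) : Mom n (M + 1).toNat g := by
  intro k hk r
  set α : Fin n → ℕ := fun l => (Finset.univ.filter fun i => r i = l).card with hα
  have hsum : ∑ l, α l = k := by
    have := Finset.card_eq_sum_card_fiberwise (f := r) (s := Finset.univ) (t := Finset.univ) (fun _ _ => by simp)
    rw [Finset.card_univ, Fintype.card_fin] at this
    exact this.symm
  have h1 := h α (by
    have : ∑ l, ((α l : ℕ) : ℤ) = ((∑ l, α l : ℕ) : ℤ) := by push_cast; rfl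
    rw [this, hsum]; omega)
  obtain ⟨h', h2, h3⟩ := pdL_FT n α g (List.finRange n)
  unfold Dop at h1
  rw [h2] at h1
  have hI : (-Complex.I) ≠ 0 := neg_ne_zero.2 Complex.I_ne_zero
  have h4 : FT n h' 0 = 0 := (mul_eq_zero.1 h1).resolve_left (pow_ne_zero _ hI)
  have h5 : FT n h' 0 = (-Complex.I) ^ k * ∫ y : RV n, g y * ((∏ i, y (r i) : ℝ) : ℂ) := by
    unfold FT
    rw [← integral_const_mul]
    refine integral_congr_ae (Filter.Eventually.of_forall fun y => ?_)
    simp only [Pi.zero_apply, mul_zero, Finset.sum_const_zero, Complex.ofReal_zero, Complex.exp_zero, one_mul]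
    rw [h3, ← List.ofFn_eq_map, List.prod_ofFn]
    have h6 : ∏ i, y (r i) = ∏ l, y l ^ α l := by
      rw [← Finset.prod_fiberwise_of_maps_to (g := r) (t := Finset.univ) (fun _ _ => Finset.mem_univ _)]
      refine Finset.prod_congr rfl fun l _ => ?_
      rw [Finset.prod_congr rfl (g := fun _ => y l) (fun i hi => by rw [(Finset.mem_filter.1 hi).2]), Finset.prod_const]
    simp only [mul_pow]
    rw [Finset.prod_mul_distrib, Finset.prod_pow_eq_pow_sum, hsum, h6]
    push_cast
    ring
  rw [h5] at h4
  exact (mul_eq_zero.1 h4).resolve_left (pow_ne_zero _ hI)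

lemma mom_loc (n : ℕ) (g : Sc n) (h : FT n g =ᶠ[nhds 0] 0) (M : ℤ) : MomentCond n M g := by
  have h1 : ∀ (i : Fin n) (F : RV n → ℂ), F =ᶠ[nhds 0] 0 → pderiv1 n i F =ᶠ[nhds 0] 0 := by
    intro i F hF
    filter_upwards [hF.fderiv (𝕜 := ℝ)] with x hx
    unfold pderiv1
    rw [hx]; simp
  have h2 : ∀ (i : Fin n) (k : ℕ) (F : RV n → ℂ), F =ᶠ[nhds 0] 0 → pderivIter n i k F =ᶠ[nhds 0] 0 := by
    intro i k F hF
    induction k with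
    | zero => exact hF
    | succ k ih => exact h1 i _ ih
  intro α _
  have h3 : ∀ l : List (Fin n), l.foldr (fun i h => pderivIter n i (α i) h) (FT n g) =ᶠ[nhds 0] 0 := by
    intro l
    induction l with
    | nil => exact h
    | cons i l ih => exact h2 i (α i) _ ih
  unfold Dop
  rw [(h3 _).eq_of_nhds]; simp

lemma FT_smooth (n : ℕ) (g : Sc n) : ContDiff ℝ ((⊤ : ℕ∞) : WithTop ℕ∞) (FT n g) := by
  let A : RV n →L[ℝ] En n := (2 * Real.pi)⁻¹ • ((eqv n).symm : RV n →L[ℝ] En n)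
  have e : FT n g = ⇑(FourierTransform.fourier (toE n g) : SchwartzMap (En n) ℂ) ∘ ⇑A := by funext ξ; rw [FT_eq]; rfl
  rw [e]
  exact (SchwartzMap.smooth _ ⊤).comp A.contDiff


lemma FT_add (n : ℕ) (g h : Sc n) (ξ : RV n) : FT n (g + h : Sc n) ξ = FT n g ξ + FT n h ξ := by
  rw [FT_eq, FT_eq, FT_eq, map_add, FourierTransform.fourier_add]; rfl

def NN (n : ℕ) (a : Fin n → ℝ) (t : ℝ) (ξ : RV n) : ℝ := ∑ i, ξ i ^ 2 / t ^ (2 * a i)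

lemma NN_smooth (n : ℕ) (a : Fin n → ℝ) (t : ℝ) : ContDiff ℝ ((⊤ : ℕ∞) : WithTop ℕ∞) (NN n a t) := by
  unfold NN; fun_prop

lemma NN_mono (n : ℕ) {a : Fin n → ℝ} (ha : ∀ i, 1 ≤ a i) {s t : ℝ} (hs : 0 < s) (hst : s ≤ t) (ξ : RV n) : NN n a t ξ ≤ NN n a s ξ := by
  unfold NN
  refine Finset.sum_le_sum fun i _ => ?_
  have h1 : s ^ (2 * a i) ≤ t ^ (2 * a i) := Real.rpow_le_rpow hs.le hst (by linarith [ha i])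
  have h2 : 0 < s ^ (2 * a i) := by positivity
  gcongr

lemma NN_dil (n : ℕ) {a : Fin n → ℝ} (ha : ∀ i, 1 ≤ a i) {t : ℝ} (ht : 0 < t) (ξ : RV n) : NN n a t (fun l => sg n a 1 l * ξ l) = NN n a (t / 2) ξ := by
  unfold NN
  refine Finset.sum_congr rfl fun i _ => ?_
  rw [Real.div_rpow ht.le (by norm_num)]
  have : (2:ℝ) ^ (2 * a i) = sg n a 1 i ^ 2 := by
    unfold sg; rw [← Real.rpow_natCast, ← Real.rpow_mul (by norm_num)]; congr 1; push_cast; ring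
  rw [this, mul_pow, div_div_eq_mul_div]
  ring

lemma NN_half (n : ℕ) {a : Fin n → ℝ} (ha : ∀ i, 1 ≤ a i) {t : ℝ} (ht : 0 < t) (ξ : RV n) : 4 * NN n a t ξ ≤ NN n a (t / 2) ξ := by
  unfold NN
  rw [Finset.mul_sum]
  refine Finset.sum_le_sum fun i _ => ?_
  rw [Real.div_rpow ht.le (by norm_num), div_div_eq_mul_div]
  have h4 : (4:ℝ) ≤ 2 ^ (2 * a i) := by
    calc (4:ℝ) = 2 ^ (2:ℝ) := by norm_num
      _ ≤ _ := Real.rpow_le_rpow_of_exponent_le (by norm_num) (by linarith [ha i])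
  have h2 : 0 < t ^ (2 * a i) := by positivity
  rw [← mul_div_assoc]
  exact div_le_div_of_nonneg_right (by nlinarith [sq_nonneg (ξ i)]) h2.le

lemma NN_an1 (n : ℕ) {a : Fin n → ℝ} (ha : ∀ i, 1 ≤ a i) {anorm : RV n → ℝ} (h : IsAnorm n a anorm) {t : ℝ} (ht : 0 < t) (ξ : RV n) (hN : NN n a t ξ < 1) : anorm ξ < t := by
  by_cases h0 : ξ = 0
  · rw [h0, h.1]; exact ht
  · by_contra hc
    have := NN_mono n ha ht (not_lt.1 hc) ξ
    have e : NN n a (anorm ξ) ξ = 1 := (h.2 ξ h0).2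
    linarith

lemma NN_an2 (n : ℕ) {a : Fin n → ℝ} (ha : ∀ i, 1 ≤ a i) {anorm : RV n → ℝ} (h : IsAnorm n a anorm) {t : ℝ} (ht : 0 < t) (ξ : RV n) (hN : 1 < NN n a t ξ) : t < anorm ξ := by
  have h0 : ξ ≠ 0 := by rintro rfl; simp [NN] at hN; linarith
  by_contra hc
  have := NN_mono n ha (h.2 ξ h0).1 (not_lt.1 hc) ξ
  have e : NN n a (anorm ξ) ξ = 1 := (h.2 ξ h0).2
  linarith

def chi (u : ℝ) : ℝ := Real.smoothTransition (3 - 4 * u)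
lemma chi_one {u : ℝ} (h : u ≤ 1 / 2) : chi u = 1 := Real.smoothTransition.one_of_one_le (by linarith)
lemma chi_zero {u : ℝ} (h : 3 / 4 ≤ u) : chi u = 0 := Real.smoothTransition.zero_of_nonpos (by linarith)
def Th (n : ℕ) (a : Fin n → ℝ) (t : ℝ) (ξ : RV n) : ℂ := ((chi (NN n a t ξ) : ℝ) : ℂ)

lemma Th_smooth (n : ℕ) (a : Fin n → ℝ) (t : ℝ) : ContDiff ℝ ((⊤ : ℕ∞) : WithTop ℕ∞) (Th n a t) := by
  have h1 : ContDiff ℝ ((⊤ : ℕ∞) : WithTop ℕ∞) chi := Real.smoothTransition.contDiff.comp (by fun_prop)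
  exact Complex.ofRealCLM.contDiff.comp (h1.comp (NN_smooth n a t))

lemma NN_cpt (n : ℕ) (a : Fin n → ℝ) {t : ℝ} (ht : 0 < t) : ∃ B, ∀ ξ, NN n a t ξ < 3 / 4 → ‖ξ‖ ≤ B := by
  refine ⟨∑ i, t ^ (2 * a i) + 1, fun ξ hN => ?_⟩
  have hS : ∀ i, t ^ (2 * a i) ≤ ∑ i, t ^ (2 * a i) := fun i => Finset.single_le_sum (f := fun i => t ^ (2 * a i)) (fun i _ => by positivity) (Finset.mem_univ i)
  have hS0 : 0 ≤ ∑ i, t ^ (2 * a i) := Finset.sum_nonneg fun i _ => by positivity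
  refine (pi_norm_le_iff_of_nonneg (by linarith)).2 fun i => ?_
  have h1 : ξ i ^ 2 / t ^ (2 * a i) ≤ NN n a t ξ := Finset.single_le_sum (f := fun i => ξ i ^ 2 / t ^ (2 * a i)) (fun i _ => by positivity) (Finset.mem_univ i)
  have h2 : ξ i ^ 2 / t ^ (2 * a i) ≤ 1 := by linarith
  rw [div_le_one (by positivity)] at h2
  rw [Real.norm_eq_abs]
  refine abs_le_of_sq_le_sq ?_ (by linarith)
  nlinarith [hS i]

lemma mkS (n : ℕ) (F : RV n → ℂ) (hF : ContDiff ℝ ((⊤ : ℕ∞) : WithTop ℕ∞) F) (B : ℝ) (hB : ∀ ξ, F ξ ≠ 0 → ‖ξ‖ ≤ B) : ∃ g : Sc n, ∀ ξ, FT n g ξ = F ξ := by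
  have hc : HasCompactSupport F := HasCompactSupport.intro (isCompact_closedBall (0 : RV n) B) fun x hx => by
    by_contra h; exact hx (by simpa using hB x h)
  obtain ⟨g, hg⟩ := FT_surj n (hc.toSchwartzMap hF)
  exact ⟨g, hg⟩

lemma calderon (n : ℕ) {a : Fin n → ℝ} (ha : ∀ i, 1 ≤ a i) {anorm : RV n → ℝ} (h : IsAnorm n a anorm) (φ0 φ : Sc n) {ε : ℝ} (hε : 0 < ε)
    (hT : Tauber n anorm φ0 φ ε) : ∃ θ l0 l : Sc n, FT n θ 0 = 1 ∧ (FT n l =ᶠ[nhds 0] 0) ∧ θ = cvl n l0 φ0 ∧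
      ∀ k : ℕ, dl n a (k + 1) θ = dl n a k θ + cvl n (fm n a l0 l (k + 1)) (fm n a φ0 φ (k + 1)) := by
  set t := 2 * ε with ht
  have ht0 : 0 < t := by positivity
  obtain ⟨B, hB⟩ := NN_cpt n a ht0
  set N := NN n a t with hN
  set N' := NN n a (t / 2) with hN'
  have hNN : ∀ ξ, 4 * N ξ ≤ N' ξ := NN_half n ha ht0
  have hN0 : ∀ ξ, 0 ≤ N ξ := fun ξ => Finset.sum_nonneg fun i _ => by positivity
  have hNc : Continuous N := (NN_smooth n a t).continuous
  have hNc' : Continuous N' := (NN_smooth n a (t / 2)).continuous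
  have hT0 : ∀ ξ, 3 / 4 ≤ N ξ → Th n a t ξ = 0 := fun ξ hξ => by unfold Th; rw [chi_zero hξ]; simp
  have hT1 : ∀ ξ, N ξ ≤ 1 / 2 → Th n a t ξ = 1 := fun ξ hξ => by unfold Th; rw [chi_one hξ]; simp
  have hT0' : ∀ ξ, 3 / 4 ≤ N' ξ → Th n a (t / 2) ξ = 0 := fun ξ hξ => by unfold Th; rw [chi_zero hξ]; simp
  have hT1' : ∀ ξ, N' ξ ≤ 1 / 2 → Th n a (t / 2) ξ = 1 := fun ξ hξ => by unfold Th; rw [chi_one hξ]; simp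
  set D : RV n → ℂ := fun ξ => Th n a t ξ - Th n a (t / 2) ξ with hD
  have hDs : ContDiff ℝ ((⊤ : ℕ∞) : WithTop ℕ∞) D := (Th_smooth n a t).sub (Th_smooth n a (t / 2))
  have hDa : ∀ ξ, 3 / 4 ≤ N ξ → D ξ = 0 := fun ξ hξ => by
    simp only [hD]; rw [hT0 ξ hξ, hT0' ξ (by linarith [hNN ξ, hN0 ξ])]; simp
  have hDb : ∀ ξ, N' ξ ≤ 1 / 2 → D ξ = 0 := fun ξ hξ => by
    simp only [hD]; rw [hT1' ξ hξ, hT1 ξ (by linarith [hNN ξ, hN0 ξ])]; simp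
  have hφ0 : ∀ ξ, N ξ < 1 → FT n φ0 ξ ≠ 0 := fun ξ hξ => norm_pos_iff.1 (hT.1 ξ (NN_an1 n ha h ht0 ξ hξ))
  have hφ : ∀ ξ, N ξ < 1 → 1 / 4 < N' ξ → FT n φ ξ ≠ 0 := fun ξ hξ hξ' => by
    refine norm_pos_iff.1 (hT.2 ξ ?_ (NN_an1 n ha h ht0 ξ hξ))
    refine NN_an2 n ha h (by positivity) ξ ?_
    have h1 := NN_half n ha (t := ε) hε ξ
    have h2 : N' ξ = NN n a ε ξ := by rw [hN', ht]; congr 1; ring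
    linarith
  have s0 : ContDiff ℝ ((⊤ : ℕ∞) : WithTop ℕ∞) (fun ξ => Th n a t ξ / FT n φ0 ξ) := by
    rw [contDiff_iff_contDiffAt]
    intro ξ
    rcases lt_or_ge (N ξ) 1 with h1 | h1
    · simp only [div_eq_mul_inv]; exact ((Th_smooth n a t).contDiffAt).mul (((FT_smooth n φ0).contDiffAt).inv (hφ0 ξ h1))
    · refine (contDiffAt_const (c := (0:ℂ))).congr_of_eventuallyEq ?_
      have : ∀ᶠ η in nhds ξ, 3 / 4 < N η := hNc.continuousAt.eventually (lt_mem_nhds (by linarith))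
      filter_upwards [this] with η hη
      rw [hT0 η hη.le, zero_div]
  have s1 : ContDiff ℝ ((⊤ : ℕ∞) : WithTop ℕ∞) (fun ξ => D ξ / FT n φ ξ) := by
    rw [contDiff_iff_contDiffAt]
    intro ξ
    rcases lt_or_ge (N ξ) 1 with h1 | h1
    · rcases lt_or_ge (1 / 4) (N' ξ) with h2 | h2
      · simp only [div_eq_mul_inv]; exact (hDs.contDiffAt).mul (((FT_smooth n φ).contDiffAt).inv (hφ ξ h1 h2))
      · refine (contDiffAt_const (c := (0:ℂ))).congr_of_eventuallyEq ?_
        have : ∀ᶠ η in nhds ξ, N' η < 1 / 2 := hNc'.continuousAt.eventually (gt_mem_nhds (by linarith))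
        filter_upwards [this] with η hη
        rw [hDb η hη.le, zero_div]
    · refine (contDiffAt_const (c := (0:ℂ))).congr_of_eventuallyEq ?_
      have : ∀ᶠ η in nhds ξ, 3 / 4 < N η := hNc.continuousAt.eventually (lt_mem_nhds (by linarith))
      filter_upwards [this] with η hη
      rw [hDa η hη.le, zero_div]
  obtain ⟨θ, hθ⟩ := mkS n (Th n a t) (Th_smooth n a t) B fun ξ hξ => hB ξ (not_le.1 fun hc => hξ (hT0 ξ hc))
  obtain ⟨l0, hl0⟩ := mkS n _ s0 B fun ξ hξ => hB ξ (not_le.1 fun hc => hξ (by simp only [hT0 ξ hc, zero_div]))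
  obtain ⟨l, hl⟩ := mkS n _ s1 B fun ξ hξ => hB ξ (not_le.1 fun hc => hξ (by simp only [hDa ξ hc, zero_div]))
  have hz : N 0 = 0 := by simp [hN, NN]
  have hz' : N' 0 = 0 := by simp [hN', NN]
  refine ⟨θ, l0, l, ?_, ?_, ?_, fun k => ?_⟩
  · rw [hθ, hT1]; rw [hz]; norm_num
  · have : ∀ᶠ η in nhds (0 : RV n), N' η < 1 / 2 := hNc'.continuousAt.eventually (gt_mem_nhds (by rw [hz']; norm_num))
    filter_upwards [this] with η hη
    rw [hl, hDb η hη.le, zero_div]; rfl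
  · refine FT_inj n fun ξ => ?_
    rw [FT_cvl, hθ, hl0]
    rcases lt_or_ge (N ξ) 1 with h1 | h1
    · rw [div_mul_cancel₀ _ (hφ0 ξ h1)]
    · rw [hT0 ξ (by linarith)]; simp
  · refine FT_inj n fun ξ => ?_
    unfold fm bs
    simp only [if_neg (Nat.succ_ne_zero k)]
    rw [FT_add, FT_cvl, FT_dl, FT_dl, FT_dl, FT_dl, hθ, hθ, hl]
    set η : RV n := fun l => ξ l / sg n a (k + 1) l with hη
    have e1 : (fun l => ξ l / sg n a k l) = fun l => sg n a 1 l * η l := by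
      funext i
      have := (sg_pos n a k i).ne'; have := (sg_pos n a 1 i).ne'
      rw [hη]; simp only []; rw [sg_add]; field_simp
    have e2 : Th n a t (fun l => sg n a 1 l * η l) = Th n a (t / 2) η := by unfold Th; rw [NN_dil n ha ht0]
    rw [e1, e2]
    have e3 : D η / FT n φ η * FT n φ η = D η := by
      rcases lt_or_ge (N η) 1 with h1 | h1
      · rcases lt_or_ge (1 / 4) (N' η) with h2 | h2
        · rw [div_mul_cancel₀ _ (hφ η h1 h2)]
        · rw [hDb η (by linarith)]; simp
      · rw [hDa η (by linarith)]; simp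
    rw [e3]; simp only [hD]; ring


lemma cvl_le (n : ℕ) (f : TD n) (κ g : Sc n) (y : RV n) :
    ‖f (RS n y (cvl n κ g))‖ₑ ≤ ∫⁻ z, ‖κ (y - z)‖ₑ * ‖f (RS n z g)‖ₑ := by
  rw [conv_int]
  refine (enorm_integral_le_lintegral_enorm _).trans ?_
  rw [← lintegral_sub_left_eq_self (fun z => ‖κ z * f (RS n (y - z) g)‖ₑ) y]
  refine lintegral_mono fun z => ?_
  simp only [enorm_mul, sub_sub_cancel]
  exact le_rfl

lemma sg_ge (n : ℕ) {a : Fin n → ℝ} (ha : ∀ i, 1 ≤ a i) (K : ℕ) (l : Fin n) : (K : ℝ) ≤ sg n a K l := by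
  unfold sg
  have h1 : (2:ℝ) ^ (K:ℝ) ≤ 2 ^ ((K:ℝ) * a l) := Real.rpow_le_rpow_of_exponent_le (by norm_num) (by nlinarith [ha l, (Nat.cast_nonneg K : (0:ℝ) ≤ K)])
  rw [Real.rpow_natCast] at h1
  refine le_trans ?_ h1
  exact_mod_cast (Nat.lt_two_pow_self (n := K)).le

lemma dl_lim (n : ℕ) {a : Fin n → ℝ} (ha : ∀ i, 1 ≤ a i) (f : TD n) (θ g : Sc n) (hθ : FT n θ 0 = 1) (y : RV n) :
    Filter.Tendsto (fun K : ℕ => f (RS n y (cvl n (dl n a K θ) g))) Filter.atTop (nhds (f (RS n y g))) := by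
  have e : ∀ K : ℕ, f (RS n y (cvl n (dl n a K θ) g)) = ∫ z, θ z * f (RS n (y - (fun l => z l / sg n a K l)) g) := fun K => by
    rw [conv_int, dl_int n a K θ (fun z => f (RS n (y - z) g))]
  simp only [e]
  have h1 : ∫ z, θ z = 1 := by
    rw [← hθ]; unfold FT; simp
  have h2 : f (RS n y g) = ∫ z, θ z * f (RS n y g) := by
    rw [integral_mul_const, h1, one_mul]
  rw [h2]
  obtain ⟨N, C, hC0, hC⟩ := Fpoly n f g
  have hFc := Fcont n f g
  refine tendsto_integral_of_dominated_convergence (fun z => (C * (1 + ‖y‖) ^ N) * ((1 + ‖z‖) ^ N * ‖θ z‖)) (fun K => ?_) ((int_w n θ N).const_mul _) (fun K => ?_) ?_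
  · refine Continuous.aestronglyMeasurable (θ.continuous.mul (hFc.comp (continuous_const.sub ?_)))
    exact continuous_pi fun l => (continuous_apply l).div_const _
  · refine Filter.Eventually.of_forall fun z => ?_
    rw [norm_mul]
    have h3 : ‖(fun l => z l / sg n a K l : RV n)‖ ≤ ‖z‖ := by
      refine (pi_norm_le_iff_of_nonneg (norm_nonneg _)).2 fun l => ?_
      have := sg_one n ha K l
      rw [norm_div, Real.norm_of_nonneg (by linarith : 0 ≤ sg n a K l)]
      exact (div_le_self (norm_nonneg _) this).trans (norm_le_pi_norm z l)
    have h4 : 1 + ‖y - (fun l => z l / sg n a K l : RV n)‖ ≤ (1 + ‖y‖) * (1 + ‖z‖) := by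
      have := norm_sub_le y (fun l => z l / sg n a K l : RV n)
      nlinarith [norm_nonneg y, norm_nonneg z]
    calc ‖θ z‖ * _ ≤ ‖θ z‖ * (C * ((1 + ‖y‖) * (1 + ‖z‖)) ^ N) := by
          refine mul_le_mul_of_nonneg_left ((hC _).trans ?_) (norm_nonneg _)
          exact mul_le_mul_of_nonneg_left (pow_le_pow_left₀ (by positivity) h4 N) hC0
      _ = _ := by rw [mul_pow]; ring
  · refine Filter.Eventually.of_forall fun z => ?_
    refine Filter.Tendsto.const_mul _ ?_
    have h5 : Filter.Tendsto (fun K : ℕ => y - (fun l => z l / sg n a K l : RV n)) Filter.atTop (nhds y) := by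
      have h6 : Filter.Tendsto (fun K : ℕ => (fun l => z l / sg n a K l : RV n)) Filter.atTop (nhds 0) := by
        refine tendsto_pi_nhds.2 fun l => ?_
        have h7 : Filter.Tendsto (fun K : ℕ => sg n a K l) Filter.atTop Filter.atTop :=
          Filter.tendsto_atTop_mono (fun K => sg_ge n ha K l) tendsto_natCast_atTop_atTop
        exact h7.const_div_atTop (z l)
      simpa using h6.const_sub y
    exact (hFc.tendsto y).comp h5

lemma cvl_step (n : ℕ) {a : Fin n → ℝ} {φ0 φ θ l0 l : Sc n}
    (h4 : ∀ k : ℕ, dl n a (k + 1) θ = dl n a k θ + cvl n (fm n a l0 l (k + 1)) (fm n a φ0 φ (k + 1))) (f : TD n) (g : Sc n) (y : RV n) (k : ℕ) :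
    f (RS n y (cvl n (dl n a (k + 1) θ) g)) = f (RS n y (cvl n (dl n a k θ) g)) + f (RS n y (cvl n (cvl n (fm n a l0 l (k + 1)) g) (fm n a φ0 φ (k + 1)))) := by
  rw [← map_add, ← map_add]
  congr 2
  refine FT_inj n fun ξ => ?_
  rw [FT_add, FT_cvl, FT_cvl, FT_cvl, FT_cvl, h4, FT_add, FT_cvl]; ring

lemma rep_b (n : ℕ) {a : Fin n → ℝ} (ha : ∀ i, 1 ≤ a i) {φ0 φ θ l0 l : Sc n} (h1 : FT n θ 0 = 1)
    (h4 : ∀ k : ℕ, dl n a (k + 1) θ = dl n a k θ + cvl n (fm n a l0 l (k + 1)) (fm n a φ0 φ (k + 1))) (f : TD n) (g : Sc n) (y : RV n) (j : ℕ) :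
    ‖f (RS n y g)‖ₑ ≤ ‖f (RS n y (cvl n (dl n a j θ) g))‖ₑ +
      ∑' i : ℕ, ∫⁻ z, ‖cvl n (fm n a l0 l (j + (i + 1))) g (y - z)‖ₑ * ‖f (RS n z (fm n a φ0 φ (j + (i + 1))))‖ₑ := by
  have hp : ∀ m : ℕ, ‖f (RS n y (cvl n (dl n a (j + m) θ) g))‖ₑ ≤ ‖f (RS n y (cvl n (dl n a j θ) g))‖ₑ +
      ∑ i ∈ Finset.range m, ∫⁻ z, ‖cvl n (fm n a l0 l (j + (i + 1))) g (y - z)‖ₑ * ‖f (RS n z (fm n a φ0 φ (j + (i + 1))))‖ₑ := fun m => by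
    induction m with
    | zero => simp
    | succ m ih =>
      rw [Finset.sum_range_succ, ← add_assoc j m 1, cvl_step n h4, ← add_assoc]
      exact (enorm_add_le _ _).trans (add_le_add ih (cvl_le n f _ _ y))
  have hl := (dl_lim n ha f θ g h1 y).comp (Filter.tendsto_add_atTop_nat j)
  refine le_of_tendsto hl.enorm (Filter.Eventually.of_forall fun m => ?_)
  have := hp m
  rw [add_comm j m] at this
  exact this.trans (add_le_add le_rfl (ENNReal.sum_le_tsum _))

lemma rep_a (n : ℕ) {a : Fin n → ℝ} (ha : ∀ i, 1 ≤ a i) {φ0 φ θ l0 l : Sc n} (h1 : FT n θ 0 = 1) (h3 : θ = cvl n l0 φ0)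
    (h4 : ∀ k : ℕ, dl n a (k + 1) θ = dl n a k θ + cvl n (fm n a l0 l (k + 1)) (fm n a φ0 φ (k + 1))) (f : TD n) (g : Sc n) (y : RV n) :
    ‖f (RS n y g)‖ₑ ≤ 
      ∑' i : ℕ, ∫⁻ z, ‖cvl n (fm n a l0 l i) g (y - z)‖ₑ * ‖f (RS n z (fm n a φ0 φ i))‖ₑ := by
  refine (rep_b n ha h1 h4 f g y 0).trans ?_
  conv_rhs => rw [tsum_eq_zero_add' ENNReal.summable]
  simp only [zero_add]
  refine add_le_add ?_ le_rfl
  have e : cvl n (dl n a 0 θ) g = cvl n (cvl n (fm n a l0 l 0) g) (fm n a φ0 φ 0) := by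
    unfold fm bs; simp only [if_true, dl_zero, h3]
    refine FT_inj n fun ξ => ?_
    simp only [FT_cvl]; ring
  rw [e]
  exact cvl_le n f _ _ y


lemma kernUp (n : ℕ) {a : Fin n → ℝ} (ha : ∀ i, 1 ≤ a i) (l0 l μ0 μ : Sc n) (hl : FT n l =ᶠ[nhds 0] 0) (A : ℝ) (N : ℕ) :
    ∃ C : ℝ≥0∞, C ≠ ∞ ∧ ∀ (k m : ℕ) (z : RV n), ‖cvl n (fm n a l0 l (k + m)) (fm n a μ0 μ k) z‖ₑ ≤
      C * T2 (-((m:ℝ) * A)) * (VV n a (k + m) * ww n a (k + m) z ^ N) := by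
  set b := ∑ i, a i with hb
  have hw := wtC n ha
  set R : ℕ := ⌈A + N * b⌉₊ with hR
  have hRle : A + N * b ≤ R := Nat.le_ceil _
  have hm : Mom n R l := by
    have := mom_of n ((R:ℤ) - 1) l (mom_loc n l hl _)
    simpa using this
  obtain ⟨C, hC, h⟩ := kern n R 1 zero_le_one ha l0 l μ0 μ hm N
  refine ⟨C, hC, fun k m z => (h k m z).trans ?_⟩
  have h1 : VV n a k ≤ VV n a (k + m) := by
    unfold VV; refine T2_mono ?_
    have := hw.hb
    push_cast
    nlinarith [(Nat.cast_nonneg m : (0:ℝ) ≤ m), hw.hb]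
  have h2 : ww n a k z ≤ T2 (m * b) * ww n a (k + m) z := by
    have := hw.tri k m z 0 0
    simpa [hw.one] using this
  have h3 : ww n a k z ^ N ≤ T2 (N * (m * b)) * ww n a (k + m) z ^ N := by
    rw [← T2_pow, ← mul_pow]; exact pow_le_pow_left' h2 N
  calc C * T2 (-((m:ℝ) * (R * 1))) * (VV n a k * ww n a k z ^ N)
      ≤ C * T2 (-((m:ℝ) * (R * 1))) * (VV n a (k + m) * (T2 (N * (m * b)) * ww n a (k + m) z ^ N)) :=
        mul_le_mul' le_rfl (mul_le_mul' h1 h3)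
    _ = C * T2 (-((m:ℝ) * (R * 1)) + N * (m * b)) * (VV n a (k + m) * ww n a (k + m) z ^ N) := by rw [T2_add]; ring
    _ ≤ _ := by
        refine mul_le_mul' (mul_le_mul' le_rfl (T2_mono ?_)) le_rfl
        nlinarith [(Nat.cast_nonneg m : (0:ℝ) ≤ m)]

lemma int_pull (n : ℕ) {K : RV n → ℂ} {D v : ℝ≥0∞} (hD : D ≠ ∞) {w : RV n → ℝ≥0∞} {N : ℕ} {H : RV n → ℝ≥0∞} (y : RV n)
    (h : ∀ z, ‖K z‖ₑ ≤ D * (v * w z ^ N)) : ∫⁻ z, ‖K (y - z)‖ₑ * H z ≤ D * ∫⁻ z, v * (w (y - z) ^ N * H z) := by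
  rw [← lintegral_const_mul' _ _ hD]
  refine lintegral_mono fun z => ?_
  calc _ ≤ D * (v * w (y - z) ^ N) * H z := mul_le_mul' (h _) le_rfl
    _ = _ := by ring

lemma i1 (n : ℕ) {a : Fin n → ℝ} (ha : ∀ i, 1 ≤ a i) {φ0 φ θ l0 l : Sc n} (h1 : FT n θ 0 = 1) (hl : FT n l =ᶠ[nhds 0] 0) (h3 : θ = cvl n l0 φ0)
    (h4 : ∀ k : ℕ, dl n a (k + 1) θ = dl n a k θ + cvl n (fm n a l0 l (k + 1)) (fm n a φ0 φ (k + 1))) (A : ℝ) (N : ℕ) :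
    ∃ C : ℝ≥0∞, C ≠ ∞ ∧ ∀ f : TD n, I1 (VV n a) (ww n a) A N C (fun k x => ‖f (RS n x (fm n a φ0 φ k))‖ₑ) := by
  obtain ⟨C1, hC1, k1⟩ := kernUp n ha l0 l φ0 φ hl A N
  obtain ⟨C2, hC2, k2⟩ := kern n 0 1 zero_le_one ha l0 l0 φ0 φ0 (fun k hk => absurd hk (Nat.not_lt_zero k)) N
  refine ⟨C1 + C2, ENNReal.add_ne_top.2 ⟨hC1, hC2⟩, fun f j y => ?_⟩
  refine (rep_b n ha h1 h4 f (fm n a φ0 φ j) y j).trans ?_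
  rw [← ENNReal.tsum_mul_left]
  conv_rhs => rw [tsum_eq_zero_add' ENNReal.summable]
  refine add_le_add ?_ (ENNReal.tsum_le_tsum fun i => ?_)
  · refine (cvl_le n f _ _ y).trans ?_
    have e : dl n a j θ = cvl n (fm n a l0 l0 (j + 0)) (fm n a φ0 φ0 j) := by
      unfold fm bs; simp only [ite_self, add_zero]; rw [cvl_dl, h3]
    rw [e]
    have k3 : ∀ z, ‖cvl n (fm n a l0 l0 (j + 0)) (fm n a φ0 φ0 j) z‖ₑ ≤ C2 * (VV n a j * ww n a j z ^ N) := fun z => by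
      have := k2 j 0 z
      simpa [T2_zero] using this
    refine (int_pull n hC2 y k3).trans ?_
    simp only [Nat.cast_zero, zero_mul, neg_zero, T2_zero, one_mul, add_zero]
    exact mul_le_mul' le_add_self le_rfl
  · refine (int_pull n (ENNReal.mul_ne_top hC1 (T2_ne_top _)) y (k1 j (i + 1))).trans ?_
    rw [mul_assoc]
    exact mul_le_mul' le_self_add le_rfl

lemma i2 (n : ℕ) (hn : 1 ≤ n) {a : Fin n → ℝ} (ha : ∀ i, 1 ≤ a i) {φ0 φ θ l0 l ψ0 ψ : Sc n} (h1 : FT n θ 0 = 1) (hl : FT n l =ᶠ[nhds 0] 0) (h3 : θ = cvl n l0 φ0)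
    (h4 : ∀ k : ℕ, dl n a (k + 1) θ = dl n a k θ + cvl n (fm n a l0 l (k + 1)) (fm n a φ0 φ (k + 1)))
    (M : ℤ) (hM : -1 ≤ M) (hmom : MomentCond n M ψ) (A : ℝ) (N : ℕ) :
    ∃ C : ℝ≥0∞, C ≠ ∞ ∧ ∀ f : TD n, ∀ (j : ℕ) y, ‖f (RS n y (fm n a ψ0 ψ j))‖ₑ ≤
      C * ∑' k : ℕ, cc (((M:ℝ) + 1) * ⨅ i, a i) A j k * ∫⁻ z, VV n a k * (ww n a k (y - z) ^ N * ‖f (RS n z (fm n a φ0 φ k))‖ₑ) := by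
  haveI : Nonempty (Fin n) := ⟨⟨0, hn⟩⟩
  have hi : ∀ i, ⨅ i, a i ≤ a i := fun i => ciInf_le (Set.finite_range a).bddBelow i
  have hi0 : 0 ≤ ⨅ i, a i := le_ciInf fun i => by linarith [ha i]
  obtain ⟨C1, hC1, k1⟩ := kernUp n ha l0 l ψ0 ψ hl A N
  obtain ⟨C2, hC2, k2⟩ := kern n (M + 1).toNat _ hi0 hi ψ0 ψ l0 l (mom_of n M ψ hmom) N
  have hR : (((M + 1).toNat : ℕ) : ℝ) = (M:ℝ) + 1 := by
    have : (((M + 1).toNat : ℕ) : ℤ) = M + 1 := Int.toNat_of_nonneg (by omega)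
    exact_mod_cast this
  rw [hR] at k2
  refine ⟨C1 + C2, ENNReal.add_ne_top.2 ⟨hC1, hC2⟩, fun f j y => ?_⟩
  refine (rep_a n ha h1 h3 h4 f (fm n a ψ0 ψ j) y).trans ?_
  rw [← ENNReal.tsum_mul_left]
  refine ENNReal.tsum_le_tsum fun k => ?_
  unfold cc
  split_ifs with hk
  · obtain ⟨m, rfl⟩ := Nat.exists_eq_add_of_le hk
    have k3 := k2 k m
    rw [cvl_comm] at k3
    refine (int_pull n (ENNReal.mul_ne_top hC2 (T2_ne_top _)) y k3).trans ?_
    rw [mul_assoc]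
    refine mul_le_mul' le_add_self (mul_le_mul' (T2_mono ?_) le_rfl)
    push_cast; apply le_of_eq; ring
  · obtain ⟨m, rfl⟩ := Nat.exists_eq_add_of_le (not_le.1 hk).le
    refine (int_pull n (ENNReal.mul_ne_top hC1 (T2_ne_top _)) y (k1 j m)).trans ?_
    rw [mul_assoc]
    refine mul_le_mul' le_self_add (mul_le_mul' (T2_mono ?_) le_rfl)
    push_cast; apply le_of_eq; ring

lemma mainLem (n : ℕ) (hn : 1 ≤ n) (a : Fin n → ℝ) (ha : ∀ i, 1 ≤ a i)
    (anorm : RV n → ℝ) (h : IsAnorm n a anorm)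
    (conv : TD n → (RV n → ℂ) → RV n → ℂ)
    (hconv : ∀ (f : TD n) (g : RV n → ℂ) (x : RV n) (Ψ : SchwartzMap (RV n) ℂ),
      (∀ y, Ψ y = g (x - y)) → conv f g x = f Ψ)
    (ψ0 ψ φ0 φ : SchwartzMap (RV n) ℂ)
    (εφ : ℝ) (hεφ : 0 < εφ)
    (hTφ : Tauber n anorm (⇑φ0) (⇑φ) εφ)
    (Mψ : ℤ) (hMψ : -1 ≤ Mψ) (hmomψ : MomentCond n Mψ (⇑ψ))
    (p : Fin n → ℝ≥0∞) (hp : ∀ i, 0 < p i ∧ p i ≠ ∞) (q : ℝ≥0∞) (hq : 0 < q)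
    (s : ℝ) (hs : s < ((Mψ:ℝ) + 1) * ⨅ i, a i) :
    ∃ c : ℝ, 0 < c ∧
      ∀ f : TD n,
        seqNorm n p q
            (fun j x => ENNReal.ofReal ((2:ℝ) ^ ((j:ℝ) * s)) *
              (‖conv f (fam n a (⇑ψ0) (⇑ψ) j) x‖₊ : ℝ≥0∞))
          ≤ ENNReal.ofReal c *
            seqNorm n p q
              (fun j x => ENNReal.ofReal ((2:ℝ) ^ ((j:ℝ) * s)) *
                (‖conv f (fam n a (⇑φ0) (⇑φ) j) x‖₊ : ℝ≥0∞)) := by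
  obtain ⟨θ, l0, l, h1, h2, h3, h4⟩ := calderon n ha h φ0 φ hεφ hTφ
  have hc : ∀ (f : TD n) (g0 g : Sc n) (k : ℕ) x, conv f (fam n a g0 g k) x = f (RS n x (fm n a g0 g k)) := fun f g0 g k x =>
    hconv f _ x _ fun y => by rw [RS_apply, fm_fam]
  obtain ⟨C, hC, H⟩ := combine n (wtC n ha) (fun k l => sg_pos n a k l) (fun k z => VV_ww n a k z) hp hq hs
    (fun hh g => ∃ f : TD n, hh = (fun k x => ‖f (RS n x (fm n a φ0 φ k))‖ₑ) ∧ g = (fun k x => ‖f (RS n x (fm n a ψ0 ψ k))‖ₑ))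
    (fun A N => by
      obtain ⟨C, hC, H⟩ := i1 n ha h1 h2 h3 h4 A N
      refine ⟨C, hC, ?_⟩
      rintro _ _ ⟨f, rfl, rfl⟩
      exact H f)
    (fun A N => by
      obtain ⟨C, hC, H⟩ := i2 n hn ha (ψ0 := ψ0) h1 h2 h3 h4 Mψ hMψ hmomψ A N
      refine ⟨C, hC, ?_⟩
      rintro _ _ ⟨f, rfl, rfl⟩
      exact H f)
    (by
      rintro _ _ ⟨f, rfl, rfl⟩
      exact growth n ha φ0 φ f)
    (by
      rintro _ _ ⟨f, rfl, rfl⟩ k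
      exact (Fcont n f _).enorm.measurable)
  refine ⟨C.toReal + 1, by positivity, fun f => ?_⟩
  simp only [hc, T2_ofReal]
  refine (H _ _ ⟨f, rfl, rfl⟩).trans (mul_le_mul' ?_ le_rfl)
  rw [ENNReal.le_ofReal_iff_toReal_le hC (by positivity)]
  linarith

/-- comparison and equivalence of general convolution quasi-norms. -/
theorem stmt16 (n : ℕ) (hn : 1 ≤ n) (a : Fin n → ℝ) (ha : ∀ i, 1 ≤ a i)
    (anorm : RV n → ℝ) (h : IsAnorm n a anorm)
    (conv : TD n → (RV n → ℂ) → RV n → ℂ)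
    (hconv : ∀ (f : TD n) (g : RV n → ℂ) (x : RV n) (Ψ : SchwartzMap (RV n) ℂ),
      (∀ y, Ψ y = g (x - y)) → conv f g x = f Ψ)
    (ψ0 ψ φ0 φ : SchwartzMap (RV n) ℂ)
    (εψ εφ : ℝ) (hεψ : 0 < εψ) (hεφ : 0 < εφ)
    (hTψ : Tauber n anorm (⇑ψ0) (⇑ψ) εψ) (hTφ : Tauber n anorm (⇑φ0) (⇑φ) εφ)
    (Mψ : ℤ) (hMψ : -1 ≤ Mψ) (hmomψ : MomentCond n Mψ (⇑ψ))
    (p : Fin n → ℝ≥0∞) (hp : ∀ i, 0 < p i ∧ p i ≠ ∞) (q : ℝ≥0∞) (hq : 0 < q)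
    (s : ℝ) (hs : s < ((Mψ:ℝ) + 1) * ⨅ i, a i) :
    (∃ c : ℝ, 0 < c ∧
      ∀ f : TD n,
        seqNorm n p q
            (fun j x => ENNReal.ofReal ((2:ℝ) ^ ((j:ℝ) * s)) *
              (‖conv f (fam n a (⇑ψ0) (⇑ψ) j) x‖₊ : ℝ≥0∞))
          ≤ ENNReal.ofReal c *
            seqNorm n p q
              (fun j x => ENNReal.ofReal ((2:ℝ) ^ ((j:ℝ) * s)) *
                (‖conv f (fam n a (⇑φ0) (⇑φ) j) x‖₊ : ℝ≥0∞))) ∧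
    (∀ Mφ : ℤ, -1 ≤ Mφ → MomentCond n Mφ (⇑φ) → s < ((Mφ:ℝ) + 1) * (⨅ i, a i) →
      ∃ c₁ c₂ : ℝ, 0 < c₁ ∧ 0 < c₂ ∧
        ∀ f : TD n,
          seqNorm n p q
              (fun j x => ENNReal.ofReal ((2:ℝ) ^ ((j:ℝ) * s)) *
                (‖conv f (fam n a (⇑ψ0) (⇑ψ) j) x‖₊ : ℝ≥0∞))
            ≤ ENNReal.ofReal c₁ *
              seqNorm n p q
                (fun j x => ENNReal.ofReal ((2:ℝ) ^ ((j:ℝ) * s)) *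
                  (‖conv f (fam n a (⇑φ0) (⇑φ) j) x‖₊ : ℝ≥0∞)) ∧
          seqNorm n p q
              (fun j x => ENNReal.ofReal ((2:ℝ) ^ ((j:ℝ) * s)) *
                (‖conv f (fam n a (⇑φ0) (⇑φ) j) x‖₊ : ℝ≥0∞))
            ≤ ENNReal.ofReal c₂ *
              seqNorm n p q
                (fun j x => ENNReal.ofReal ((2:ℝ) ^ ((j:ℝ) * s)) *
                  (‖conv f (fam n a (⇑ψ0) (⇑ψ) j) x‖₊ : ℝ≥0∞)) ∧
          (seqNorm n p q
              (fun j x => ENNReal.ofReal ((2:ℝ) ^ ((j:ℝ) * s)) *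
                (‖conv f (fam n a (⇑ψ0) (⇑ψ) j) x‖₊ : ℝ≥0∞)) ≠ ∞ ↔
            seqNorm n p q
              (fun j x => ENNReal.ofReal ((2:ℝ) ^ ((j:ℝ) * s)) *
                (‖conv f (fam n a (⇑φ0) (⇑φ) j) x‖₊ : ℝ≥0∞)) ≠ ∞)) := by
  refine ⟨mainLem n hn a ha anorm h conv hconv ψ0 ψ φ0 φ εφ hεφ hTφ Mψ hMψ hmomψ p hp q hq s hs, fun Mφ hMφ hmomφ hsφ => ?_⟩
  obtain ⟨c₁, h1, H1⟩ := mainLem n hn a ha anorm h conv hconv ψ0 ψ φ0 φ εφ hεφ hTφ Mψ hMψ hmomψ p hp q hq s hs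
  obtain ⟨c₂, h2, H2⟩ := mainLem n hn a ha anorm h conv hconv φ0 φ ψ0 ψ εψ hεψ hTψ Mφ hMφ hmomφ p hp q hq s hsφ
  exact ⟨c₁, c₂, h1, h2, fun f => ⟨H1 f, H2 f,
    fun hf => ne_top_of_le_ne_top (ENNReal.mul_ne_top ENNReal.ofReal_ne_top hf) (H2 f),
    fun hf => ne_top_of_le_ne_top (ENNReal.mul_ne_top ENNReal.ofReal_ne_top hf) (H1 f)⟩⟩
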